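/- (Stillman's conjecture.) There is a function C : ℤ_+ × ℤ_+ × ℕ → ℤ_+, independent of N and of K, such that for every field K (not necessarily algebraically closed), every N, and every m × n matrix over R = K[x_1,…,x_N] whose entries are polynomials of degree at most d, the projective dimension over R of the cokernel of the R-linear map R^n → R^m given by the matrix is at most C(m,n,d). -/

import Mathlib

universe u v

/-- `ProjDimLE R c M` says that the `R`-module `M` has projective dimension at most `c`,
i.e. it admits a projective resolution `0 → P_c → ⋯ → P_0 → M → 0` of length `c`. -/
def ProjDimLE (R : Type u) [Ring R] :
    (c : ℕ) → (M : Type v) → [AddCommGroup M] → [Module R M] → Prop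
  | 0, M, _, _ => Module.Projective R M
  | c + 1, M, _, _ =>
      ∃ (P : Type v) (_ : AddCommGroup P) (_ : Module R P) (f : P →ₗ[R] M),
        Module.Projective R P ∧ Function.Surjective f ∧
          ProjDimLE R c (LinearMap.ker f)

namespace Stillman

open CategoryTheory TensorProduct

/-! ### Projective dimension -/

/-- The module `M` has projective dimension at most `c`. -/
abbrev PD (R : Type u) [Ring R] (M : Type u) [AddCommGroup M] [Module R M] (c : ℕ) : Prop :=
  HasProjectiveDimensionLE (ModuleCat.of R M) c

section PD

variable {R : Type u} [Ring R]

lemma pd_zero_iff (M : Type u) [AddCommGroup M] [Module R M] :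
    PD R M 0 ↔ Module.Projective R M := by
  rw [PD, ← projective_iff_hasProjectiveDimensionLE_zero, ← IsProjective.iff_projective]

lemma pd_mono {M : Type u} [AddCommGroup M] [Module R M] {c c' : ℕ} (h : c ≤ c')
    (hM : PD R M c) : PD R M c' :=
  by
  have : HasProjectiveDimensionLT (ModuleCat.of R M) (c + 1) := hM
  exact hasProjectiveDimensionLT_of_ge (ModuleCat.of R M) (c + 1) (c' + 1) (by omega)

lemma pd_congr {M N : Type u} [AddCommGroup M] [Module R M] [AddCommGroup N] [Module R N]
    (e : M ≃ₗ[R] N) {c : ℕ} (hM : PD R M c) : PD R N c :=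
  ModuleCat.hasProjectiveDimensionLE_of_linearEquiv (M := ModuleCat.of R M)
    (N := ModuleCat.of R N) e c

lemma pd_succ_iff {M P : Type u} [AddCommGroup M] [Module R M] [AddCommGroup P] [Module R P]
    [Module.Projective R P] (f : P →ₗ[R] M) (hf : Function.Surjective f) (c : ℕ) :
    PD R M (c + 1) ↔ PD R (LinearMap.ker f) c :=
  (LinearMap.shortExact_shortComplexKer hf).hasProjectiveDimensionLT_X₃_iff c
    ((IsProjective.iff_projective _).1 ‹_›)

lemma pd_of_exact {A B C : Type u} [AddCommGroup A] [Module R A] [AddCommGroup B] [Module R B]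
    [AddCommGroup C] [Module R C] (f : A →ₗ[R] B) (g : B →ₗ[R] C) (hfg : Function.Exact f g)
    (hf : Function.Injective f) (hg : Function.Surjective g) {c : ℕ} (hA : PD R A c)
    (hB : PD R B c) : PD R C (c + 1) := by
  have hS := ModuleCat.shortComplex_shortExact
    (ModuleCat.shortComplexOfCompEqZero f g hfg.linearMap_comp_eq_zero) hfg hf hg
  exact hS.hasProjectiveDimensionLT_X₃ (c + 1) hA (pd_mono (Nat.le_succ c) hB)

lemma projDimLE_of_pd {M : Type u} [AddCommGroup M] [Module R M] {c : ℕ} (h : PD R M c) :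
    ProjDimLE R c M := by
  induction c generalizing M with
  | zero => exact (pd_zero_iff M).1 h
  | succ c ih =>
    refine ⟨M →₀ R, inferInstance, inferInstance, Finsupp.linearCombination R id,
      inferInstance, Finsupp.linearCombination_id_surjective R M, ih ?_⟩
    exact (pd_succ_iff _ (Finsupp.linearCombination_id_surjective R M) c).1 h

end PD

section BaseChange

variable {R S : Type u} [CommRing R] [CommRing S] [Algebra R S]

lemma kerBaseChange_exact [Module.Flat R S] {M P : Type u} [AddCommGroup M] [Module R M]
    [AddCommGroup P] [Module R P] (f : P →ₗ[R] M) :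
    Function.Exact ((LinearMap.ker f).subtype.baseChange S) (f.baseChange S) :=
  Module.Flat.lTensor_exact S (LinearMap.exact_subtype_ker_map f)

/-- Base change along a flat map commutes with kernels. -/
noncomputable def kerBaseChange [Module.Flat R S] {M P : Type u} [AddCommGroup M] [Module R M]
    [AddCommGroup P] [Module R P] (f : P →ₗ[R] M) :
    S ⊗[R] (LinearMap.ker f) ≃ₗ[S] LinearMap.ker (f.baseChange S) :=
  (LinearEquiv.ofInjective ((LinearMap.ker f).subtype.baseChange S)
    (Module.Flat.lTensor_preserves_injective_linearMap _ (Submodule.injective_subtype _))).trans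
    (LinearEquiv.ofEq _ _ (LinearMap.exact_iff.1 (kerBaseChange_exact f)).symm)

lemma pd_baseChange [Module.Flat R S] {M : Type u} [AddCommGroup M] [Module R M] {c : ℕ}
    (h : PD R M c) : PD S (S ⊗[R] M) c := by
  induction c generalizing M with
  | zero =>
    rw [pd_zero_iff] at h ⊢
    infer_instance
  | succ c ih =>
    have hs := Finsupp.linearCombination_id_surjective R M
    rw [pd_succ_iff _ hs] at h
    refine (pd_succ_iff ((Finsupp.linearCombination R (id : M → M)).baseChange S)
      (LinearMap.lTensor_surjective S hs) c).2 (pd_congr (kerBaseChange _) (ih h))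

lemma pd_descent [IsNoetherianRing R] [Module.FaithfullyFlat R S] {M : Type u} [AddCommGroup M]
    [Module R M] [Module.Finite R M] {c : ℕ} (h : PD S (S ⊗[R] M) c) : PD R M c := by
  induction c generalizing M with
  | zero =>
    rw [pd_zero_iff] at h ⊢
    have : Module.Flat R M := Module.Flat.of_flat_tensorProduct R M S
    have : Module.FinitePresentation R M := Module.finitePresentation_of_finite R M
    exact Module.Flat.projective_of_finitePresentation
  | succ c ih =>
    obtain ⟨n, f, hf⟩ := Module.Finite.exists_fin' R M
    rw [pd_succ_iff f hf]
    have hs : Function.Surjective (f.baseChange S) := LinearMap.lTensor_surjective S hf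
    have h2 : PD S (LinearMap.ker (f.baseChange S)) c := (pd_succ_iff (f.baseChange S) hs c).1 h
    exact ih (pd_congr (kerBaseChange f).symm h2)

end BaseChange

section Hilbert

open Polynomial

variable {A : Type u} [CommRing A]

lemma pd_polynomialModule {M : Type u} [AddCommGroup M] [Module A M] {c : ℕ} (h : PD A M c) :
    PD A[X] (PolynomialModule A M) c :=
  pd_congr (PolynomialModule.polynomialTensorProductLEquivPolynomialModule A M)
    (pd_baseChange h)

lemma pd_polynomial {c : ℕ}
    (h : ∀ (M : Type u) [AddCommGroup M] [Module A M], PD A M c)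
    (M : Type u) [AddCommGroup M] [Module A[X] M] : PD A[X] M (c + 1) := by
  let _ : Module A M := Module.compHom M (C : A →+* A[X])
  have : IsScalarTower A A[X] M := IsScalarTower.of_algebraMap_smul fun r x => rfl
  let φ : PolynomialModule A M →ₗ[A[X]] M :=
    (LinearMap.liftBaseChange A[X] (LinearMap.id : M →ₗ[A] M)) ∘ₗ
      (PolynomialModule.polynomialTensorProductLEquivPolynomialModule A M).symm.toLinearMap
  have hφ : ∀ n m, φ (PolynomialModule.single A n m) = (X : A[X]) ^ n • m := by
    intro n m
    have : PolynomialModule.single A n m =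
        PolynomialModule.polynomialTensorProductLEquivPolynomialModule A M
          (((X : A[X]) ^ n) ⊗ₜ[A] m) := by
      simp [PolynomialModule.polynomialTensorProductLEquivPolynomialModule,
        ← monomial_one_right_eq_X_pow]
      rfl
    rw [this]
    simp [φ]
  let μ : M →ₗ[A] M := (LinearMap.lsmul A[X] M X).restrictScalars A
  let ψ : PolynomialModule A M →ₗ[A[X]] PolynomialModule A M :=
    LinearMap.lsmul A[X] _ X -
      { toFun := PolynomialModule.map A μ
        map_add' := map_add _
        map_smul' := fun p q => by
          have := PolynomialModule.map_smul A μ p q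
          simpa using this }
  have hψ : ∀ n m, ψ (PolynomialModule.single A n m) =
      PolynomialModule.single A (n + 1) m - PolynomialModule.single A n ((X : A[X]) • m) := by
    intro n m
    simp only [ψ, LinearMap.sub_apply, LinearMap.lsmul_apply, LinearMap.coe_mk, AddHom.coe_mk,
      PolynomialModule.map_single, ← monomial_one_one_eq_X,
      PolynomialModule.monomial_smul_single, one_smul, add_comm 1 n]
    rfl
  refine pd_of_exact ψ φ ?_ ?_ ?_ (pd_polynomialModule (h M)) (pd_polynomialModule (h M))
  · have hle : ∀ q, φ (ψ q) = 0 := by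
      intro q
      induction q using PolynomialModule.induction_linear with
      | zero => simp
      | add a b ha hb => rw [map_add, map_add, ha, hb, add_zero]
      | single n m => rw [hψ, map_sub, hφ, hφ, smul_smul, pow_succ, sub_self]
    have hcongr : ∀ q, ∃ q', q = PolynomialModule.single A 0 (φ q) + ψ q' := by
      intro q
      induction q using PolynomialModule.induction_linear with
      | zero => exact ⟨0, by simp⟩
      | add a b ha hb =>
        obtain ⟨a', ha⟩ := ha
        obtain ⟨b', hb⟩ := hb
        refine ⟨a' + b', ?_⟩
        rw [map_add, map_add, PolynomialModule.single_add]
        nth_rewrite 1 [ha, hb]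
        abel
      | single n m =>
        induction n generalizing m with
        | zero => exact ⟨0, by simp [hφ]⟩
        | succ n ih =>
          obtain ⟨q', h'⟩ := ih ((X : A[X]) • m)
          refine ⟨PolynomialModule.single A n m + q', ?_⟩
          have h2 : φ (PolynomialModule.single A (n + 1) m) =
              φ (PolynomialModule.single A n ((X : A[X]) • m)) := by
            rw [hφ, hφ, pow_succ, mul_smul]
          rw [map_add, hψ, h2, add_left_comm, ← h', sub_add_cancel]
    intro q
    constructor
    · intro hq
      obtain ⟨q', h'⟩ := hcongr q
      exact ⟨q', by rw [h', hq]; simp⟩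
    · rintro ⟨q', rfl⟩
      exact hle q'
  · rw [injective_iff_map_eq_zero]
    intro q hq
    have hc : ∀ n, q.coeff n = (X : A[X]) • q.coeff (n + 1) := by
      intro n
      have h1 : ∀ q : PolynomialModule A M,
          (ψ q).coeff (n + 1) = q.coeff n - (X : A[X]) • q.coeff (n + 1) := by
        intro q
        induction q using PolynomialModule.induction_linear with
        | zero => simp
        | add a b ha hb =>
          simp only [map_add, PolynomialModule.coeff_add, Finsupp.add_apply, ha, hb, smul_add]
          abel
        | single k m =>
          have h2 : ∀ a b : PolynomialModule A M, (a - b).coeff = a.coeff - b.coeff :=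
            fun a b => rfl
          rw [hψ, h2]
          simp only [PolynomialModule.coeff_single, Finsupp.sub_apply,
            Finsupp.single_apply, Nat.add_right_cancel_iff]
          split_ifs <;> simp
      have := h1 q
      rw [hq] at this
      simpa [sub_eq_zero] using this.symm
    have hz : ∀ k n, q.coeff.support.sup id < n + k → q.coeff n = 0 := by
      intro k
      induction k with
      | zero =>
        intro n hn
        by_contra hne
        exact absurd (Finset.le_sup (f := id) (Finsupp.mem_support_iff.2 hne)) (by simpa using hn)
      | succ k ih =>
        intro n hn
        rw [hc, ih (n + 1) (by omega), smul_zero]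
    rw [← PolynomialModule.coeff_eq_zero]
    ext n
    exact hz (q.coeff.support.sup id + 1) n (by omega)
  · intro m
    exact ⟨PolynomialModule.single A 0 m, by simp [hφ]⟩

attribute [local instance] RingHomInvPair.of_ringEquiv in
lemma pd_of_ringEquiv {A B : Type u} [CommRing A] [CommRing B] (e : A ≃+* B) {c : ℕ}
    (h : ∀ (M : Type u) [AddCommGroup M] [Module A M], PD A M c)
    (M : Type u) [AddCommGroup M] [Module B M] : PD B M c := by
  let _ : Module A M := Module.compHom M (e : A →+* B)
  have := h M
  let e' : M ≃ₛₗ[RingHomClass.toRingHom e] M :=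
    { AddEquiv.refl M with map_smul' := fun r x => rfl }
  exact ModuleCat.hasProjectiveDimensionLE_of_semiLinearEquiv (M := ModuleCat.of A M)
    (N := ModuleCat.of B M) e e' c

/-- **Hilbert's syzygy theorem.** -/
theorem pd_mvPolynomial (K : Type u) [Field K] (n : ℕ) (M : Type u) [AddCommGroup M]
    [Module (MvPolynomial (Fin n) K) M] : PD (MvPolynomial (Fin n) K) M n := by
  induction n generalizing M with
  | zero =>
    refine pd_of_ringEquiv (MvPolynomial.isEmptyRingEquiv K (Fin 0)).symm ?_ M
    intro M _ _
    rw [pd_zero_iff]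
    infer_instance
  | succ n ih =>
    exact pd_of_ringEquiv (MvPolynomial.finSuccEquiv K n).toRingEquiv.symm
      (fun M _ _ => pd_polynomial ih M) M

end Hilbert

section Matrix

variable {A R : Type u} [CommRing A] [CommRing R] [Algebra A R] {m n : ℕ}

/-- The cokernel of a matrix. -/
abbrev Coker {R : Type u} [CommRing R] {m n : ℕ} (Q : Matrix (Fin m) (Fin n) R) : Type u :=
  (Fin m → R) ⧸ LinearMap.range Q.mulVecLin

variable (R) in
/-- The cokernel of a matrix commutes with base change. -/
noncomputable def cokerBaseChange (Q : Matrix (Fin m) (Fin n) A) :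
    Coker (Q.map (algebraMap A R)) ≃ₗ[R] R ⊗[A] Coker Q := by
  let e := TensorProduct.piScalarRight A R R (Fin m)
  let e' := TensorProduct.piScalarRight A R R (Fin n)
  let g : (Fin m → R) →ₗ[R] R ⊗[A] Coker Q :=
    ((LinearMap.range Q.mulVecLin).mkQ.baseChange R) ∘ₗ e.symm.toLinearMap
  have hg : Function.Surjective g :=
    (LinearMap.lTensor_surjective R (Submodule.mkQ_surjective _)).comp e.symm.surjective
  refine (Submodule.quotEquivOfEq _ _ ?_).trans (g.quotKerEquivOfSurjective hg)
  have hcomp : e.toLinearMap ∘ₗ Q.mulVecLin.baseChange R =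
      (Q.map (algebraMap A R)).mulVecLin ∘ₗ e'.toLinearMap := by
    ext i j
    simp [e, e', Matrix.mulVec, dotProduct, Pi.single_apply, Algebra.algebraMap_eq_smul_one]
  have hex : Function.Exact (Q.mulVecLin.baseChange R)
      ((LinearMap.range Q.mulVecLin).mkQ.baseChange R) :=
    lTensor_exact R (LinearMap.exact_map_mkQ_range _) (Submodule.mkQ_surjective _)
  have h1 : LinearMap.range (Q.map (algebraMap A R)).mulVecLin =
      LinearMap.range ((Q.map (algebraMap A R)).mulVecLin ∘ₗ e'.toLinearMap) :=
    (LinearMap.range_comp_of_range_eq_top _ e'.range).symm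
  rw [h1, ← hcomp]
  ext x
  constructor
  · rintro ⟨y, rfl⟩
    simpa [g] using hex.apply_apply_eq_zero y
  · intro hx
    obtain ⟨y, hy⟩ := (hex (e.symm x)).1 hx
    exact ⟨y, by simp [hy]⟩

lemma pd_coker_map [Module.Flat A R] (Q : Matrix (Fin m) (Fin n) A) {c : ℕ}
    (h : PD A (Coker Q) c) : PD R (Coker (Q.map (algebraMap A R))) c :=
  pd_congr (cokerBaseChange R Q).symm (pd_baseChange h)

lemma pd_coker_of_map [IsNoetherianRing A] [Module.FaithfullyFlat A R]
    (Q : Matrix (Fin m) (Fin n) A) {c : ℕ}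
    (h : PD R (Coker (Q.map (algebraMap A R))) c) : PD A (Coker Q) c :=
  pd_descent (S := R) (pd_congr (cokerBaseChange R Q) h)

attribute [local instance] MvPolynomial.algebraMvPolynomial in
lemma pd_coker_of_field_extension {K L : Type u} [Field K] [Field L] [Algebra K L] {N : ℕ}
    (Q : Matrix (Fin m) (Fin n) (MvPolynomial (Fin N) K)) {c : ℕ}
    (h : PD (MvPolynomial (Fin N) L) (Coker (Q.map (MvPolynomial.map (algebraMap K L)))) c) :
    PD (MvPolynomial (Fin N) K) (Coker Q) c := by
  have : Module.Free (MvPolynomial (Fin N) K) (MvPolynomial (Fin N) L) :=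
    Module.Free.of_equiv (Algebra.IsPushout.equiv K (MvPolynomial (Fin N) K) L
      (MvPolynomial (Fin N) L)).toLinearEquiv
  exact pd_coker_of_map (R := MvPolynomial (Fin N) L) Q h

end Matrix

end Stillman

namespace Stillman

open CategoryTheory Abelian

/-! ### Vanishing of Ext and freeness -/

section Ext

variable {B : Type u} [CommRing B]

/-- All extensions of the given degree vanish. -/
abbrev ExtZero (M k : Type u) [AddCommGroup M] [Module B M] [AddCommGroup k] [Module B k]
    (i : ℕ) : Prop :=
  ∀ e : Ext.{u} (ModuleCat.of B M) (ModuleCat.of B k) i, e = 0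

lemma extZero_of_pd {M k : Type u} [AddCommGroup M] [Module B M] [AddCommGroup k] [Module B k]
    {c i : ℕ} (h : PD B M c) (hi : c < i) : ExtZero (B := B) M k i := by
  have : HasProjectiveDimensionLT (ModuleCat.of B M) (c + 1) := h
  exact fun e => e.eq_zero_of_hasProjectiveDimensionLT (c + 1) hi

lemma extZero_of_exact {M M' k : Type u} [AddCommGroup M] [Module B M] [AddCommGroup M']
    [Module B M'] [AddCommGroup k] [Module B k] (a : M →ₗ[B] M) (q : M →ₗ[B] M')
    (haq : Function.Exact a q) (ha : Function.Injective a) (hq : Function.Surjective q)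
    (n : ℕ) (hn : a ^ n ∈ Submodule.span B
      {f : M →ₗ[B] M | ∃ (b : B) (g : M →ₗ[B] M), (∀ x : k, b • x = 0) ∧ f = b • g})
    {i : ℕ} (h : ExtZero (B := B) M' k (i + 1)) : ExtZero (B := B) M k i := by
  have hS := ModuleCat.shortComplex_shortExact
    (ModuleCat.shortComplexOfCompEqZero a q haq.linearMap_comp_eq_zero) haq ha hq
  have hdiv : ∀ (m : ℕ) (e : Ext.{u} (ModuleCat.of B M) (ModuleCat.of B k) i),
      ∃ e' : Ext.{u} (ModuleCat.of B M) (ModuleCat.of B k) i,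
        e = (Ext.mk₀ (ModuleCat.ofHom (a ^ m))).comp e' (zero_add i) := by
    intro m
    induction m with
    | zero =>
      intro e
      refine ⟨e, ?_⟩
      have : ModuleCat.ofHom (a ^ 0) = 𝟙 (ModuleCat.of B M) := rfl
      rw [this, Ext.mk₀_id_comp]
    | succ m ih =>
      intro e
      obtain ⟨e', rfl⟩ := ih e
      obtain ⟨e'', rfl⟩ := Ext.contravariant_sequence_exact₁ hS _ e' (add_comm 1 i) (h _)
      refine ⟨e'', ?_⟩
      rw [Ext.mk₀_comp_mk₀_assoc, pow_succ']
      rfl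
  have hkill : ∀ f ∈ Submodule.span B
      {f : M →ₗ[B] M | ∃ (b : B) (g : M →ₗ[B] M), (∀ x : k, b • x = 0) ∧ f = b • g},
      ∀ e : Ext.{u} (ModuleCat.of B M) (ModuleCat.of B k) i,
        (Ext.mk₀ (ModuleCat.ofHom f)).comp e (zero_add i) = 0 := by
    intro f hf
    induction hf using Submodule.span_induction with
    | mem f hf =>
      obtain ⟨b, g, hb, rfl⟩ := hf
      intro e
      have h1 : ModuleCat.ofHom (b • g) = b • ModuleCat.ofHom g := rfl
      rw [h1, Ext.mk₀_smul, Ext.smul_comp, ← Ext.comp_smul, Ext.smul_eq_comp_mk₀ e]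
      have h2 : b • 𝟙 (ModuleCat.of B k) = 0 := by
        ext x
        exact hb x
      rw [h2, Ext.mk₀_zero, Ext.comp_zero, Ext.comp_zero]
    | zero =>
      intro e
      have h1 : ModuleCat.ofHom (0 : M →ₗ[B] M) = 0 := rfl
      rw [h1, Ext.mk₀_zero, Ext.zero_comp]
    | add f g _ _ hf hg =>
      intro e
      have h1 : ModuleCat.ofHom (f + g) = ModuleCat.ofHom f + ModuleCat.ofHom g := rfl
      rw [h1, Ext.mk₀_add, Ext.add_comp, hf, hg, add_zero]
    | smul b f _ hf =>
      intro e
      have h1 : ModuleCat.ofHom (b • f) = b • ModuleCat.ofHom f := rfl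
      rw [h1, Ext.mk₀_smul, Ext.smul_comp, hf, smul_zero]
  intro e
  obtain ⟨e', rfl⟩ := hdiv n e
  exact hkill _ hn e'

lemma injective_of_extZero [IsDomain B] [IsNoetherianRing B] {I : Ideal B} [hI : I.IsMaximal]
    {E : Type} [Finite E] {M : Type u} [AddCommGroup M] [Module B M]
    (f : (E → B) →ₗ[B] M) (hf : Function.Surjective f)
    (hker : LinearMap.ker f ≤ I • (⊤ : Submodule B (E → B)))
    (h : ExtZero (B := B) M (B ⧸ I) 1) : Function.Injective f := by
  have hS := LinearMap.shortExact_shortComplexKer hf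
  have hext : ∀ g : LinearMap.ker f →ₗ[B] B ⧸ I, g = 0 := by
    intro g
    obtain ⟨e, he⟩ := Ext.contravariant_sequence_exact₁ hS (ModuleCat.of B (B ⧸ I))
      (Ext.mk₀ (ModuleCat.ofHom g)) (add_zero 1) (h _)
    obtain ⟨g', rfl⟩ := Ext.homEquiv₀.symm.surjective e
    rw [Ext.homEquiv₀_symm_apply, Ext.mk₀_comp_mk₀] at he
    have he' := congrArg ModuleCat.Hom.hom (Ext.homEquiv₀.symm.injective he)
    ext x
    have h1 : g'.hom (x : E → B) = g x := congrArg (fun φ => φ x) he'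
    rw [← h1]
    have h2 : I • (⊤ : Submodule B (E → B)) ≤ LinearMap.ker g'.hom := by
      rw [Submodule.smul_le]
      intro r hr n _
      rw [LinearMap.mem_ker, map_smul]
      obtain ⟨y, hy⟩ := Ideal.Quotient.mk_surjective (g'.hom n)
      rw [← hy]
      exact Ideal.Quotient.eq_zero_iff_mem.2 (I.mul_mem_right _ hr)
    exact h2 (hker x.2)
  have hZ : (⊤ : Submodule B (LinearMap.ker f)) ≤ I • (⊤ : Submodule B (LinearMap.ker f)) := by
    intro x _
    let _ : Field (B ⧸ I) := Ideal.Quotient.field I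
    rw [← Submodule.Quotient.mk_eq_zero, ← Module.forall_dual_apply_eq_zero_iff (B ⧸ I)]
    intro φ
    exact LinearMap.congr_fun (hext ((φ.restrictScalars B) ∘ₗ Submodule.mkQ _)) x
  obtain ⟨r, hr1, hr⟩ := Submodule.exists_sub_one_mem_and_smul_eq_zero_of_fg_of_le_smul I
    (⊤ : Submodule B (LinearMap.ker f)) (IsNoetherian.noetherian _) hZ
  rw [← LinearMap.ker_eq_bot, Submodule.eq_bot_iff]
  intro x hx
  have hr0 : r ≠ 0 := by
    rintro rfl
    apply hI.ne_top
    rw [Ideal.eq_top_iff_one]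
    simpa using I.neg_mem hr1
  have := hr ⟨x, hx⟩ trivial
  simpa [hr0] using congrArg Subtype.val this

end Ext

/-! ### Homogeneous systems of parameters -/

section Graded

open MvPolynomial

variable {K : Type u} [Field K] {σ : Type v}

attribute [local instance] MvPolynomial.gradedAlgebra in
lemma homogeneousComponent_mul_of_le {f g : MvPolynomial σ K} {k d : ℕ} (hf : f.IsHomogeneous k)
    (h : k ≤ d) :
    homogeneousComponent d (f * g) = f * homogeneousComponent (d - k) g := by
  have := DirectSum.coe_decompose_mul_of_left_mem_of_le (homogeneousSubmodule σ K) (b := g)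
    ((mem_homogeneousSubmodule k f).2 hf) h
  have hd : ∀ p : MvPolynomial σ K,
      (DirectSum.decompose (homogeneousSubmodule σ K) p d : MvPolynomial σ K) =
        homogeneousComponent d p := fun p => decomposition.decompose'_apply p d
  have hd' : ∀ p : MvPolynomial σ K,
      (DirectSum.decompose (homogeneousSubmodule σ K) p (d - k) : MvPolynomial σ K) =
        homogeneousComponent (d - k) p := fun p => decomposition.decompose'_apply p (d - k)
  rwa [hd, hd'] at this

attribute [local instance] MvPolynomial.gradedAlgebra in
lemma homogeneousComponent_mul_of_lt {f g : MvPolynomial σ K} {k d : ℕ} (hf : f.IsHomogeneous k)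
    (h : d < k) : homogeneousComponent d (f * g) = 0 := by
  have := DirectSum.coe_decompose_mul_of_left_mem_of_not_le (homogeneousSubmodule σ K) (b := g)
    ((mem_homogeneousSubmodule k f).2 hf) (not_le.2 h)
  exact (decomposition.decompose'_apply (f * g) d).symm.trans this

attribute [local instance] MvPolynomial.gradedAlgebra in
lemma homogeneousComponent_mem_span {I : Ideal (MvPolynomial σ K)} {s : Set (MvPolynomial σ K)}
    (hs : ∀ f ∈ s, ∃ k, f.IsHomogeneous k) (hI : I = Ideal.span s) {f : MvPolynomial σ K}
    (hf : f ∈ I) (d : ℕ) : homogeneousComponent d f ∈ I := by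
  subst hI
  have h := Ideal.homogeneous_span (homogeneousSubmodule σ K) s fun f hf => by
    obtain ⟨k, hk⟩ := hs f hf
    exact ⟨k, hk⟩
  exact (mem_iff_homogeneousComponent_mem h f).1 hf d

/-- Graded Nakayama lemma. -/
lemma eq_top_of_span_monomials {ι : Type*} [Finite ι] (θ : ι → MvPolynomial σ K) (δ : ι → ℕ)
    (hδ : ∀ l, 0 < δ l) (hθ : ∀ l, (θ l).IsHomogeneous (δ l)) (E : Set (σ →₀ ℕ))
    (hE : ∀ f : MvPolynomial σ K, ∃ g ∈ Submodule.span K ((fun e => monomial e (1 : K)) '' E),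
      f - g ∈ Ideal.span (Set.range θ))
    (T : Submodule K (MvPolynomial σ K)) (hT : ∀ l, ∀ f ∈ T, θ l * f ∈ T)
    (hET : ∀ e ∈ E, monomial e (1 : K) ∈ T) : T = ⊤ := by
  have := Fintype.ofFinite ι
  have key : ∀ d, ∀ f : MvPolynomial σ K, f.IsHomogeneous d → f ∈ T := by
    intro d
    induction d using Nat.strong_induction_on with
    | _ d ih =>
      intro f hf
      obtain ⟨g, hg, hfg⟩ := hE f
      obtain ⟨c, hc⟩ := Ideal.mem_span_range_iff_exists_fun.1 hfg
      have h1 : f = homogeneousComponent d g + ∑ l, homogeneousComponent d (θ l * c l) := by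
        rw [← map_sum, ← map_add]
        simp_rw [mul_comm (θ _)]
        rw [hc, add_sub_cancel, homogeneousComponent_of_mem hf, if_pos rfl]
      rw [h1]
      refine T.add_mem ?_ (T.sum_mem fun l _ => ?_)
      · refine Submodule.span_induction (p := fun g _ => homogeneousComponent d g ∈ T)
          ?_ ?_ ?_ ?_ hg
        · rintro _ ⟨e, he, rfl⟩
          have h2 := homogeneousComponent_of_mem (m := d)
            ((mem_homogeneousSubmodule _ _).2 (isHomogeneous_monomial (n := e.degree) (1 : K) rfl))
          rw [h2]
          split_ifs
          · exact hET e he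
          · exact T.zero_mem
        · rw [map_zero]
          exact T.zero_mem
        · intro a b _ _ ha hb
          rw [map_add]
          exact T.add_mem ha hb
        · intro r a _ ha
          rw [map_smul]
          exact T.smul_mem r ha
      · rcases le_or_gt (δ l) d with h | h
        · rw [homogeneousComponent_mul_of_le (hθ l) h]
          exact hT l _ (ih _ (by have := hδ l; omega) _ (homogeneousComponent_isHomogeneous _ _))
        · rw [homogeneousComponent_mul_of_lt (hθ l) h]
          exact T.zero_mem
  rw [eq_top_iff]
  intro f _
  rw [← sum_homogeneousComponent f]
  exact T.sum_mem fun d _ => key d _ (homogeneousComponent_isHomogeneous _ _)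

lemma exists_X_pow_mem {I : Ideal (MvPolynomial σ K)} {s : Set (MvPolynomial σ K)}
    (hs : ∀ f ∈ s, ∃ k, f.IsHomogeneous k) (hI : I = Ideal.span s)
    [Module.Finite K (MvPolynomial σ K ⧸ I)] (j : σ) : ∃ n, (X j : MvPolynomial σ K) ^ n ∈ I := by
  obtain ⟨p, hp, hp0⟩ := Algebra.IsIntegral.isIntegral (R := K)
    (Ideal.Quotient.mk I (X j : MvPolynomial σ K))
  refine ⟨p.natDegree, ?_⟩
  have h1 : Polynomial.aeval (X j : MvPolynomial σ K) p ∈ I := by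
    rw [← Ideal.Quotient.eq_zero_iff_mem, ← hp0]
    exact (Polynomial.aeval_algHom_apply (Ideal.Quotient.mkₐ K I) (X j) p).symm
  have h2 := homogeneousComponent_mem_span hs hI h1 p.natDegree
  rw [Polynomial.aeval_eq_sum_range, map_sum, Finset.sum_eq_single p.natDegree] at h2
  · rw [map_smul, homogeneousComponent_of_mem ((mem_homogeneousSubmodule _ _).2
      (isHomogeneous_X_pow j p.natDegree)), if_pos rfl, Polynomial.coeff_natDegree, hp.leadingCoeff, one_smul] at h2
    exact h2
  · intro k _ hk
    rw [map_smul, homogeneousComponent_of_mem ((mem_homogeneousSubmodule _ _).2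
      (isHomogeneous_X_pow j k)), if_neg hk.symm, smul_zero]
  · simp

end Graded

end Stillman

namespace Stillman
open MvPolynomial

section Free

variable {K : Type u} [Field K] {N : ℕ} {ι : Type} [Fintype ι]

variable (K N) in
/-- The ideal generated by the first variables. -/
noncomputable abbrev xIdeal (j : ℕ) : Ideal (MvPolynomial (Fin N) K) :=
  Ideal.span (X '' {l : Fin N | l.val < j})

lemma constantCoeff_mem_span (p : MvPolynomial ι K) (hp : constantCoeff p = 0) :
    p ∈ Ideal.span (Set.range (X : ι → MvPolynomial ι K)) := by
  rw [← Set.image_univ, mem_ideal_span_X_image]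
  intro m hm
  by_contra! h
  have : m = 0 := by
    ext i
    simpa using h i
  rw [this, mem_support_iff] at hm
  exact hm hp

instance isMaximal_span_X : (Ideal.span (Set.range (X : ι → MvPolynomial ι K))).IsMaximal := by
  have h : Ideal.span (Set.range (X : ι → MvPolynomial ι K)) =
      RingHom.ker (constantCoeff : MvPolynomial ι K →+* K) := by
    apply le_antisymm
    · rw [Ideal.span_le]
      rintro _ ⟨i, rfl⟩
      simp [RingHom.mem_ker]
    · intro p hp
      exact constantCoeff_mem_span p hp
  rw [h]
  exact RingHom.ker_isMaximal_of_surjective _ fun x => ⟨C x, constantCoeff_C _ x⟩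

lemma pd_mvPolynomial_card (hι : Nat.card ι = N) (M : Type u) [AddCommGroup M]
    [Module (MvPolynomial ι K) M] : PD (MvPolynomial ι K) M N := by
  have e : Fin N ≃ ι := (Fintype.equivFinOfCardEq (by rw [← hι, Nat.card_eq_fintype_card])).symm
  exact pd_of_ringEquiv (renameEquiv K e).toRingEquiv
    (fun M _ _ => pd_mvPolynomial K N M) M

variable [Algebra (MvPolynomial ι K) (MvPolynomial (Fin N) K)]
  {θ : ι → MvPolynomial (Fin N) K}

lemma extZero_quotient_step (hX : ∀ l, algebraMap (MvPolynomial ι K) (MvPolynomial (Fin N) K) (X l) = θ l)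
    (hθ : ∀ l, ∃ k, (θ l).IsHomogeneous k)
    [Module.Finite K (MvPolynomial (Fin N) K ⧸ Ideal.span (Set.range θ))]
    (j : ℕ) (hj : j < N) (i : ℕ)
    (h : ExtZero (B := MvPolynomial ι K) (MvPolynomial (Fin N) K ⧸
      xIdeal K N (j + 1))
      (MvPolynomial ι K ⧸ Ideal.span (Set.range (X : ι → MvPolynomial ι K))) (i + 1)) :
    ExtZero (B := MvPolynomial ι K) (MvPolynomial (Fin N) K ⧸
      xIdeal K N j)
      (MvPolynomial ι K ⧸ Ideal.span (Set.range (X : ι → MvPolynomial ι K))) i := by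
  set J : Ideal (MvPolynomial (Fin N) K) := xIdeal K N j with hJ
  set J' : Ideal (MvPolynomial (Fin N) K) := xIdeal K N (j + 1) with hJ'
  have hset : {l : Fin N | l.val < j + 1} = insert ⟨j, hj⟩ {l : Fin N | l.val < j} := by
    ext l
    simp only [Set.mem_ofPred_eq, Set.mem_insert_iff, Fin.ext_iff]
    omega
  have hJJ' : J' = Ideal.span {X ⟨j, hj⟩} ⊔ J := by
    rw [hJ', xIdeal, hset, Set.image_insert_eq, Ideal.span_insert]
  have hle : J ≤ J' := hJJ' ▸ le_sup_right
  obtain ⟨n, hn⟩ := exists_X_pow_mem (I := Ideal.span (Set.range θ)) (by rintro _ ⟨l, rfl⟩; exact hθ l) rfl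
    (⟨j, hj⟩ : Fin N)
  refine extZero_of_exact (LinearMap.mulLeft (MvPolynomial ι K) (Ideal.Quotient.mk J (X ⟨j, hj⟩)))
    (Ideal.Quotient.factorₐ (MvPolynomial ι K) hle).toLinearMap ?_ ?_ ?_ n ?_ h
  · intro x
    obtain ⟨x, rfl⟩ := Ideal.Quotient.mk_surjective x
    constructor
    · intro hx
      have hx : x ∈ J' := Ideal.Quotient.eq_zero_iff_mem.1 hx
      rw [hJJ', Submodule.mem_sup] at hx
      obtain ⟨y, hy, z, hz, rfl⟩ := hx
      obtain ⟨c, rfl⟩ := Ideal.mem_span_singleton.1 hy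
      refine ⟨Ideal.Quotient.mk J c, ?_⟩
      rw [LinearMap.mulLeft_apply, ← map_mul, Ideal.Quotient.eq]
      simpa using hz
    · rintro ⟨y, hy⟩
      obtain ⟨y, rfl⟩ := Ideal.Quotient.mk_surjective y
      rw [← hy]
      refine Ideal.Quotient.eq_zero_iff_mem.2 (J'.mul_mem_right _ ?_)
      rw [hJJ']
      exact Ideal.mem_sup_left (Ideal.mem_span_singleton_self _)
  · rw [← LinearMap.ker_eq_bot, Submodule.eq_bot_iff]
    intro x hx
    obtain ⟨x, rfl⟩ := Ideal.Quotient.mk_surjective x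
    have hx : X ⟨j, hj⟩ * x ∈ J := Ideal.Quotient.eq_zero_iff_mem.1 hx
    refine Ideal.Quotient.eq_zero_iff_mem.2 ?_
    rw [hJ, xIdeal, mem_ideal_span_X_image] at hx ⊢
    intro m hm
    obtain ⟨l, hl, hl0⟩ := hx (Finsupp.single ⟨j, hj⟩ 1 + m) (by
      rw [mem_support_iff, coeff_X_mul]
      exact mem_support_iff.1 hm)
    refine ⟨l, hl, ?_⟩
    have : (⟨j, hj⟩ : Fin N) ≠ l := by
      rintro rfl
      exact lt_irrefl j hl
    simpa [this] using hl0
  · intro y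
    obtain ⟨y, rfl⟩ := Ideal.Quotient.mk_surjective y
    exact ⟨Ideal.Quotient.mk J y, rfl⟩
  · rw [LinearMap.pow_mulLeft, ← map_pow]
    obtain ⟨c, hc⟩ := Ideal.mem_span_range_iff_exists_fun.1 hn
    have h1 : LinearMap.mulLeft (MvPolynomial ι K) (Ideal.Quotient.mk J (X ⟨j, hj⟩ ^ n)) =
        ∑ l, (X l : MvPolynomial ι K) •
          LinearMap.mulLeft (MvPolynomial ι K) (Ideal.Quotient.mk J (c l)) := by
      refine LinearMap.ext fun x => ?_
      have h2 : ∀ l, (X l : MvPolynomial ι K) • (Ideal.Quotient.mk J (c l) * x) =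
          Ideal.Quotient.mk J (c l * θ l) * x := by
        intro l
        obtain ⟨y, rfl⟩ := Ideal.Quotient.mk_surjective x
        have h3 : (X l : MvPolynomial ι K) • (c l * y) = c l * θ l * y := by
          rw [Algebra.smul_def, hX l]
          ring
        rw [← map_mul, ← map_mul, ← h3]
        rfl
      rw [LinearMap.sum_apply]
      simp only [LinearMap.smul_apply, LinearMap.mulLeft_apply]
      rw [Finset.sum_congr rfl fun l _ => h2 l, ← Finset.sum_mul, ← map_sum, hc]
    rw [h1]
    refine Submodule.sum_mem _ fun l _ => Submodule.subset_span ⟨X l, _, fun x => ?_, rfl⟩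
    obtain ⟨x, rfl⟩ := Ideal.Quotient.mk_surjective x
    exact Ideal.Quotient.eq_zero_iff_mem.2 (Ideal.mul_mem_right _ _ (Ideal.subset_span ⟨l, rfl⟩))

lemma extZero_quotient (hι : Nat.card ι = N)
    (hX : ∀ l, algebraMap (MvPolynomial ι K) (MvPolynomial (Fin N) K) (X l) = θ l)
    (hθ : ∀ l, ∃ k, (θ l).IsHomogeneous k)
    [Module.Finite K (MvPolynomial (Fin N) K ⧸ Ideal.span (Set.range θ))]
    (t j : ℕ) (hj : j + t = N) (i : ℕ) (hi : j < i) :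
    ExtZero (B := MvPolynomial ι K) (MvPolynomial (Fin N) K ⧸
      xIdeal K N j)
      (MvPolynomial ι K ⧸ Ideal.span (Set.range (X : ι → MvPolynomial ι K))) i := by
  induction t generalizing j i with
  | zero => exact extZero_of_pd (pd_mvPolynomial_card hι _) (by omega)
  | succ t ih => exact extZero_quotient_step hX hθ j (by omega) i (ih _ (by omega) _ (by omega))

/-- A polynomial ring is free over the subring generated by a homogeneous system of parameters. -/
theorem free_of_hsop [IsScalarTower K (MvPolynomial ι K) (MvPolynomial (Fin N) K)]
    (hι : Nat.card ι = N)
    (hX : ∀ l, algebraMap (MvPolynomial ι K) (MvPolynomial (Fin N) K) (X l) = θ l)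
    (δ : ι → ℕ) (hδ : ∀ l, 0 < δ l) (hθ : ∀ l, (θ l).IsHomogeneous (δ l))
    [Module.Finite K (MvPolynomial (Fin N) K ⧸ Ideal.span (Set.range θ))] :
    Module.Free (MvPolynomial ι K) (MvPolynomial (Fin N) K) := by
  have hext := extZero_quotient hι hX (fun l => ⟨_, hθ l⟩) N 0 (zero_add N) 1 one_pos
  set J : Ideal (MvPolynomial (Fin N) K) := xIdeal K N 0 with hJ
  have hJ0 : J = ⊥ := by
    have : {l : Fin N | l.val < 0} = ∅ := by ext; simp
    rw [hJ, xIdeal, this, Set.image_empty, Ideal.span_empty]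
  set π := Ideal.Quotient.mkₐ K (Ideal.span (Set.range θ)) with hπ
  obtain ⟨κ, a, ha, hspan, hli⟩ := exists_linearIndependent' K
    (fun e : Fin N →₀ ℕ => π (monomial e (1 : K)))
  have : Finite κ := hli.finite
  have := Fintype.ofFinite κ
  let f : (κ → MvPolynomial ι K) →ₗ[MvPolynomial ι K] MvPolynomial (Fin N) K :=
    Fintype.linearCombination (MvPolynomial ι K) (fun e => monomial (a e) (1 : K))
  have hC : ∀ p : MvPolynomial ι K, π (algebraMap _ _ p) = π (C (constantCoeff p)) := by
    intro p
    have h1 := constantCoeff_mem_span (p - C (constantCoeff p)) (by simp)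
    have h2 : algebraMap (MvPolynomial ι K) (MvPolynomial (Fin N) K) (p - C (constantCoeff p)) ∈
        Ideal.span (Set.range θ) := by
      have := Ideal.mem_map_of_mem (algebraMap (MvPolynomial ι K) (MvPolynomial (Fin N) K)) h1
      rw [Ideal.map_span] at this
      refine Ideal.span_mono ?_ this
      rintro _ ⟨_, ⟨l, rfl⟩, rfl⟩
      exact ⟨l, (hX l).symm⟩
    rw [map_sub] at h2
    have h3 : algebraMap (MvPolynomial ι K) (MvPolynomial (Fin N) K) (C (constantCoeff p)) =
        C (constantCoeff p) :=
      (IsScalarTower.algebraMap_apply K (MvPolynomial ι K) (MvPolynomial (Fin N) K) _).symm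
    rw [h3] at h2
    exact Ideal.Quotient.eq.2 h2
  have hker : LinearMap.ker f ≤ Ideal.span (Set.range (X : ι → MvPolynomial ι K)) •
      (⊤ : Submodule (MvPolynomial ι K) (κ → MvPolynomial ι K)) := by
    intro c hc
    have h1 : ∑ e, constantCoeff (c e) • π (monomial (a e) (1 : K)) = 0 := by
      have h2 := congrArg π (LinearMap.mem_ker.1 hc)
      rw [map_zero, Fintype.linearCombination_apply, map_sum] at h2
      rw [← h2]
      refine Finset.sum_congr rfl fun e _ => ?_
      rw [Algebra.smul_def (c e), map_mul, hC, ← map_mul, ← smul_eq_C_mul, map_smul]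
    have h2 := Fintype.linearIndependent_iff.1 hli _ h1
    classical
    rw [pi_eq_sum_univ' c]
    exact Submodule.sum_mem _ fun e _ => Submodule.smul_mem_smul (constantCoeff_mem_span _ (h2 e)) trivial
  have hsurj : Function.Surjective f := by
    rw [← LinearMap.range_eq_top]
    have := eq_top_of_span_monomials θ δ hδ hθ (Set.range a) ?_
      ((LinearMap.range f).restrictScalars K) ?_ ?_
    · exact (Submodule.restrictScalars_eq_top_iff K (MvPolynomial ι K) (MvPolynomial (Fin N) K)).1 this
    · intro p
      have h1 : π p ∈ Submodule.span K (Set.range ((fun e : Fin N →₀ ℕ => π (monomial e (1 : K))) ∘ a)) := by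
        rw [hspan]
        have h3 : p ∈ Submodule.span K (Set.range fun e : Fin N →₀ ℕ => monomial e (1 : K)) := by
          have := (basisMonomials (Fin N) K).span_eq
          rw [coe_basisMonomials] at this
          rw [this]
          trivial
        have h4 := Submodule.mem_map_of_mem (f := π.toLinearMap) h3
        rw [Submodule.map_span, ← Set.range_comp] at h4
        exact h4
      have h2 : Set.range ((fun e : Fin N →₀ ℕ => π (monomial e (1 : K))) ∘ a) =
          π.toLinearMap '' ((fun e => monomial e (1 : K)) '' Set.range a) := by
        rw [← Set.range_comp, ← Set.range_comp]
        rfl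
      rw [h2, ← Submodule.map_span] at h1
      obtain ⟨g, hg, hgp⟩ := h1
      exact ⟨g, hg, Ideal.Quotient.eq.1 hgp.symm⟩
    · rintro l _ ⟨c, rfl⟩
      exact ⟨(X l : MvPolynomial ι K) • c, by rw [map_smul, Algebra.smul_def, hX]⟩
    · rintro _ ⟨e, rfl⟩
      classical
      refine ⟨Pi.single e 1, ?_⟩
      rw [Fintype.linearCombination_apply_single, one_smul]
  have hinj : Function.Injective f := by
    have h1 : LinearMap.ker ((Ideal.Quotient.mkₐ (MvPolynomial ι K) J).toLinearMap ∘ₗ f) = LinearMap.ker f := by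
      ext c
      rw [LinearMap.mem_ker, LinearMap.mem_ker]
      have : Ideal.Quotient.mk J (f c) = 0 ↔ f c = 0 := by
        rw [Ideal.Quotient.eq_zero_iff_mem, hJ0, Ideal.mem_bot]
      exact this
    have h2 := injective_of_extZero ((Ideal.Quotient.mkₐ (MvPolynomial ι K) J).toLinearMap ∘ₗ f)
      ((Ideal.Quotient.mkₐ_surjective (MvPolynomial ι K) J).comp hsurj) (h1 ▸ hker) hext
    rw [← LinearMap.ker_eq_bot] at h2 ⊢
    rw [← h1, h2]
  exact Module.Free.of_equiv (LinearEquiv.ofBijective f ⟨hinj, hsurj⟩)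

end Free
end Stillman

namespace Stillman
open MvPolynomial

section Good

variable {K : Type u} [Field K] {N : ℕ}

/-- A finite family of polynomials is good if it can be completed by linear forms to a system
of parameters of the polynomial ring. -/
def Good {β : Type*} (w : β → MvPolynomial (Fin N) K) : Prop :=
  ∃ (s : ℕ) (u : Fin s → MvPolynomial (Fin N) K), s + Nat.card β = N ∧
    (∀ i, (u i).IsHomogeneous 1) ∧
    Module.Finite K (MvPolynomial (Fin N) K ⧸ Ideal.span (Set.range w ∪ Set.range u))

theorem Good.flat {β : Type*} [Finite β] {w : β → MvPolynomial (Fin N) K} (h : Good w)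
    (δ : β → ℕ) (hδ : ∀ b, 0 < δ b) (hw : ∀ b, (w b).IsHomogeneous (δ b)) :
    (aeval w : MvPolynomial β K →ₐ[K] MvPolynomial (Fin N) K).toRingHom.Flat := by
  obtain ⟨s, u, hs, hu, hfin⟩ := h
  have := Fintype.ofFinite β
  have e : Fin (Nat.card β) ≃ β := (Fintype.equivFinOfCardEq (Nat.card_eq_fintype_card).symm).symm
  let θ : Fin s ⊕ Fin (Nat.card β) → MvPolynomial (Fin N) K := Sum.elim u (w ∘ e)
  have hθ : (aeval θ : MvPolynomial (Fin s ⊕ Fin (Nat.card β)) K →ₐ[K] _).toRingHom.Flat := by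
    let alg : Algebra (MvPolynomial (Fin s ⊕ Fin (Nat.card β)) K) (MvPolynomial (Fin N) K) :=
      (aeval θ : MvPolynomial (Fin s ⊕ Fin (Nat.card β)) K →ₐ[K] _).toRingHom.toAlgebra
    have : IsScalarTower K (MvPolynomial (Fin s ⊕ Fin (Nat.card β)) K) (MvPolynomial (Fin N) K) :=
      IsScalarTower.of_algebraMap_eq fun x => ((aeval θ).commutes x).symm
    have : Module.Finite K (MvPolynomial (Fin N) K ⧸ Ideal.span (Set.range θ)) := by
      rwa [Set.Sum.elim_range, EquivLike.range_comp, Set.union_comm]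
    have : Module.Free (MvPolynomial (Fin s ⊕ Fin (Nat.card β)) K) (MvPolynomial (Fin N) K) := by
      refine free_of_hsop (θ := θ) (by simpa using hs) (fun l => aeval_X θ l)
        (Sum.elim (fun _ => 1) (δ ∘ e)) ?_ ?_
      · rintro (l | l)
        · exact one_pos
        · exact hδ _
      · rintro (l | l)
        · exact hu _
        · exact hw _
    exact Module.Flat.of_free
  have hinr : (rename Sum.inr : MvPolynomial (Fin (Nat.card β)) K →ₐ[K]
      MvPolynomial (Fin s ⊕ Fin (Nat.card β)) K).toRingHom.Flat := by
    have h1 : (rename Sum.inr : MvPolynomial (Fin (Nat.card β)) K →ₐ[K]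
      MvPolynomial (Fin s ⊕ Fin (Nat.card β)) K).toRingHom =
        (sumAlgEquiv K (Fin s) (Fin (Nat.card β))).symm.toRingEquiv.toRingHom.comp
        (algebraMap (MvPolynomial (Fin (Nat.card β)) K)
          (MvPolynomial (Fin s) (MvPolynomial (Fin (Nat.card β)) K))) := by
      refine RingHom.ext fun p => ?_
      have h2 := AlgHom.congr_fun (sumAlgEquiv_comp_rename_inr K (Fin s) (Fin (Nat.card β))) p
      exact ((sumAlgEquiv K (Fin s) (Fin (Nat.card β))).symm_apply_apply _).symm.trans
        (congrArg (sumAlgEquiv K (Fin s) (Fin (Nat.card β))).symm h2)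
    rw [h1]
    refine RingHom.Flat.comp ?_ (RingHom.Flat.of_bijective (RingEquiv.bijective _))
    rw [RingHom.flat_algebraMap_iff]
    infer_instance
  have h2 : (aeval w : MvPolynomial β K →ₐ[K] MvPolynomial (Fin N) K).toRingHom =
      ((aeval θ : MvPolynomial (Fin s ⊕ Fin (Nat.card β)) K →ₐ[K] _).toRingHom.comp
        (rename Sum.inr : MvPolynomial (Fin (Nat.card β)) K →ₐ[K]
      MvPolynomial (Fin s ⊕ Fin (Nat.card β)) K).toRingHom).comp
        (renameEquiv K e.symm).toRingEquiv.toRingHom := by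
    have : (aeval w : MvPolynomial β K →ₐ[K] MvPolynomial (Fin N) K) =
      ((aeval θ).comp (rename Sum.inr)).comp (renameEquiv K e.symm).toAlgHom := by
      ext1 b
      simp [θ]
    rw [this]
    rfl
  rw [h2]
  exact (RingHom.Flat.of_bijective
    (renameEquiv K e.symm).toRingEquiv.bijective).comp (hinr.comp hθ)

end Good

lemma mem_map_of_mul_mem_of_flat {A R : Type*} [CommRing A] [CommRing R] {φ : A →+* R}
    (hφ : φ.Flat) {I : Ideal A} {g : A} (h : ∀ a, g * a ∈ I → a ∈ I) {r : R}
    (hr : φ g * r ∈ I.map φ) : r ∈ I.map φ := by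
  let _ := φ.toAlgebra
  have : Module.Flat A R := hφ
  obtain ⟨n, f, x, hf⟩ := Submodule.mem_span_set'.1 hr
  choose a ha hax using fun i => (x i).2
  obtain ⟨k, b, y, hy, hb⟩ := Module.Flat.isTrivialRelation_of_sum_smul_eq_zero
    (f := fun o : Option (Fin n) => Option.elim o g (fun i => - a i)) (x := fun o : Option (Fin n) => Option.elim o r f) (by
      rw [Fintype.sum_option]
      simp only [Option.elim, neg_smul, Finset.sum_neg_distrib]
      rw [add_neg_eq_zero]
      refine hf.symm.trans (Finset.sum_congr rfl fun i _ => ?_)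
      rw [smul_eq_mul, ← hax i, mul_comm]
      rfl)
  have h0 := hy none
  simp only [Option.elim] at h0
  rw [h0]
  refine Submodule.sum_mem _ fun j _ => ?_
  refine Ideal.mul_mem_right _ _ (Ideal.mem_map_of_mem φ (h _ ?_))
  have h1 := hb j
  rw [Fintype.sum_option] at h1
  simp only [Option.elim] at h1
  rw [eq_neg_of_add_eq_zero_left h1]
  refine I.neg_mem (I.sum_mem fun i _ => I.mul_mem_right _ (I.neg_mem (ha i)))

end Stillman

namespace Stillman
open MvPolynomial

section LinearParameters

variable {K : Type u} [Field K]

lemma natDegree_coeff_aeval_line {τ A : Type*} [CommRing A] [Algebra K A] (a : τ → A) (μ : τ → K)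
    {d : ℕ} {F : MvPolynomial τ K} (hF : F.IsHomogeneous d) :
    (aeval (fun j => Polynomial.C (a j) +
      Polynomial.C (algebraMap K A (μ j)) * Polynomial.X) F).natDegree ≤ d ∧
    (aeval (fun j => Polynomial.C (a j) +
      Polynomial.C (algebraMap K A (μ j)) * Polynomial.X) F).coeff d =
      algebraMap K A (eval μ F) := by
  set g : τ → Polynomial A := fun j => Polynomial.C (a j) +
      Polynomial.C (algebraMap K A (μ j)) * Polynomial.X with hg
  have hg1 : ∀ j, (g j).natDegree ≤ 1 := by
    intro j
    simp only [hg]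
    compute_degree
  have hmon : ∀ e : τ →₀ ℕ, e.degree = d → (aeval g (monomial e (1 : K))).natDegree ≤ d ∧
      (aeval g (monomial e (1 : K))).coeff d = algebraMap K A (eval μ (monomial e (1 : K))) := by
    intro e he
    have h1 : aeval g (monomial e (1 : K)) = ((Finsupp.toMultiset e).map g).prod := by
      rw [aeval_monomial, map_one, one_mul, Finsupp.toMultiset_map, Finsupp.prod_toMultiset,
        Finsupp.prod_mapDomain_index (fun _ => pow_zero _) (fun _ => pow_add _)]
    have hcard : ((Finsupp.toMultiset e).map g).card * 1 = d := by
      rw [Multiset.card_map, Finsupp.card_toMultiset, mul_one, ← he]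
      rfl
    have h2 : ∀ p ∈ (Finsupp.toMultiset e).map g, p.natDegree ≤ 1 := by
      intro p hp
      obtain ⟨j, -, rfl⟩ := Multiset.mem_map.1 hp
      exact hg1 j
    rw [h1]
    constructor
    · refine (Polynomial.natDegree_multiset_prod_le _).trans ?_
      rw [← hcard, ← smul_eq_mul, ← Multiset.card_map Polynomial.natDegree]
      refine Multiset.sum_le_card_nsmul _ _ ?_
      intro x hx
      obtain ⟨p, hp, rfl⟩ := Multiset.mem_map.1 hx
      exact h2 p hp
    · have h3 := Polynomial.coeff_multiset_prod_of_natDegree_le _ 1 h2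
      rw [hcard] at h3
      rw [h3, Multiset.map_map]
      have h4 : (fun p : Polynomial A => p.coeff 1) ∘ g = fun j => algebraMap K A (μ j) := by
        ext j
        simp [hg, Polynomial.coeff_C]
      rw [h4, eval_monomial, one_mul, Finsupp.toMultiset_map, Finsupp.prod_toMultiset,
        Finsupp.prod_mapDomain_index (fun _ => pow_zero _) (fun _ => pow_add _), map_finsuppProd]
      simp
  have hsum : F = ∑ e ∈ F.support, coeff e F • monomial e (1 : K) := by
    conv_lhs => rw [F.as_sum]
    refine Finset.sum_congr rfl fun e _ => ?_
    rw [smul_monomial, smul_eq_mul, mul_one]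
  have hdeg : ∀ e ∈ F.support, e.degree = d := by
    intro e he
    by_contra h
    exact mem_support_iff.1 he (hF.coeff_eq_zero h)
  constructor
  · rw [hsum, map_sum]
    refine Polynomial.natDegree_sum_le_of_forall_le _ _ fun e he => ?_
    rw [map_smul]
    exact (Polynomial.natDegree_smul_le _ _).trans (hmon e (hdeg e he)).1
  · rw [hsum, map_sum, Polynomial.finsetSum_coeff, map_sum, map_sum]
    refine Finset.sum_congr rfl fun e he => ?_
    rw [map_smul, Polynomial.coeff_smul, (hmon e (hdeg e he)).2, smul_eval, map_mul, Algebra.smul_def]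

lemma isIntegral_of_isIntegral_adjoin {C : Type*} [CommRing C] [Algebra K C] {A : Subalgebra K C}
    {S : Set C} (hS : ∀ s ∈ S, IsIntegral A s) {x : C} (hx : IsIntegral (Algebra.adjoin K S) x) :
    IsIntegral A x := by
  have hle : Algebra.adjoin K S ≤ (integralClosure A C).restrictScalars K :=
    Algebra.adjoin_le hS
  obtain ⟨p, hp, hpx⟩ := hx
  let φ : Algebra.adjoin K S →+* integralClosure A C :=
    (Subalgebra.inclusion hle).toRingHom
  refine isIntegral_trans (A := integralClosure A C) x ⟨p.map φ, hp.map φ, ?_⟩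
  rw [Polynomial.eval₂_map]
  exact hpx

variable {N : ℕ}

/-- The quotient by an ideal is integral over the subalgebra generated by linear forms. -/
def IntegralOver (I : Ideal (MvPolynomial (Fin N) K)) {m : ℕ}
    (l : Fin m → MvPolynomial (Fin N) K) : Prop :=
  ∀ k, IsIntegral (Algebra.adjoin K (Set.range fun j => Ideal.Quotient.mk I (l j)))
    (Ideal.Quotient.mk I (X k))

lemma exists_integralOver_pred [Infinite K] {I : Ideal (MvPolynomial (Fin N) K)} {m d : ℕ}
    {l : Fin (m + 1) → MvPolynomial (Fin N) K} (hl : ∀ j, (l j).IsHomogeneous 1)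
    (hinteg : IntegralOver I l) {F : MvPolynomial (Fin (m + 1)) K} (hF : F.IsHomogeneous d)
    (hd : d ≠ 0) (hF0 : F ≠ 0) (hFI : aeval l F ∈ I) :
    ∃ l' : Fin m → MvPolynomial (Fin N) K, (∀ j, (l' j).IsHomogeneous 1) ∧ IntegralOver I l' := by
  obtain ⟨lam, hlam⟩ : ∃ lam : Fin (m + 1) → K, eval lam F ≠ 0 := by
    by_contra! h
    exact hF0 (MvPolynomial.funext fun x => by rw [h x, map_zero])
  obtain ⟨k, hk⟩ : ∃ k, lam k ≠ 0 := by
    by_contra! h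
    have h0 : lam = 0 := _root_.funext h
    apply hlam
    have h1 := hF.coeff_eq_zero (d := 0) (by simpa using hd.symm)
    rw [h0]
    simpa [constantCoeff_eq] using h1
  set π := Ideal.Quotient.mkₐ K I with hπ
  set l' : Fin (m + 1) → MvPolynomial (Fin N) K := fun j => l j - (lam j * (lam k)⁻¹) • l k with hl'
  have hl'k : l' k = 0 := by
    simp only [hl']
    rw [mul_inv_cancel₀ hk, one_smul, sub_self]
  refine ⟨fun j => l' (k.succAbove j), fun j => ?_, ?_⟩
  · have h1 := (homogeneousSubmodule (Fin N) K 1).sub_mem (hl (k.succAbove j))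
      ((homogeneousSubmodule (Fin N) K 1).smul_mem (lam (k.succAbove j) * (lam k)⁻¹) (hl k))
    exact h1
  set A := Algebra.adjoin K (Set.range fun j => Ideal.Quotient.mk I (l' (k.succAbove j))) with hA
  have hmem : ∀ j, π (l' j) ∈ A := by
    intro j
    rcases Fin.eq_self_or_eq_succAbove k j with rfl | ⟨i, rfl⟩
    · rw [hl'k, map_zero]
      exact A.zero_mem
    · exact Algebra.subset_adjoin ⟨i, rfl⟩
  set t : MvPolynomial (Fin N) K ⧸ I := (lam k)⁻¹ • π (l k) with ht
  have hπl : ∀ j, π (l j) = π (l' j) + algebraMap K _ (lam j) * t := by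
    intro j
    simp only [hl', ht]
    rw [map_sub, map_smul, ← Algebra.smul_def, smul_smul, sub_add_cancel]
  have htint : IsIntegral A t := by
    obtain ⟨hG1, hG2⟩ := natDegree_coeff_aeval_line (fun j => (⟨π (l' j), hmem j⟩ : A)) lam hF
    set G := aeval (fun j => Polynomial.C (⟨π (l' j), hmem j⟩ : A) +
      Polynomial.C (algebraMap K A (lam j)) * Polynomial.X) F with hG
    refine ⟨Polynomial.C (algebraMap K A (eval lam F)⁻¹) * G,
      Polynomial.monic_of_natDegree_le_of_coeff_eq_one d
        ((Polynomial.natDegree_C_mul_le _ _).trans hG1) ?_, ?_⟩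
    · rw [Polynomial.coeff_C_mul, hG2, ← map_mul, inv_mul_cancel₀ hlam, map_one]
    · rw [Polynomial.eval₂_mul]
      have h1 : Polynomial.eval₂ (algebraMap A (MvPolynomial (Fin N) K ⧸ I)) t G = 0 := by
        have h2 : ((Polynomial.aeval t).restrictScalars K : Polynomial A →ₐ[K] _).comp
            (aeval (fun j => Polynomial.C (⟨π (l' j), hmem j⟩ : A) +
              Polynomial.C (algebraMap K A (lam j)) * Polynomial.X)) = π.comp (aeval l) := by
          ext j
          simp only [AlgHom.comp_apply, aeval_X, AlgHom.restrictScalars_apply, map_add, map_mul,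
            Polynomial.aeval_C, Polynomial.aeval_X, hπl]
          rfl
        have h3 := AlgHom.congr_fun h2 F
        exact h3.trans (Ideal.Quotient.eq_zero_iff_mem.2 hFI)
      rw [h1, mul_zero]
  intro x
  refine isIntegral_of_isIntegral_adjoin ?_ (hinteg x)
  rintro _ ⟨j, rfl⟩
  have h1 : Ideal.Quotient.mk I (l j) = π (l' j) + algebraMap K _ (lam j) * t := hπl j
  change IsIntegral A (Ideal.Quotient.mk I (l j))
  rw [h1]
  refine IsIntegral.add (isIntegral_algebraMap (x := (⟨π (l' j), hmem j⟩ : A))) (IsIntegral.mul ?_ htint)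
  rw [IsScalarTower.algebraMap_apply K A]
  exact isIntegral_algebraMap

lemma exists_prime_algebraicIndependent {P : Type*} [CommRing P] [Algebra K P] {I : Ideal P}
    {m : ℕ} (l : Fin m → P)
    (h : AlgebraicIndependent K fun j => Ideal.Quotient.mk I (l j)) :
    ∃ Q : Ideal P, Q.IsPrime ∧ I ≤ Q ∧
      AlgebraicIndependent K fun j => Ideal.Quotient.mk Q (l j) := by
  have haev : ∀ (J : Ideal P) (p : MvPolynomial (Fin m) K),
      aeval (fun j => Ideal.Quotient.mk J (l j)) p = Ideal.Quotient.mk J (aeval l p) := by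
    intro J p
    exact AlgHom.congr_fun (comp_aeval l (Ideal.Quotient.mkₐ K J)).symm p
  obtain ⟨Q, hQ, hIQ, hdis⟩ := Ideal.exists_le_prime_disjoint I
    ((nonZeroDivisors (MvPolynomial (Fin m) K)).map (aeval l : MvPolynomial (Fin m) K →ₐ[K] P)) (by
      rw [Set.disjoint_left]
      rintro _ hx ⟨p, hp, rfl⟩
      refine nonZeroDivisors.ne_zero hp ((algebraicIndependent_iff.1 h) p ?_)
      rw [haev]
      exact Ideal.Quotient.eq_zero_iff_mem.2 hx)
  refine ⟨Q, hQ, hIQ, algebraicIndependent_iff.2 fun p hp => ?_⟩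
  by_contra hp0
  rw [haev, Ideal.Quotient.eq_zero_iff_mem] at hp
  exact Set.disjoint_left.1 hdis hp ⟨p, mem_nonZeroDivisors_of_ne_zero hp0, rfl⟩

/-- If a family of homogeneous polynomials is not good, then some component of its zero set has
too large a dimension. -/
theorem exists_prime_of_not_good [Infinite K] {β : Type*} [Finite β]
    {w : β → MvPolynomial (Fin N) K} (δ : β → ℕ) (hδ : ∀ b, 0 < δ b)
    (hw : ∀ b, (w b).IsHomogeneous (δ b)) (h : ¬ Good w) :
    ∃ Q : Ideal (MvPolynomial (Fin N) K), Q.IsPrime ∧ (∀ b, w b ∈ Q) ∧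
      ∃ (s : ℕ) (y : Fin s → MvPolynomial (Fin N) K), N < s + Nat.card β ∧
        AlgebraicIndependent K fun j => Ideal.Quotient.mk Q (y j) := by
  set I : Ideal (MvPolynomial (Fin N) K) := Ideal.span (Set.range w) with hI
  have hex : ∃ m, ∃ l : Fin m → MvPolynomial (Fin N) K,
      (∀ j, (l j).IsHomogeneous 1) ∧ IntegralOver I l :=
    ⟨N, X, fun j => isHomogeneous_X _ _, fun k => isIntegral_algebraMap
      (x := (⟨_, Algebra.subset_adjoin ⟨k, rfl⟩⟩ : Algebra.adjoin K
        (Set.range fun j => Ideal.Quotient.mk I (X j))))⟩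
  classical
  obtain ⟨m, ⟨l, hl, hinteg⟩, hmin⟩ : ∃ m, (∃ l : Fin m → MvPolynomial (Fin N) K,
      (∀ j, (l j).IsHomogeneous 1) ∧ IntegralOver I l) ∧ ∀ m' < m, ¬ ∃ l : Fin m' → MvPolynomial (Fin N) K,
      (∀ j, (l j).IsHomogeneous 1) ∧ IntegralOver I l :=
    ⟨Nat.find hex, Nat.find_spec hex, fun m' hm' => Nat.find_min hex hm'⟩
  have hind : AlgebraicIndependent K fun j => Ideal.Quotient.mk I (l j) := by
    rw [algebraicIndependent_iff]
    intro p hp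
    have hpI : aeval l p ∈ I := by
      rw [← Ideal.Quotient.eq_zero_iff_mem, ← hp]
      exact (AlgHom.congr_fun (comp_aeval l (Ideal.Quotient.mkₐ K I)) p)
    by_contra hp0
    obtain ⟨d, hd⟩ : ∃ d, homogeneousComponent d p ≠ 0 := by
      by_contra! h0
      exact hp0 (by rw [← sum_homogeneousComponent p]; exact Finset.sum_eq_zero fun d _ => h0 d)
    have hdI : aeval l (homogeneousComponent d p) ∈ I := by
      have h1 : aeval l (homogeneousComponent d p) = homogeneousComponent d (aeval l p) := by
        conv_rhs => rw [← sum_homogeneousComponent p]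
        rw [map_sum, map_sum]
        have h2 : ∀ k, homogeneousComponent d (aeval l (homogeneousComponent k p)) =
            if d = k then aeval l (homogeneousComponent k p) else 0 := by
          intro k
          have := (homogeneousComponent_isHomogeneous k p).aeval l hl
          rw [one_mul] at this
          exact homogeneousComponent_of_mem this
        simp_rw [h2]
        rw [Finset.sum_ite_eq, if_pos]
        rw [Finset.mem_range, Nat.lt_succ_iff]
        by_contra! hlt
        exact hd (homogeneousComponent_eq_zero _ _ hlt)
      rw [h1]
      exact homogeneousComponent_mem_span (by rintro _ ⟨b, rfl⟩; exact ⟨_, hw b⟩) hI hpI d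
    by_cases hd0 : d = 0
    · subst hd0
      rw [homogeneousComponent_zero] at hd hdI
      have hc : coeff 0 p ≠ 0 := fun h0 => hd (by rw [h0, C_0])
      have hle : I ≤ RingHom.ker (constantCoeff : MvPolynomial (Fin N) K →+* K) := by
        rw [hI, Ideal.span_le]
        rintro _ ⟨b, rfl⟩
        exact (hw b).coeff_eq_zero (by simpa using (hδ b).ne)
      have := hle hdI
      rw [RingHom.mem_ker, ← algebraMap_eq, AlgHom.commutes, algebraMap_eq, constantCoeff_C] at this
      exact hc this
    · obtain _ | m := m
      · have : IsHomogeneous (homogeneousComponent d p) 0 := by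
          rw [eq_C_of_isEmpty (homogeneousComponent d p)]
          exact isHomogeneous_C _ _
        exact hd0 (((homogeneousComponent_isHomogeneous d p).inj_right this hd))
      · obtain ⟨l', hl'⟩ := exists_integralOver_pred hl hinteg
          (homogeneousComponent_isHomogeneous d p) hd0 hd hdI
        exact hmin m (Nat.lt_succ_self m) ⟨l', hl'⟩
  obtain ⟨Q, hQ, hIQ, hQind⟩ := exists_prime_algebraicIndependent l hind
  refine ⟨Q, hQ, fun b => hIQ (Ideal.subset_span ⟨b, rfl⟩), m, l, ?_, hQind⟩
  by_contra! hle
  apply h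
  refine ⟨N - Nat.card β, fun i => if hi : i.val < m then l ⟨i, hi⟩ else 0, by omega, fun i => ?_, ?_⟩
  · dsimp only
    split_ifs
    · exact hl _
    · exact isHomogeneous_zero _ _ _
  set J : Ideal (MvPolynomial (Fin N) K) := Ideal.span (Set.range w ∪ Set.range
    (fun i : Fin (N - Nat.card β) => if hi : i.val < m then l ⟨i, hi⟩ else 0)) with hJ
  have hIJ : I ≤ J := Ideal.span_mono Set.subset_union_left
  have hlJ : ∀ j, l j ∈ J := by
    intro j
    refine Ideal.subset_span (Or.inr ⟨⟨j, by omega⟩, ?_⟩)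
    simp
  have hX : ∀ k, IsIntegral K (Ideal.Quotient.mk J (X k : MvPolynomial (Fin N) K)) := by
    intro k
    obtain ⟨p, hp, hpX⟩ := hinteg k
    have hle : Algebra.adjoin K (Set.range fun j => Ideal.Quotient.mk I (l j)) ≤
        (⊥ : Subalgebra K (MvPolynomial (Fin N) K ⧸ J)).comap (Ideal.Quotient.factorₐ K hIJ) := by
      refine Algebra.adjoin_le ?_
      rintro _ ⟨j, rfl⟩
      have : Ideal.Quotient.mk J (l j) = 0 := Ideal.Quotient.eq_zero_iff_mem.2 (hlJ j)
      have h2 : Ideal.Quotient.factorₐ K hIJ (Ideal.Quotient.mk I (l j)) = 0 := this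
      change Ideal.Quotient.factorₐ K hIJ (Ideal.Quotient.mk I (l j)) ∈
        (⊥ : Subalgebra K (MvPolynomial (Fin N) K ⧸ J))
      rw [h2]
      exact Subalgebra.zero_mem _
    let φ : Algebra.adjoin K (Set.range fun j => Ideal.Quotient.mk I (l j)) →+*
        (⊥ : Subalgebra K (MvPolynomial (Fin N) K ⧸ J)) :=
      (((Ideal.Quotient.factorₐ K hIJ).comp (Subalgebra.val _)).codRestrict ⊥
        (fun x => hle x.2)).toRingHom
    refine isIntegral_trans (A := (⊥ : Subalgebra K (MvPolynomial (Fin N) K ⧸ J))) _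
      ⟨p.map φ, hp.map φ, ?_⟩
    rw [Polynomial.eval₂_map]
    have h1 := congrArg (Ideal.Quotient.factorₐ K hIJ).toRingHom hpX
    rw [Polynomial.hom_eval₂, map_zero] at h1
    exact h1
  have hinteg' : Algebra.IsIntegral K (MvPolynomial (Fin N) K ⧸ J) := by
    constructor
    intro x
    obtain ⟨x, rfl⟩ := Ideal.Quotient.mk_surjective x
    have h1 : (integralClosure K (MvPolynomial (Fin N) K ⧸ J)).comap (Ideal.Quotient.mkₐ K J) = ⊤ := by
      rw [← top_le_iff, ← adjoin_range_X]
      refine Algebra.adjoin_le ?_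
      rintro _ ⟨k, rfl⟩
      exact hX k
    exact (h1.symm ▸ Algebra.mem_top : x ∈ _)
  exact Algebra.IsIntegral.finite

end LinearParameters
end Stillman

namespace Stillman
open MvPolynomial

section Kaehler

variable {K : Type u} [Field K]

open KaehlerDifferential TensorProduct

open scoped IntermediateField.algebraAdjoinAdjoin in
lemma exists_card_eq_finrank_kaehler (K F : Type*) [Field K] [Field F] [Algebra K F]
    [PerfectField K] [Algebra.EssFiniteType K F] :
    ∃ t : Finset F, IsTranscendenceBasis K ((↑) : t → F) ∧ Module.finrank F Ω[F⁄K] = t.card := by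
  obtain ⟨t, ht, hsep⟩ := exists_isTranscendenceBasis_and_isSeparable_of_perfectField K F
  refine ⟨t, ht, ?_⟩
  have hsep : Algebra.IsSeparable
      (IntermediateField.adjoin K (Set.range ((↑) : t → F))) F := by
    convert! hsep <;> simp
  have h1 : Algebra.FormallyEtale (IntermediateField.adjoin K (Set.range ((↑) : t → F))) F :=
    Algebra.FormallyEtale.of_isSeparable _ F
  have h2 : Algebra.FormallyEtale (Algebra.adjoin K (Set.range ((↑) : t → F)))
      (IntermediateField.adjoin K (Set.range ((↑) : t → F))) :=
    .of_isLocalization (nonZeroDivisors _)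
  have h3 : Algebra.FormallyEtale (Algebra.adjoin K (Set.range ((↑) : t → F))) F :=
    .comp _ (IntermediateField.adjoin K (Set.range ((↑) : t → F))) _
  let alg1 : Algebra (MvPolynomial t K) (Algebra.adjoin K (Set.range ((↑) : t → F))) :=
    ht.1.aevalEquiv.toAlgHom.toRingHom.toAlgebra
  have h4 : Algebra.FormallyEtale (MvPolynomial t K)
      (Algebra.adjoin K (Set.range ((↑) : t → F))) :=
    .of_equiv (AlgEquiv.ofBijective (Algebra.ofId (MvPolynomial t K) _) ht.1.aevalEquiv.bijective)
  let alg2 : Algebra (MvPolynomial t K) F :=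
    ((Subalgebra.val _).comp ht.1.aevalEquiv.toAlgHom).toRingHom.toAlgebra
  have : IsScalarTower (MvPolynomial t K) (Algebra.adjoin K (Set.range ((↑) : t → F))) F :=
    IsScalarTower.of_algebraMap_eq fun x => rfl
  have h5 : Algebra.FormallyEtale (MvPolynomial t K) F :=
    .comp _ (Algebra.adjoin K (Set.range ((↑) : t → F))) _
  have : IsScalarTower K (MvPolynomial t K) F :=
    IsScalarTower.of_algebraMap_eq fun x => (((Subalgebra.val _).comp ht.1.aevalEquiv.toAlgHom).commutes x).symm
  rw [← (tensorKaehlerEquivOfFormallyEtale K (MvPolynomial t K) F).finrank_eq,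
    Module.finrank_eq_card_basis ((mvPolynomialBasis K t).baseChange F)]
  simp

lemma card_le_finrank_kaehler (K F : Type*) [Field K] [Field F] [Algebra K F]
    [PerfectField K] [Algebra.EssFiniteType K F] {s : ℕ} {y : Fin s → F}
    (hy : AlgebraicIndependent K y) : s ≤ Module.finrank F Ω[F⁄K] := by
  obtain ⟨t, ht, h⟩ := exists_card_eq_finrank_kaehler K F
  rw [h]
  have h1 := hy.lift_cardinalMk_le_trdeg
  rw [← ht.cardinalMk_eq_trdeg] at h1
  simpa using h1

variable {N : ℕ}

lemma finrank_kaehler_le {F : Type*} [Field F] [Algebra K F] (Q : Ideal (MvPolynomial (Fin N) K))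
    [Q.IsPrime] [Algebra (MvPolynomial (Fin N) K ⧸ Q) F]
    [IsScalarTower K (MvPolynomial (Fin N) K ⧸ Q) F] [IsFractionRing (MvPolynomial (Fin N) K ⧸ Q) F]
    {β : Type*} [Fintype β] (y : β → MvPolynomial (Fin N) K) (hy : ∀ b, y b ∈ Q)
    (hli : LinearIndependent F fun b j =>
      algebraMap (MvPolynomial (Fin N) K ⧸ Q) F (Ideal.Quotient.mk Q (pderiv j (y b)))) :
    Fintype.card β + Module.finrank F Ω[F⁄K] ≤ N := by
  let π : MvPolynomial (Fin N) K →ₐ[K] F :=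
    (IsScalarTower.toAlgHom K (MvPolynomial (Fin N) K ⧸ Q) F).comp (Ideal.Quotient.mkₐ K Q)
  let φ : (Fin N → F) →ₗ[F] Ω[F⁄K] := Fintype.linearCombination F fun j => D K F (π (X j))
  have hD : ∀ f : MvPolynomial (Fin N) K, D K F (π f) = φ fun j => π (pderiv j f) := by
    intro f
    induction f using MvPolynomial.induction_on with
    | C a =>
      have h1 : π (C a) = algebraMap K F a := π.commutes a
      rw [h1, Derivation.map_algebraMap]
      simp only [pderiv_C, map_zero]
      exact (map_zero φ).symm
    | add f g hf hg =>
      rw [map_add, map_add, hf, hg, ← map_add]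
      congr 1
      ext j
      simp
    | mul_X f k hf =>
      have h1 : D K F (π (X k)) = φ (Pi.single k 1) := by
        rw [Fintype.linearCombination_apply_single, one_smul]
      rw [map_mul, Derivation.leibniz, hf, h1, ← LinearMap.map_smul, ← LinearMap.map_smul,
        ← map_add]
      congr 1
      ext j
      simp only [Pi.add_apply, Pi.smul_apply, smul_eq_mul, Derivation.leibniz, map_add, map_mul,
        pderiv_X]
      rw [Pi.single_comm, Pi.apply_single (fun _ => π) (fun _ => map_zero _), map_one]
  have hsurj : Function.Surjective φ := by
    rw [← LinearMap.range_eq_top, ← top_le_iff,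
      ← span_range_map_derivation_of_isLocalization K (MvPolynomial (Fin N) K ⧸ Q) F (nonZeroDivisors _)]
    rw [Submodule.span_le]
    rintro _ ⟨x, rfl⟩
    obtain ⟨f, rfl⟩ := Ideal.Quotient.mk_surjective x
    rw [Function.comp_apply, KaehlerDifferential.map_D]
    exact ⟨_, (hD f).symm⟩
  have h1 := LinearMap.finrank_range_add_finrank_ker φ
  rw [LinearMap.range_eq_top.2 hsurj, finrank_top, Module.finrank_fin_fun] at h1
  have hker : ∀ b, (fun j => algebraMap (MvPolynomial (Fin N) K ⧸ Q) F
      (Ideal.Quotient.mk Q (pderiv j (y b)))) ∈ LinearMap.ker φ := by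
    intro b
    have h2 := hD (y b)
    have h3 : π (y b) = 0 := by
      change algebraMap _ F (Ideal.Quotient.mk Q (y b)) = 0
      rw [Ideal.Quotient.eq_zero_iff_mem.2 (hy b), map_zero]
    rw [h3, map_zero] at h2
    exact h2.symm
  have h2 : LinearIndependent F fun b => (⟨_, hker b⟩ : LinearMap.ker φ) :=
    LinearIndependent.of_comp (LinearMap.ker φ).subtype hli
  have := h2.fintype_card_le_finrank
  omega

/-- The Jacobian criterion: polynomials vanishing on a component of too large dimension
have dependent differentials along it. -/
theorem exists_relation_pderiv [PerfectField K] (Q : Ideal (MvPolynomial (Fin N) K)) [Q.IsPrime]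
    {β : Type*} [Finite β] (y : β → MvPolynomial (Fin N) K) (hy : ∀ b, y b ∈ Q) {s : ℕ}
    (t : Fin s → MvPolynomial (Fin N) K) (ht : AlgebraicIndependent K fun j => Ideal.Quotient.mk Q (t j))
    (hs : N < s + Nat.card β) :
    ∃ c : β → MvPolynomial (Fin N) K, (∃ b, c b ∉ Q) ∧
      ∀ j, ∑ᶠ b, c b * pderiv j (y b) ∈ Q := by
  have := Fintype.ofFinite β
  let P := MvPolynomial (Fin N) K ⧸ Q
  let F := FractionRing P
  have hft : Algebra.EssFiniteType K F := .comp K P F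
  have hind : AlgebraicIndependent K fun j => algebraMap P F (Ideal.Quotient.mk Q (t j)) :=
    ht.map' (f := IsScalarTower.toAlgHom K P F) (IsFractionRing.injective P F)
  have h1 := card_le_finrank_kaehler K F hind
  have h2 : ¬ LinearIndependent F fun b j => algebraMap P F (Ideal.Quotient.mk Q (pderiv j (y b))) := by
    intro hli
    have := finrank_kaehler_le (F := F) Q y hy hli
    rw [Nat.card_eq_fintype_card] at hs
    omega
  rw [Fintype.not_linearIndependent_iff] at h2
  obtain ⟨c, hc, b, hb⟩ := h2
  obtain ⟨d, hd⟩ := IsLocalization.exist_integer_multiples_of_finite (nonZeroDivisors P) c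
  choose e he using hd
  choose e' he' using fun b => Ideal.Quotient.mk_surjective (e b)
  have hd0 : algebraMap P F d ≠ 0 := fun h0 =>
    nonZeroDivisors.ne_zero d.2 (IsFractionRing.injective P F (h0.trans (map_zero _).symm))
  refine ⟨e', ⟨b, fun h => ?_⟩, fun j => ?_⟩
  · rw [← Ideal.Quotient.eq_zero_iff_mem, he'] at h
    have h3 := he b
    rw [h, map_zero, Algebra.smul_def] at h3
    exact mul_ne_zero hd0 hb h3.symm
  · rw [finsum_eq_sum_of_fintype, ← Ideal.Quotient.eq_zero_iff_mem, map_sum]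
    apply IsFractionRing.injective P F
    rw [map_zero, map_sum]
    have h3 := congrFun hc j
    rw [Finset.sum_apply] at h3
    have h4 := congrArg (algebraMap P F d * ·) h3
    simp only [Finset.mul_sum, Pi.zero_apply, mul_zero, Pi.smul_apply, smul_eq_mul] at h4
    rw [← h4]
    refine Finset.sum_congr rfl fun b _ => ?_
    rw [map_mul, map_mul, he', he b, Algebra.smul_def, mul_assoc]

end Kaehler

end Stillman

namespace Stillman
open MvPolynomial

section AlgebraicDimension

variable {K : Type u} [Field K] {N : ℕ}

lemma finite_adjoin_of_finite_quotient {ι : Type*} [Finite ι] (θ : ι → MvPolynomial (Fin N) K)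
    (δ : ι → ℕ) (hδ : ∀ l, 0 < δ l) (hθ : ∀ l, (θ l).IsHomogeneous (δ l))
    [Module.Finite K (MvPolynomial (Fin N) K ⧸ Ideal.span (Set.range θ))] :
    Module.Finite (Algebra.adjoin K (Set.range θ)) (MvPolynomial (Fin N) K) := by
  choose n hn using exists_X_pow_mem (I := Ideal.span (Set.range θ)) (s := Set.range θ)
    (by rintro _ ⟨l, rfl⟩; exact ⟨_, hθ l⟩) rfl
  set m : Fin N →₀ ℕ := Finsupp.equivFunOnFinite.symm n with hm
  set A := Algebra.adjoin K (Set.range θ) with hA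
  have hfin : ((fun e => monomial e (1 : K)) '' Set.Iic m).Finite := (Set.finite_Iic m).image _
  have key := eq_top_of_span_monomials θ δ hδ hθ (Set.Iic m) ?_
    ((Submodule.span A ((fun e => monomial e (1 : K)) '' Set.Iic m)).restrictScalars K) ?_ ?_
  · refine ⟨⟨hfin.toFinset, ?_⟩⟩
    rw [hfin.coe_toFinset]
    exact (Submodule.restrictScalars_eq_top_iff K A (MvPolynomial (Fin N) K)).1 key
  · intro f
    induction f using MvPolynomial.induction_on' with
    | monomial e a =>
      by_cases he : e ≤ m
      · refine ⟨monomial e a, ?_, by rw [sub_self]; exact Submodule.zero_mem _⟩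
        have : monomial e a = a • monomial e (1 : K) := by rw [smul_monomial, smul_eq_mul, mul_one]
        rw [this]
        exact Submodule.smul_mem _ _ (Submodule.subset_span ⟨e, he, rfl⟩)
      · refine ⟨0, Submodule.zero_mem _, ?_⟩
        obtain ⟨j, hj⟩ : ∃ j, n j < e j := by
          by_contra! h
          exact he fun j => h j
        have h1 : monomial e a = monomial (e - Finsupp.single j (n j)) a * X j ^ n j := by
          rw [X_pow_eq_monomial, monomial_mul, mul_one, tsub_add_cancel_of_le]
          rw [Finsupp.single_le_iff]
          exact hj.le
        rw [sub_zero, h1]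
        exact Ideal.mul_mem_left _ _ (hn j)
    | add p q hp hq =>
      obtain ⟨g, hg, hpg⟩ := hp
      obtain ⟨g', hg', hqg⟩ := hq
      refine ⟨g + g', Submodule.add_mem _ hg hg', ?_⟩
      rw [add_sub_add_comm]
      exact Ideal.add_mem _ hpg hqg
  · intro l f hf
    exact Submodule.smul_mem _ (⟨θ l, Algebra.subset_adjoin ⟨l, rfl⟩⟩ : A) hf
  · intro e he
    exact Submodule.subset_span ⟨e, he, rfl⟩

lemma isAlgebraic_of_isAlgebraic_adjoin {D : Type*} [CommRing D] [IsDomain D] [Algebra K D]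
    {A : Subalgebra K D} {S : Set D} (hS : ∀ s ∈ S, IsAlgebraic A s) {x : D}
    (hx : IsAlgebraic (Algebra.adjoin K S) x) : IsAlgebraic A x := by
  have h0 : Algebra.adjoin K S ≤ (Subalgebra.algebraicClosure A D).restrictScalars K :=
    Algebra.adjoin_le fun s hs => hS s hs
  have h1 : IsAlgebraic ((Subalgebra.algebraicClosure A D).restrictScalars K) x :=
    IsAlgebraic.tower_top_of_subalgebra_le h0 hx
  have h2 : IsAlgebraic (Subalgebra.algebraicClosure A D) x := h1
  exact IsAlgebraic.restrictScalars A h2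

/-- Along a prime over which some members of a good family become algebraic over the others,
the dimension drops accordingly. -/
theorem Good.card_add_le {β : Type*} [Finite β] {w : β → MvPolynomial (Fin N) K} (h : Good w)
    (δ : β → ℕ) (hδ : ∀ b, 0 < δ b) (hw : ∀ b, (w b).IsHomogeneous (δ b))
    (Q : Ideal (MvPolynomial (Fin N) K)) [Q.IsPrime] (E : Set β)
    (hE : ∀ b ∈ E, IsAlgebraic (Algebra.adjoin K ((fun b => Ideal.Quotient.mk Q (w b)) '' Eᶜ))
      (Ideal.Quotient.mk Q (w b))) {s : ℕ} (y : Fin s → MvPolynomial (Fin N) K)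
    (hy : AlgebraicIndependent K fun j => Ideal.Quotient.mk Q (y j)) : s + Nat.card E ≤ N := by
  classical
  obtain ⟨r, z, hr, hz, hfin⟩ := h
  have := Fintype.ofFinite β
  have hfin' : Module.Finite K (MvPolynomial (Fin N) K ⧸ Ideal.span (Set.range (Sum.elim w z))) := by
    rwa [Set.Sum.elim_range]
  have h1 := finite_adjoin_of_finite_quotient (Sum.elim w z) (Sum.elim δ fun _ => 1)
    (by rintro (l | l); exacts [hδ l, one_pos]) (by rintro (l | l); exacts [hw l, hz l])
  have h2 : ∀ x : MvPolynomial (Fin N) K ⧸ Q,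
      IsIntegral (Algebra.adjoin K (Ideal.Quotient.mkₐ K Q '' Set.range (Sum.elim w z))) x := by
    intro x
    obtain ⟨f, rfl⟩ := Ideal.Quotient.mk_surjective x
    obtain ⟨p, hp, hpf⟩ := Algebra.IsIntegral.isIntegral (R := Algebra.adjoin K (Set.range (Sum.elim w z))) f
    let ψ : Algebra.adjoin K (Set.range (Sum.elim w z)) →+*
        Algebra.adjoin K (Ideal.Quotient.mkₐ K Q '' Set.range (Sum.elim w z)) :=
      (((Ideal.Quotient.mkₐ K Q).comp (Subalgebra.val _)).codRestrict _ (by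
        rintro ⟨a, ha⟩
        rw [← AlgHom.map_adjoin]
        exact ⟨a, ha, rfl⟩)).toRingHom
    refine ⟨p.map ψ, hp.map ψ, ?_⟩
    have h3 := congrArg (Ideal.Quotient.mk Q) hpf
    rw [map_zero, Polynomial.hom_eval₂] at h3
    rw [Polynomial.eval₂_map]
    exact h3
  set S : Set (MvPolynomial (Fin N) K ⧸ Q) := (fun b => Ideal.Quotient.mk Q (w b)) '' Eᶜ ∪
    Set.range fun i => Ideal.Quotient.mk Q (z i) with hS
  have h3 : Algebra.IsAlgebraic (Algebra.adjoin K S) (MvPolynomial (Fin N) K ⧸ Q) := by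
    refine ⟨fun x => isAlgebraic_of_isAlgebraic_adjoin ?_ (h2 x).isAlgebraic⟩
    rintro _ ⟨_, ⟨l | l, rfl⟩, rfl⟩
    · by_cases hl : l ∈ E
      · exact IsAlgebraic.tower_top_of_subalgebra_le
          (Algebra.adjoin_mono Set.subset_union_left) (hE l hl)
      · exact isAlgebraic_algebraMap (⟨_, Algebra.subset_adjoin (Or.inl ⟨l, hl, rfl⟩)⟩ : Algebra.adjoin K S)
    · exact isAlgebraic_algebraMap (⟨_, Algebra.subset_adjoin (Or.inr ⟨l, rfl⟩)⟩ : Algebra.adjoin K S)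
  have h4 := Algebra.IsAlgebraic.trdeg_le_cardinalMk K S
  have h5 := Cardinal.lift_le.{0}.2 h4
  have h6 := hy.lift_cardinalMk_le_trdeg
  have hSfin : S.Finite := (Set.toFinite _).union (Set.toFinite _)
  have hle : S.ncard ≤ (Eᶜ).ncard + r := by
    refine (Set.ncard_union_le _ _).trans (add_le_add (Set.ncard_image_le (Set.toFinite _)) ?_)
    rw [← Set.image_univ]
    refine (Set.ncard_image_le (Set.toFinite _)).trans ?_
    simp [Set.ncard_univ]
  have h7 : (s : Cardinal.{u}) ≤ S.ncard := by
    rw [Set.cast_ncard hSfin]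
    refine le_trans ?_ h4
    simpa using h6
  have h8 : s ≤ S.ncard := by exact_mod_cast h7
  have h9 := Set.ncard_add_ncard_compl E
  rw [Nat.card_coe_set_eq]
  omega

end AlgebraicDimension
end Stillman

namespace Stillman
open MvPolynomial

section Taylor

variable {K : Type*} [Field K] {p : ℕ} {R : Type*} [CommRing R]
  [Algebra K R]

/-- In characteristic `p` the `p`-th iterate of a derivation is a derivation. -/
lemma iterate_char_leibniz [hp : Fact p.Prime] [CharP K p] (D : Derivation K R R) (a b : R) :
    D^[p] (a * b) = a * D^[p] b + D^[p] a * b := by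
  classical
  let D₀ : Module.End K R := D
  let D₁ : Module.End K (TensorProduct K R R) := LinearMap.rTensor R D₀
  let D₂ : Module.End K (TensorProduct K R R) := LinearMap.lTensor R D₀
  have hcomm : Commute D₁ D₂ := by
    refine TensorProduct.ext' fun x y => ?_
    simp [D₁, D₂]
  have h1 : ∀ n, ∀ x : TensorProduct K R R, LinearMap.mul' K R (((D₁ + D₂) ^ n) x) =
      (D₀ ^ n) (LinearMap.mul' K R x) := by
    intro n
    induction n with
    | zero => intro x; rfl
    | succ n ih =>
      intro x
      rw [pow_succ, pow_succ, Module.End.mul_apply, Module.End.mul_apply, ih]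
      congr 1
      induction x using TensorProduct.induction_on with
      | zero => simp
      | tmul x y =>
        simp only [LinearMap.add_apply, map_add, D₁, D₂, LinearMap.rTensor_tmul,
          LinearMap.lTensor_tmul, LinearMap.mul'_apply]
        change D x * y + x * D y = D (x * y)
        rw [D.leibniz, smul_eq_mul, smul_eq_mul]
        ring
      | add x y hx hy => rw [map_add, map_add, map_add, map_add, hx, hy]
  have hchar : (p : Module.End K (TensorProduct K R R)) = 0 := by
    have h2 := map_natCast (algebraMap K (Module.End K (TensorProduct K R R))) p
    rw [← h2, CharP.cast_eq_zero, map_zero]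
  have h2 : (D₁ + D₂) ^ p = D₁ ^ p + D₂ ^ p := by
    obtain ⟨r, hr⟩ := hcomm.exists_add_pow_prime_eq hp.out
    rw [hr, hchar]
    simp
  have h3 := h1 p (a ⊗ₜ b)
  have h4 : ∀ n, ∀ x y : R, (D₁ ^ n) (x ⊗ₜ y) = (D₀ ^ n) x ⊗ₜ y := by
    intro n x y
    rw [LinearMap.rTensor_pow, LinearMap.rTensor_tmul]
  have h5 : ∀ n, ∀ x y : R, (D₂ ^ n) (x ⊗ₜ y) = x ⊗ₜ (D₀ ^ n) y := by
    intro n x y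
    rw [LinearMap.lTensor_pow, LinearMap.lTensor_tmul]
  rw [h2, LinearMap.add_apply, h4, h5, map_add, LinearMap.mul'_apply, LinearMap.mul'_apply,
    LinearMap.mul'_apply] at h3
  have h6 : ∀ x, (D₀ ^ p) x = D^[p] x := fun x => Module.End.pow_apply D₀ p x
  rw [h6, h6, h6] at h3
  rw [← h3, add_comm]

lemma iterate_const_mul (D : Derivation K R R) {c : R} (hc : D c = 0) (k : ℕ) (f : R) :
    D^[k] (c * f) = c * D^[k] f := by
  induction k with
  | zero => rfl
  | succ k ih =>
    rw [Function.iterate_succ_apply', Function.iterate_succ_apply', ih, D.leibniz, hc, smul_zero,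
      add_zero, smul_eq_mul]

lemma iterate_mul_of_const (D : Derivation K R R) {z γ : R} (hz : D z = γ) (hγ : D γ = 0) (k : ℕ)
    (a : R) : D^[k + 1] (z * a) = z * D^[k + 1] a + (k + 1) * (γ * D^[k] a) := by
  induction k with
  | zero => simp [hz]; ring
  | succ k ih =>
    rw [Function.iterate_succ_apply', ih, map_add, D.leibniz, D.leibniz,
      D.leibniz, hz, hγ, ← Function.iterate_succ_apply' D k, ← Function.iterate_succ_apply' D (k + 1)]
    have : D ((k : R) + 1) = 0 := by
      rw [map_add, Derivation.map_natCast, Derivation.map_one_eq_zero, add_zero]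
    rw [this]
    simp only [smul_eq_mul]
    push_cast
    ring

/-- A divided-power Taylor projection onto the constants of the derivation `D`. -/
noncomputable def taylor (p : ℕ) (D : Derivation K R R) (γ z f : R) : R :=
  ∑ k ∈ Finset.range p, ((k.factorial : K)⁻¹) • ((-z) ^ k * γ ^ (p - 1 - k) * D^[k] f)

variable (D : Derivation K R R) {γ z : R}

lemma taylor_add (f g : R) : taylor p D γ z (f + g) = taylor p D γ z f + taylor p D γ z g := by
  simp only [taylor, iterate_map_add, mul_add, smul_add, Finset.sum_add_distrib]

lemma taylor_zero : taylor p D γ z 0 = 0 := by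
  simp [taylor, iterate_map_zero]

lemma taylor_sum {ι : Type*} (s : Finset ι) (f : ι → R) :
    taylor p D γ z (∑ i ∈ s, f i) = ∑ i ∈ s, taylor p D γ z (f i) := by
  classical
  induction s using Finset.induction_on with
  | empty => simp [taylor_zero]
  | insert a s ha ih => rw [Finset.sum_insert ha, Finset.sum_insert ha, taylor_add, ih]

lemma taylor_const_mul {c : R} (hc : D c = 0) (f : R) :
    taylor p D γ z (c * f) = c * taylor p D γ z f := by
  simp only [taylor, iterate_const_mul D hc, Finset.mul_sum]
  refine Finset.sum_congr rfl fun k _ => ?_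
  rw [mul_smul_comm]
  congr 1
  ring

lemma taylor_const (hp0 : 0 < p) {c : R} (hc : D c = 0) :
    taylor p D γ z c = γ ^ (p - 1) * c := by
  rw [taylor, Finset.sum_eq_single 0]
  · simp
  · intro k _ hk
    obtain ⟨k, rfl⟩ := Nat.exists_eq_succ_of_ne_zero hk
    rw [Function.iterate_succ_apply, hc, iterate_map_zero, mul_zero, smul_zero]
  · intro h
    simp [hp0.ne'] at h

lemma derivation_pow_mul_eq_zero {D : Derivation K R R} {a : R} (ha : D a = 0) (n : ℕ) :
    D (a ^ n) = 0 := by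
  rw [Derivation.leibniz_pow, ha, smul_zero, smul_zero]

lemma derivation_taylor_of_commute (D' : Derivation K R R) (hz : D' z = 0) (hγ : D' γ = 0)
    (hcomm : ∀ f, D' (D f) = D (D' f)) (f : R) :
    D' (taylor p D γ z f) = taylor p D γ z (D' f) := by
  have h1 : ∀ k f, D' (D^[k] f) = D^[k] (D' f) := by
    intro k
    induction k with
    | zero => intro f; rfl
    | succ k ih =>
      intro f
      rw [Function.iterate_succ_apply, ih, hcomm, ← Function.iterate_succ_apply]
  rw [taylor, taylor, map_sum]
  refine Finset.sum_congr rfl fun k _ => ?_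
  rw [D'.map_smul, D'.leibniz, h1]
  have h2 : D' ((-z) ^ k * γ ^ (p - 1 - k)) = 0 := by
    rw [D'.leibniz, derivation_pow_mul_eq_zero hγ,
      derivation_pow_mul_eq_zero (by rw [map_neg, hz, neg_zero]), smul_zero, smul_zero, add_zero]
  rw [h2, smul_zero, add_zero, smul_eq_mul]

lemma factorial_ne_zero [hp : Fact p.Prime] [CharP K p] {k : ℕ} (hk : k < p) : (k.factorial : K) ≠ 0 := by
  rw [Ne, CharP.cast_eq_zero_iff K p, hp.out.dvd_factorial]
  omega

lemma derivation_taylor_self [hp : Fact p.Prime] [CharP K p] (hz : D z = γ) (hγ : D γ = 0) {f : R} (hf : D^[p] f = 0) :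
    D (taylor p D γ z f) = 0 := by
  have key : ∀ n ≤ p, D (∑ k ∈ Finset.range n,
      ((k.factorial : K)⁻¹) • ((-z) ^ k * γ ^ (p - 1 - k) * D^[k] f)) =
      if n = 0 then 0 else (((n - 1).factorial : K)⁻¹) • ((-z) ^ (n - 1) * γ ^ (p - n) * D^[n] f) := by
    intro n
    induction n with
    | zero => intro _; simp
    | succ n ih =>
      intro hn
      rw [Finset.sum_range_succ, map_add, ih (by omega), if_neg (Nat.succ_ne_zero n), D.map_smul,
        D.leibniz, D.leibniz, derivation_pow_mul_eq_zero hγ, smul_zero, zero_add,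
        Derivation.leibniz_pow, map_neg, hz, ← Function.iterate_succ_apply' D]
      rw [Nat.add_sub_cancel, show p - 1 - n = p - (n + 1) by omega]
      obtain _ | m := n
      · simp
      · rw [if_neg (Nat.succ_ne_zero m), Nat.add_sub_cancel, smul_add, add_comm, add_assoc]
        rw [← eq_sub_iff_add_eq']
        simp only [smul_eq_mul, Nat.succ_eq_add_one, sub_self]
        have h1 : (((m + 1).factorial : K)⁻¹) * ((m + 1 : ℕ) : K) = ((m.factorial : K)⁻¹) := by
          have h2 := factorial_ne_zero (K := K) (p := p) (k := m + 1) (by omega)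
          rw [Nat.factorial_succ, Nat.cast_mul] at h2 ⊢
          rw [mul_inv, mul_comm, ← mul_assoc, mul_inv_cancel₀ (left_ne_zero_of_mul h2), one_mul]
        rw [← h1, mul_smul, Nat.cast_smul_eq_nsmul, ← smul_add]
        convert smul_zero _
        rw [show p - (m + 1) = p - (m + 1 + 1) + 1 by omega]
        simp only [nsmul_eq_mul]
        ring
  rw [taylor, key p le_rfl, hf, mul_zero, smul_zero, ite_self]

lemma taylor_sub_mem_span (hp0 : 0 < p) (f : R) :
    taylor p D γ z f - γ ^ (p - 1) * f ∈ Ideal.span {z} := by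
  obtain ⟨n, rfl⟩ : ∃ n, p = n + 1 := ⟨p - 1, by omega⟩
  rw [taylor, Finset.sum_range_succ']
  simp only [Nat.factorial_zero, Nat.cast_one, inv_one, pow_zero, one_mul, one_smul,
    Function.iterate_zero, id, Nat.sub_zero, add_sub_cancel_right]
  refine Submodule.sum_mem _ fun k _ => ?_
  rw [← algebraMap_smul R]
  refine Submodule.smul_mem _ _ (Ideal.mem_span_singleton.2 ?_)
  rw [mul_assoc]
  exact Dvd.dvd.mul_right ((dvd_neg.2 dvd_rfl).mul_left _ |>.trans (by rw [pow_succ])) _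

lemma taylor_sub_mem (hp0 : 0 < p) {I : Ideal R} (hI : ∀ f ∈ I, D f ∈ I) {f : R} (hf : D f ∈ I) :
    taylor p D γ z f - γ ^ (p - 1) * f ∈ I := by
  obtain ⟨n, rfl⟩ : ∃ n, p = n + 1 := ⟨p - 1, by omega⟩
  rw [taylor, Finset.sum_range_succ']
  simp only [Nat.factorial_zero, Nat.cast_one, inv_one, pow_zero, one_mul, one_smul,
    Function.iterate_zero, id, Nat.sub_zero, add_sub_cancel_right]
  have h1 : ∀ k, D^[k + 1] f ∈ I := by
    intro k
    induction k with
    | zero => exact hf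
    | succ k ih => rw [Function.iterate_succ_apply']; exact hI _ ih
  refine Submodule.sum_mem _ fun k _ => ?_
  rw [← algebraMap_smul R]
  exact Submodule.smul_mem _ _ (Ideal.mul_mem_left _ _ (h1 k))

lemma taylor_mul [hp : Fact p.Prime] [CharP K p] (hz : D z = γ) (hγ : D γ = 0) (a : R) :
    z ^ p ∣ taylor p D γ z (z * a) := by
  have key : ∀ n < p, ∑ k ∈ Finset.range (n + 1),
      ((k.factorial : K)⁻¹) • ((-z) ^ k * γ ^ (p - 1 - k) * D^[k] (z * a)) =
      ((n.factorial : K)⁻¹) • ((-z) ^ n * z * γ ^ (p - 1 - n) * D^[n] a) := by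
    intro n
    induction n with
    | zero => intro _; simp; ring
    | succ n ih =>
      intro hn
      rw [Finset.sum_range_succ, ih (by omega), iterate_mul_of_const D hz hγ]
      have h1 : ((n.factorial : K)⁻¹) = (((n + 1).factorial : K)⁻¹) * ((n + 1 : ℕ) : K) := by
        have h2 := factorial_ne_zero (K := K) (p := p) hn
        rw [Nat.factorial_succ, Nat.cast_mul] at h2 ⊢
        rw [mul_inv, mul_comm, ← mul_assoc, mul_inv_cancel₀ (left_ne_zero_of_mul h2), one_mul]
      rw [h1, mul_smul, Nat.cast_smul_eq_nsmul, ← smul_add]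
      congr 1
      rw [show p - 1 - n = p - 1 - (n + 1) + 1 by omega]
      simp only [nsmul_eq_mul]
      push_cast
      ring
  have hp0 := hp.out.pos
  have h1 := key (p - 1) (by omega)
  rw [Nat.sub_add_cancel hp0] at h1
  rw [taylor, h1, ← algebraMap_smul R, smul_eq_mul]
  refine Dvd.dvd.mul_left ?_ _
  refine Dvd.dvd.mul_right (Dvd.dvd.mul_right ?_ _) _
  rw [neg_pow, mul_assoc, ← pow_succ, Nat.sub_add_cancel hp0]
  exact dvd_mul_left _ _

end Taylor
end Stillman

namespace Stillman
open MvPolynomial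

lemma exists_derivation_iterate {K R : Type*} [Field K] {p : ℕ} [Fact p.Prime] [CharP K p]
    [CommRing R] [Algebra K R] (D : Derivation K R R) :
    ∃ D' : Derivation K R R, ∀ f, D' f = D^[p] f := by
  refine ⟨Derivation.mk' ((D : Module.End K R) ^ p) fun a b => ?_,
    fun f => Module.End.pow_apply _ p f⟩
  have h := iterate_char_leibniz (p := p) D a b
  rw [mul_comm (D^[p] a) b] at h
  rw [Module.End.pow_apply, Module.End.pow_apply, Module.End.pow_apply]
  exact h

lemma pderiv_comm {σ K : Type*} [CommRing K] (k l : σ) (g : MvPolynomial σ K) :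
    pderiv k (pderiv l g) = pderiv l (pderiv k g) := by
  classical
  have h : ⁅(pderiv k : Derivation K (MvPolynomial σ K) (MvPolynomial σ K)),
      (pderiv l : Derivation K (MvPolynomial σ K) (MvPolynomial σ K))⁆ = 0 := by
    refine derivation_ext fun m => ?_
    rw [Derivation.commutator_apply, pderiv_X, pderiv_X, Pi.single_apply, Pi.single_apply]
    split_ifs <;> simp
  have h1 := DFunLike.congr_fun h g
  rw [Derivation.commutator_apply, Derivation.zero_apply, sub_eq_zero] at h1
  exact h1

section DualDerivations

variable {K : Type*} [Field K] {p : ℕ} [hp : Fact p.Prime] [CharP K p] {R : Type*} [CommRing R]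
  [Algebra K R] {Λ : Type*} [DecidableEq Λ] {z : Λ → R} {D : Λ → Derivation K R R} {γ : R}

lemma taylor_mem_span_image (hz : ∀ l m, D l (z m) = if l = m then γ else 0)
    (hγ : ∀ l, D l γ = 0) (S : Set Λ) (l : Λ) {f : R} (hf : f ∈ Ideal.span (z '' S)) :
    taylor p (D l) γ (z l) f ∈ Ideal.span (z '' S) := by
  have key : ∀ a, taylor p (D l) γ (z l) (a * f) ∈ Ideal.span (z '' S) := by
    induction hf using Submodule.span_induction with
    | mem f hf =>
      obtain ⟨m, hm, rfl⟩ := hf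
      intro a
      rw [mul_comm]
      by_cases hlm : l = m
      · subst hlm
        refine Ideal.mem_of_dvd _ ?_ (Ideal.subset_span ⟨l, hm, rfl⟩)
        exact (dvd_pow_self _ hp.out.ne_zero).trans
          (taylor_mul (D l) (by rw [hz, if_pos rfl]) (hγ l) a)
      · rw [taylor_const_mul (D l) (by rw [hz, if_neg hlm])]
        exact Ideal.mul_mem_right _ _ (Ideal.subset_span ⟨m, hm, rfl⟩)
    | zero => intro a; rw [mul_zero, taylor_zero]; exact Submodule.zero_mem _
    | add f g _ _ hf hg =>
      intro a
      rw [mul_add, taylor_add]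
      exact Submodule.add_mem _ (hf a) (hg a)
    | smul c f _ hf =>
      intro a
      rw [smul_eq_mul, ← mul_assoc]
      exact hf _
  simpa using key 1

lemma exists_forall_derivation_eq_zero [Fintype Λ]
    (hz : ∀ l m, D l (z m) = if l = m then γ else 0)
    (hγ : ∀ l, D l γ = 0) (hcomm : ∀ l m f, D l (D m f) = D m (D l f))
    (hpow : ∀ l f, (D l)^[p] f = 0) (S : Set Λ) {f : R}
    (hf : ∀ l, D l f ∈ Ideal.span (z '' S)) :
    ∃ f', f' - γ ^ ((p - 1) * Fintype.card Λ) * f ∈ Ideal.span (z '' S) ∧ ∀ l, D l f' = 0 := by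
  have key : ∀ s : Finset Λ, ∃ f', f' - γ ^ ((p - 1) * s.card) * f ∈ Ideal.span (z '' S) ∧
      (∀ l, D l f' ∈ Ideal.span (z '' S)) ∧ ∀ l ∈ s, D l f' = 0 := by
    intro s
    induction s using Finset.induction_on with
    | empty => exact ⟨f, by simp, hf, by simp⟩
    | insert l s hl ih =>
      obtain ⟨f', h1, h2, h3⟩ := ih
      have h4 : D l (taylor p (D l) γ (z l) f') = 0 :=
        derivation_taylor_self (D l) (by rw [hz, if_pos rfl]) (hγ l) (hpow l f')
      have h5 : ∀ m, m ≠ l → D m (taylor p (D l) γ (z l) f') = taylor p (D l) γ (z l) (D m f') :=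
        fun m hm => derivation_taylor_of_commute (D l) (D m) (by rw [hz, if_neg hm]) (hγ m)
          (hcomm m l) f'
      refine ⟨taylor p (D l) γ (z l) f', ?_, fun m => ?_, fun m hm => ?_⟩
      · have h6 : taylor p (D l) γ (z l) f' - γ ^ (p - 1) * f' ∈ Ideal.span (z '' S) := by
          by_cases hlS : l ∈ S
          · refine Ideal.span_mono ?_ (taylor_sub_mem_span (D l) hp.out.pos f')
            rintro _ rfl
            exact ⟨l, hlS, rfl⟩
          · refine taylor_sub_mem (D l) hp.out.pos (fun g hg => ?_) (h2 l)
            induction hg using Submodule.span_induction with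
            | mem g hg =>
              obtain ⟨m, hm, rfl⟩ := hg
              rw [hz, if_neg (by rintro rfl; exact hlS hm)]
              exact Submodule.zero_mem _
            | zero => rw [map_zero]; exact Submodule.zero_mem _
            | add f g _ _ hf hg => rw [map_add]; exact Submodule.add_mem _ hf hg
            | smul c f hfm hf =>
              rw [smul_eq_mul, (D l).leibniz]
              exact Submodule.add_mem _ (Submodule.smul_mem _ _ hf)
                (by rw [smul_eq_mul, mul_comm]; exact Ideal.mul_mem_left _ _ hfm)
        rw [Finset.card_insert_of_notMem hl]
        have h7 := Submodule.add_mem _ h6 (Ideal.mul_mem_left _ (γ ^ (p - 1)) h1)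
        convert h7 using 1
        rw [mul_add, mul_one, pow_add]
        ring
      · by_cases hm : m = l
        · rw [hm, h4]; exact Submodule.zero_mem _
        · rw [h5 m hm]
          exact taylor_mem_span_image hz hγ S l (h2 m)
      · by_cases hml : m = l
        · rw [hml, h4]
        · rw [h5 m hml, h3 m ((Finset.mem_insert.1 hm).resolve_left hml), taylor_zero]
  obtain ⟨f', h1, -, h2⟩ := key Finset.univ
  exact ⟨f', h1, fun l => h2 l (Finset.mem_univ _)⟩

lemma exists_mul_eq_sum_pow (hz : ∀ l m, D l (z m) = if l = m then γ else 0)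
    (hγ : ∀ l, D l γ = 0) (S : Finset Λ) {f : R} (hf : f ∈ Ideal.span (z '' S))
    (hDf : ∀ l, D l f = 0) :
    ∃ b : Λ → R, γ ^ ((p - 1) * S.card) * f = ∑ m ∈ S, z m ^ p * b m := by
  have key : ∀ s ⊆ S, ∃ b : Λ → R, γ ^ ((p - 1) * s.card) * f =
      ∑ m ∈ S, (if m ∈ s then z m ^ p else z m) * b m := by
    intro s
    induction s using Finset.induction_on with
    | empty =>
      intro _
      obtain ⟨c, hc⟩ := (Submodule.mem_span_image_finset_iff_exists_fun' R).1 hf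
      refine ⟨c, ?_⟩
      simp only [Finset.card_empty, mul_zero, pow_zero, one_mul, Finset.notMem_empty, if_false]
      rw [← hc]
      exact Finset.sum_congr rfl fun m _ => by rw [smul_eq_mul, mul_comm]
    | insert l s hl ih =>
      intro hsub
      obtain ⟨b, hb⟩ := ih ((Finset.subset_insert _ _).trans hsub)
      have h1 := congrArg (taylor p (D l) γ (z l)) hb
      rw [taylor_const (D l) hp.out.pos, taylor_sum] at h1
      · obtain ⟨b', hb'⟩ := taylor_mul (p := p) (D l) (z := z l) (by rw [hz, if_pos rfl]) (hγ l) (b l)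
        refine ⟨fun m => if m = l then b' else taylor p (D l) γ (z l) (b m), ?_⟩
        rw [Finset.card_insert_of_notMem hl, mul_add, mul_one, pow_add, mul_comm (γ ^ _) (γ ^ _),
          mul_assoc, h1]
        refine Finset.sum_congr rfl fun m _ => ?_
        by_cases hml : m = l
        · subst hml
          simp only [if_neg hl, Finset.mem_insert_self, if_true, hb']
        · have h2 : D l (z m) = 0 := by rw [hz, if_neg (Ne.symm hml)]
          rw [taylor_const_mul]
          · simp only [Finset.mem_insert, hml, false_or, if_false]
          · split_ifs
            · exact derivation_pow_mul_eq_zero h2 p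
            · exact h2
      · rw [(D l).leibniz, hDf, derivation_pow_mul_eq_zero (hγ l), smul_zero, smul_zero, add_zero]
  exact (key S subset_rfl).imp fun b hb => hb.trans
    (Finset.sum_congr rfl fun m hm => by rw [if_pos hm])

end DualDerivations

section FrobeniusFlat

variable {K : Type*} [Field K] {p : ℕ} [hp : Fact p.Prime] [CharP K p] [PerfectField K] {N : ℕ}

lemma exists_eq_pow_of_pderiv_eq_zero {f : MvPolynomial (Fin N) K} (hf : ∀ j, pderiv j f = 0) :
    ∃ g, f = g ^ p := by
  have : ExpChar K p := .prime hp.out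
  have : ExpChar (MvPolynomial (Fin N) K) p := inferInstance
  have : PerfectRing K p := PerfectField.toPerfectRing p
  have key : f ∈ (frobenius (MvPolynomial (Fin N) K) p).range := by
    rw [f.as_sum]
    refine Subring.sum_mem _ fun e he => ?_
    have h1 : ∀ j, p ∣ e j := by
      intro j
      by_contra hj
      have h2 : e j ≠ 0 := by rintro h; exact hj (h ▸ dvd_zero p)
      have h3 := congrArg (coeff (e - Finsupp.single j 1)) (hf j)
      rw [coeff_pderiv, coeff_zero, tsub_add_cancel_of_le (by
        rw [Finsupp.single_le_iff]; omega)] at h3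
      rcases mul_eq_zero.1 h3 with h3 | h3
      · exact (mem_support_iff.1 he) h3
      · have h4 : ((e j : ℕ) : K) = 0 := by
          rw [← h3, Finsupp.tsub_apply, Finsupp.single_eq_same]
          norm_cast
          rw [Nat.sub_add_cancel (by omega)]
        exact hj ((CharP.cast_eq_zero_iff K p _).1 h4)
    choose e' he' using h1
    refine ⟨monomial (Finsupp.equivFunOnFinite.symm e') ((frobeniusEquiv K p).symm (coeff e f)), ?_⟩
    rw [frobenius_def, monomial_pow]
    have h2 : p • Finsupp.equivFunOnFinite.symm e' = e := by
      refine Finsupp.ext fun j => ?_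
      simp [he']
    rw [h2, frobeniusEquiv_symm_pow_p]
  obtain ⟨g, hg⟩ := key
  exact ⟨g, hg.symm⟩

lemma mem_span_of_pow_eq_sum {Λ : Type*} (S : Finset Λ) (z : Λ → MvPolynomial (Fin N) K)
    {f : MvPolynomial (Fin N) K} {b : Λ → MvPolynomial (Fin N) K}
    (hf : f ^ p = ∑ m ∈ S, z m ^ p * b m) : f ∈ Ideal.span (z '' S) := by
  have : ExpChar K p := .prime hp.out
  have hpz : ∀ l (g : MvPolynomial (Fin N) K), pderiv l (g ^ p) = 0 := by
    intro l g
    rw [Derivation.leibniz_pow, ← Nat.cast_smul_eq_nsmul K, CharP.cast_eq_zero, zero_smul]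
  have hX : ∀ l m : Fin N, pderiv l (X m : MvPolynomial (Fin N) K) = if l = m then 1 else 0 := by
    intro l m
    rw [pderiv_X, Pi.single_apply]
    simp only [eq_comm]
  have hpow : ∀ l (g : MvPolynomial (Fin N) K), (pderiv l)^[p] g = 0 := by
    intro l g
    obtain ⟨D', hD'⟩ := exists_derivation_iterate (p := p) (pderiv l : Derivation K (MvPolynomial (Fin N) K) _)
    have h1 : D' = 0 := by
      refine derivation_ext fun m => ?_
      rw [hD']
      obtain ⟨n, hn⟩ : ∃ n, p = n + 2 := ⟨p - 2, by have := hp.out.two_le; omega⟩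
      rw [hn]
      change (pderiv l)^[n] (pderiv l (pderiv l (X m))) = 0
      rw [hX]
      split_ifs <;> simp [iterate_map_zero]
    have h2 := DFunLike.congr_fun h1 g
    rw [hD'] at h2
    exact h2
  have key : ∀ s : Finset (Fin N), ∃ b : Λ → MvPolynomial (Fin N) K,
      f ^ p = ∑ m ∈ S, z m ^ p * b m ∧ ∀ l ∈ s, ∀ m, pderiv l (b m) = 0 := by
    intro s
    induction s using Finset.induction_on with
    | empty => exact ⟨b, hf, by simp⟩
    | insert l s hl ih =>
      obtain ⟨b, hb, hb'⟩ := ih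
      refine ⟨fun m => taylor p (pderiv l) 1 (X l) (b m), ?_, fun k hk m => ?_⟩
      · have h1 := congrArg (taylor p (pderiv l) 1 (X l)) hb
        rw [taylor_const _ hp.out.pos (hpz l f), one_pow, one_mul, taylor_sum] at h1
        rw [h1]
        exact Finset.sum_congr rfl fun m _ => taylor_const_mul _ (hpz l _) _
      · by_cases hkl : k = l
        · subst hkl
          exact derivation_taylor_self _ (by rw [hX, if_pos rfl]) (Derivation.map_one_eq_zero _)
            (hpow k _)
        · have h1 : ∀ g : MvPolynomial (Fin N) K, pderiv k (pderiv l g) = pderiv l (pderiv k g) := by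
            intro g
            exact pderiv_comm k l g
          rw [derivation_taylor_of_commute _ (pderiv k) (by rw [hX, if_neg hkl])
            (Derivation.map_one_eq_zero _) h1, hb' k ((Finset.mem_insert.1 hk).resolve_left hkl),
            taylor_zero]
  obtain ⟨b, hb, hb'⟩ := key Finset.univ
  choose g hg using fun m => exists_eq_pow_of_pderiv_eq_zero (p := p)
    fun l => hb' l (Finset.mem_univ l) m
  have h1 : f = ∑ m ∈ S, z m * g m := by
    apply frobenius_inj (MvPolynomial (Fin N) K) p
    rw [map_sum]
    simp only [frobenius_def, mul_pow]
    rw [hb]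
    exact Finset.sum_congr rfl fun m _ => by rw [← hg]
  rw [h1]
  exact Submodule.sum_mem _ fun m hm => Ideal.mul_mem_right _ _ (Ideal.subset_span ⟨m, hm, rfl⟩)

end FrobeniusFlat
end Stillman

namespace Stillman
open MvPolynomial

section Jacobian

variable {K : Type*} [Field K] {N : ℕ} {V : Type v} [Fintype V] [DecidableEq V]

/-- The minor of the Jacobian matrix of `w` with the variables selected by `j`. -/
noncomputable def jacMinor (w : V → MvPolynomial (Fin N) K) (j : V → Fin N) : MvPolynomial (Fin N) K :=
  (Matrix.of fun a v => pderiv (j a) (w v)).det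

lemma derivation_sum_apply {ι : Type*} (s : Finset ι)
    (D : ι → Derivation K (MvPolynomial (Fin N) K) (MvPolynomial (Fin N) K)) (f : MvPolynomial (Fin N) K) :
    (∑ i ∈ s, D i) f = ∑ i ∈ s, D i f := by
  classical
  induction s using Finset.induction with
  | empty => simp
  | insert a s ha ih => rw [Finset.sum_insert ha, Finset.sum_insert ha, Derivation.add_apply, ih]

lemma exists_jacobian_dual (w : V → MvPolynomial (Fin N) K) (j : V → Fin N) :
    ∃ (Λ : Type v) (_ : Fintype Λ) (_ : DecidableEq Λ) (z : Λ → MvPolynomial (Fin N) K)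
      (D : Λ → Derivation K (MvPolynomial (Fin N) K) (MvPolynomial (Fin N) K)) (ι : V → Λ),
      (∀ v, z (ι v) = w v) ∧ (∀ l m, D l (z m) = if l = m then jacMinor w j else 0) ∧
      (∀ k, ∃ c : Λ → MvPolynomial (Fin N) K, ∀ f, jacMinor w j * pderiv k f = ∑ l, c l * D l f) := by
  classical
  by_cases hj : jacMinor w j = 0
  · refine ⟨V, inferInstance, inferInstance, w, 0, id, fun _ => rfl, fun l m => ?_, fun k => ⟨0, fun f => ?_⟩⟩
    · rw [hj, ite_self]; rfl
    · rw [hj]; simp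
  have hinj : Function.Injective j := by
    intro a b hab
    by_contra hne
    exact hj (Matrix.det_zero_of_row_eq hne (by ext v; simp [hab]))
  set M : Matrix V V (MvPolynomial (Fin N) K) := Matrix.of fun a v => pderiv (j a) (w v) with hM
  set g := jacMinor w j with hg
  have hgM : M.det = g := rfl
  let E : V → Derivation K (MvPolynomial (Fin N) K) (MvPolynomial (Fin N) K) :=
    fun v => ∑ a, M.adjugate v a • pderiv (j a)
  have hE : ∀ v f, E v f = ∑ a, M.adjugate v a * pderiv (j a) f := by
    intro v f
    simp only [E, derivation_sum_apply, Derivation.smul_apply, smul_eq_mul]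
  have hEw : ∀ v u, E v (w u) = if v = u then g else 0 := by
    intro v u
    have h1 := congrFun (congrFun (Matrix.adjugate_mul M) v) u
    rw [Matrix.mul_apply, Matrix.smul_apply, Matrix.one_apply, hgM] at h1
    rw [hE]
    refine h1.trans ?_
    split_ifs <;> simp
  have hEX : ∀ v l, l ∉ Set.range j → E v (X l) = 0 := by
    intro v l hl
    rw [hE]
    refine Finset.sum_eq_zero fun a _ => ?_
    rw [pderiv_X_of_ne (by rintro rfl; exact hl ⟨a, rfl⟩), mul_zero]
  let E' : {l // l ∉ Set.range j} → Derivation K (MvPolynomial (Fin N) K) (MvPolynomial (Fin N) K) :=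
    fun l => g • pderiv l.1 - ∑ v, pderiv l.1 (w v) • E v
  have hE' : ∀ l f, E' l f = g * pderiv l.1 f - ∑ v, pderiv l.1 (w v) * E v f := by
    intro l f
    simp only [E', Derivation.sub_apply, derivation_sum_apply, Derivation.smul_apply, smul_eq_mul]
  refine ⟨V ⊕ {l // l ∉ Set.range j}, inferInstance, inferInstance,
    Sum.elim w fun l => X l.1, Sum.elim E E', Sum.inl, fun v => rfl, ?_, fun k => ?_⟩
  · rintro (v | l) (u | m)
    · simp only [Sum.elim_inl, Sum.inl.injEq]
      exact hEw v u
    · simp only [Sum.elim_inl, Sum.elim_inr, reduceCtorEq, if_false]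
      exact hEX v m.1 m.2
    · simp only [Sum.elim_inl, Sum.elim_inr, reduceCtorEq, if_false]
      rw [hE']
      simp [hEw, mul_comm]
    · simp only [Sum.elim_inr, Sum.inr.injEq]
      rw [hE']
      simp only [hEX _ m.1 m.2, mul_zero, Finset.sum_const_zero, sub_zero, pderiv_X, Pi.single_apply,
        Subtype.ext_iff, eq_comm, mul_ite, mul_one]
  · by_cases hk : k ∈ Set.range j
    · obtain ⟨a, rfl⟩ := hk
      refine ⟨Sum.elim (fun v => M a v) 0, fun f => ?_⟩
      rw [Fintype.sum_sum_type]
      simp only [Sum.elim_inl, Sum.elim_inr, Pi.zero_apply, zero_mul, Finset.sum_const_zero,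
        add_zero, hE, Finset.mul_sum]
      rw [Finset.sum_comm]
      have h1 : ∀ b, ∑ v, M a v * (M.adjugate v b * pderiv (j b) f) =
          (if a = b then g else 0) * pderiv (j b) f := by
        intro b
        have h2 := congrFun (congrFun (Matrix.mul_adjugate M) a) b
        rw [Matrix.mul_apply, Matrix.smul_apply, Matrix.one_apply, hgM] at h2
        simp only [← mul_assoc]
        rw [← Finset.sum_mul, h2]
        split_ifs <;> simp
      simp only [h1, ite_mul, zero_mul]
      simp
    · refine ⟨Sum.elim (fun v => pderiv k (w v)) (fun l => if l = ⟨k, hk⟩ then 1 else 0), fun f => ?_⟩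
      rw [Fintype.sum_sum_type]
      simp only [Sum.elim_inl, Sum.elim_inr, ite_mul, zero_mul, one_mul, Finset.sum_ite_eq',
        Finset.mem_univ, if_true, hE']
      ring

lemma derivation_apply_eq_sum (D : Derivation K (MvPolynomial (Fin N) K) (MvPolynomial (Fin N) K))
    (f : MvPolynomial (Fin N) K) : D f = ∑ k, D (X k) * pderiv k f := by
  classical
  have h : D = ∑ k, D (X k) • pderiv k := by
    refine derivation_ext fun m => ?_
    simp [derivation_sum_apply, pderiv_X, Pi.single_apply]
  conv_lhs => rw [h]
  simp [derivation_sum_apply]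

variable {p : ℕ} [hp : Fact p.Prime] [CharP K p]

lemma exists_jacobian_dual_commuting (w : V → MvPolynomial (Fin N) K) (j : V → Fin N)
    (hj : jacMinor w j ≠ 0) :
    ∃ (Λ : Type v) (_ : Fintype Λ) (_ : DecidableEq Λ) (z : Λ → MvPolynomial (Fin N) K)
      (D : Λ → Derivation K (MvPolynomial (Fin N) K) (MvPolynomial (Fin N) K)) (ι : V → Λ),
      (∀ v, z (ι v) = w v) ∧ (∀ l m, D l (z m) = if l = m then jacMinor w j ^ p else 0) ∧
      (∀ l, D l (jacMinor w j ^ p) = 0) ∧ (∀ l m f, D l (D m f) = D m (D l f)) ∧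
      (∀ l f, (D l)^[p] f = 0) ∧ (∀ f, (∀ l, D l f = 0) → ∀ k, pderiv k f = 0) := by
  classical
  obtain ⟨Λ, _, _, z, D, ι, hι, hz, hc⟩ := exists_jacobian_dual w j
  set g := jacMinor w j with hg
  have hp1 : g ^ (p - 1) * g = g ^ p := by
    rw [← pow_succ, Nat.sub_add_cancel hp.out.pos]
  have hg0 : g ^ (p - 1) ≠ 0 := pow_ne_zero _ hj
  have hker : ∀ f, (∀ l, D l f = 0) → ∀ k, pderiv k f = 0 := by
    intro f hf k
    obtain ⟨c, hc⟩ := hc k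
    have h1 := hc f
    simp only [hf, mul_zero, Finset.sum_const_zero] at h1
    exact (mul_eq_zero.1 h1).resolve_left hj
  have hzero : ∀ D' : Derivation K (MvPolynomial (Fin N) K) (MvPolynomial (Fin N) K),
      (∀ m, D' (z m) = 0) → D' = 0 := by
    intro D' hD'
    choose c hc using hc
    have h1 : ∀ f, g * D' f = ∑ l, (∑ k, D' (X k) * c k l) * D l f := by
      intro f
      rw [derivation_apply_eq_sum D' f, Finset.mul_sum]
      simp only [Finset.sum_mul]
      rw [Finset.sum_comm]
      refine Finset.sum_congr rfl fun k _ => ?_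
      rw [mul_left_comm, hc, Finset.mul_sum]
      exact Finset.sum_congr rfl fun l _ => (mul_assoc _ _ _).symm
    have h2 : ∀ m, ∑ k, D' (X k) * c k m = 0 := by
      intro m
      have h3 := h1 (z m)
      rw [hD', mul_zero] at h3
      simp only [hz, mul_ite, mul_zero, Finset.sum_ite_eq', Finset.mem_univ, if_true] at h3
      exact (mul_eq_zero.1 h3.symm).resolve_right hj
    ext1 m
    have h3 := h1 (X m)
    simp only [h2, zero_mul, Finset.sum_const_zero] at h3
    exact (mul_eq_zero.1 h3).resolve_left hj
  have hgp : ∀ D' : Derivation K (MvPolynomial (Fin N) K) (MvPolynomial (Fin N) K), D' (g ^ p) = 0 := by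
    intro D'
    rw [Derivation.leibniz_pow, ← Nat.cast_smul_eq_nsmul K, CharP.cast_eq_zero, zero_smul]
  have hz' : ∀ l m, (g ^ (p - 1) • D l) (z m) = if l = m then g ^ p else 0 := by
    intro l m
    rw [Derivation.smul_apply, hz, smul_eq_mul, mul_ite, mul_zero, hp1]
  refine ⟨Λ, inferInstance, inferInstance, z, fun l => g ^ (p - 1) • D l, ι, hι, hz', fun l => hgp _,
    fun l m f => ?_, fun l f => ?_, fun f hf => hker f fun l => ?_⟩
  · have h1 := hzero ⁅g ^ (p - 1) • D l, g ^ (p - 1) • D m⁆ (fun n => by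
      rw [Derivation.commutator_apply, hz', hz']
      split_ifs <;> simp only [hgp, map_zero, sub_zero])
    have h2 := DFunLike.congr_fun h1 f
    rw [Derivation.commutator_apply, Derivation.zero_apply, sub_eq_zero] at h2
    exact h2
  · obtain ⟨D', hD'⟩ := exists_derivation_iterate (p := p) (g ^ (p - 1) • D l)
    have h1 := hzero D' (fun m => by
      rw [hD']
      obtain ⟨n, hn⟩ : ∃ n, p = n + 2 := ⟨p - 2, by have := hp.out.two_le; omega⟩
      have h2 : (g ^ (p - 1) • D l) ((g ^ (p - 1) • D l) (z m)) = 0 := by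
        rw [hz']
        split_ifs
        · exact hgp _
        · exact map_zero _
      generalize hE : g ^ (p - 1) • D l = E at h2 ⊢
      rw [hn, Function.iterate_add_apply]
      change E^[n] (E (E (z m))) = 0
      rw [h2, iterate_map_zero])
    have h2 := DFunLike.congr_fun h1 f
    rw [hD'] at h2
    exact h2
  · have h1 := hf l
    rw [Derivation.smul_apply, smul_eq_mul] at h1
    exact (mul_eq_zero.1 h1).resolve_left hg0

variable [PerfectField K]

lemma exists_pow_sub_pow_mem (w : V → MvPolynomial (Fin N) K) (j : V → Fin N)
    (hj : jacMinor w j ≠ 0) :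
    ∃ M : ℕ, (∀ F : MvPolynomial (Fin N) K, (∀ k, pderiv k F ∈ Ideal.span (Set.range w)) →
        ∃ G, jacMinor w j ^ (p * M) * F - G ^ p ∈ Ideal.span (Set.range w)) ∧
      ∀ f : MvPolynomial (Fin N) K, f ^ p ∈ Ideal.span (Set.range w) →
        jacMinor w j ^ M * f ∈ Ideal.span (Set.range w) := by
  obtain ⟨Λ, _, _, z, D, ι, hι, hz, hγ, hcomm, hpow, hker⟩ :=
    exists_jacobian_dual_commuting (p := p) w j hj
  have hS : Set.range w = z '' (Finset.univ.image ι : Finset Λ) := by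
    ext x
    simp [hι]
  set g := jacMinor w j with hg
  rw [hS]
  have hcard : (Finset.univ.image ι).card ≤ Fintype.card Λ := Finset.card_le_univ _
  refine ⟨(p - 1) * Fintype.card Λ, fun F hF => ?_, fun f hf => ?_⟩
  · obtain ⟨F', h1, h2⟩ := exists_forall_derivation_eq_zero hz hγ hcomm hpow
      (Finset.univ.image ι : Finset Λ) (f := F) (fun l => by
        rw [derivation_apply_eq_sum (D l) F]
        exact Submodule.sum_mem _ fun k _ => Ideal.mul_mem_left _ _ (hF k))
    obtain ⟨G, hG⟩ := exists_eq_pow_of_pderiv_eq_zero (p := p) (hker F' h2)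
    refine ⟨G, ?_⟩
    rw [← hG, pow_mul]
    have := Submodule.neg_mem _ h1
    rwa [neg_sub] at this
  · have hDf : ∀ l, D l (f ^ p) = 0 := by
      intro l
      rw [Derivation.leibniz_pow, ← Nat.cast_smul_eq_nsmul K, CharP.cast_eq_zero, zero_smul]
    obtain ⟨b, hb⟩ := exists_mul_eq_sum_pow hz hγ _ hf hDf
    rw [← pow_mul, mul_comm p, pow_mul, ← mul_pow] at hb
    have h1 := mem_span_of_pow_eq_sum _ z hb
    have h2 : (p - 1) * Fintype.card Λ = ((p - 1) * Fintype.card Λ -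
        (p - 1) * (Finset.univ.image ι).card) + (p - 1) * (Finset.univ.image ι).card :=
      (Nat.sub_add_cancel (Nat.mul_le_mul_left _ hcard)).symm
    rw [h2, pow_add, mul_assoc]
    exact Ideal.mul_mem_left _ _ h1

/-- A polynomial whose derivatives vanish along a complete intersection that is smooth in
codimension one is a `p`-th power along it. -/
theorem exists_sub_pow_mem (w : V → MvPolynomial (Fin N) K) (j j' : V → Fin N)
    (hg : ∀ f, jacMinor w j * f ∈ Ideal.span (Set.range w) → f ∈ Ideal.span (Set.range w))
    (hh : ∀ f, jacMinor w j' * f ∈ Ideal.span (Set.range w) ⊔ Ideal.span {jacMinor w j} →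
      f ∈ Ideal.span (Set.range w) ⊔ Ideal.span {jacMinor w j})
    {F : MvPolynomial (Fin N) K} (hF : ∀ k, pderiv k F ∈ Ideal.span (Set.range w)) :
    ∃ G, F - G ^ p ∈ Ideal.span (Set.range w) := by
  have : ExpChar K p := .prime hp.out
  set I := Ideal.span (Set.range w) with hI
  by_cases htop : (1 : MvPolynomial (Fin N) K) ∈ I
  · exact ⟨0, by rw [← mul_one (F - 0 ^ p)]; exact Ideal.mul_mem_left _ _ htop⟩
  have hg0 : jacMinor w j ≠ 0 := fun h => htop (hg 1 (by rw [h, zero_mul]; exact I.zero_mem))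
  have hgn : ∀ n f, jacMinor w j ^ n * f ∈ I → f ∈ I := by
    intro n
    induction n with
    | zero => intro f hf; simpa using hf
    | succ n ih => intro f hf; rw [pow_succ, mul_assoc] at hf; exact hg _ (ih _ hf)
  by_cases hh0 : jacMinor w j' = 0
  · have h1 := hh 1 (by rw [hh0, zero_mul]; exact Submodule.zero_mem _)
    obtain ⟨a, ha, b, hb, hab⟩ := Submodule.mem_sup.1 h1
    obtain ⟨c, rfl⟩ := Ideal.mem_span_singleton'.1 hb
    obtain ⟨M, hM, -⟩ := exists_pow_sub_pow_mem (p := p) w j hg0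
    obtain ⟨G, hG⟩ := hM F hF
    refine ⟨c ^ M * G, hgn (p * M) _ ?_⟩
    have h2 : (c * jacMinor w j) ^ (p * M) - 1 ∈ I := by
      rw [← Ideal.Quotient.eq, map_pow]
      have h3 : Ideal.Quotient.mk I (c * jacMinor w j) = 1 := by
        rw [← map_one (Ideal.Quotient.mk I), Ideal.Quotient.eq, ← hab]
        have := I.neg_mem ha
        convert this using 1
        ring
      rw [h3, one_pow, map_one]
    have h4 := I.sub_mem hG (I.mul_mem_right (G ^ p) h2)
    convert h4 using 1
    rw [mul_pow, mul_pow, ← pow_mul, mul_comm M p]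
    ring
  obtain ⟨M₁, hM₁, hred⟩ := exists_pow_sub_pow_mem (p := p) w j hg0
  obtain ⟨M₂, hM₂, -⟩ := exists_pow_sub_pow_mem (p := p) w j' hh0
  obtain ⟨G₁, hG₁⟩ := hM₁ F hF
  obtain ⟨G₂, hG₂⟩ := hM₂ F hF
  set g := jacMinor w j with hgdef
  set h := jacMinor w j' with hhdef
  have h1 : g ^ M₁ * G₂ - h ^ M₂ * G₁ ∈ I := by
    refine hgn M₁ _ (hred _ ?_)
    rw [sub_pow_expChar, mul_pow, mul_pow, ← pow_mul, ← pow_mul, mul_comm M₁, mul_comm M₂]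
    have h2 := I.sub_mem (I.mul_mem_left (h ^ (p * M₂)) hG₁) (I.mul_mem_left (g ^ (p * M₁)) hG₂)
    convert h2 using 1
    ring
  have hhn : ∀ n f, h ^ n * f ∈ I ⊔ Ideal.span {g} → f ∈ I ⊔ Ideal.span {g} := by
    intro n
    induction n with
    | zero => intro f hf; simpa using hf
    | succ n ih => intro f hf; rw [pow_succ, mul_assoc] at hf; exact hh _ (ih _ hf)
  have key : ∀ n G₁ G₂, g ^ n * G₂ - h ^ M₂ * G₁ ∈ I → ∃ G₃, G₁ - g ^ n * G₃ ∈ I := by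
    intro n
    induction n with
    | zero => intro G₁ G₂ _; exact ⟨G₁, by simp⟩
    | succ n ih =>
      intro G₁ G₂ hG
      have h3 : G₁ ∈ I ⊔ Ideal.span {g} := by
        refine hhn M₂ _ ?_
        have h4 : h ^ M₂ * G₁ = -(g ^ (n + 1) * G₂ - h ^ M₂ * G₁) + g * (g ^ n * G₂) := by ring
        rw [h4]
        exact Submodule.add_mem_sup (I.neg_mem hG) (Ideal.mul_mem_right _ _ (Ideal.mem_span_singleton_self g))
      obtain ⟨a, ha, b, hb, hab⟩ := Submodule.mem_sup.1 h3
      obtain ⟨c, rfl⟩ := Ideal.mem_span_singleton'.1 hb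
      obtain ⟨G₃, hG₃⟩ := ih c G₂ (hg _ (by
        have h5 := I.add_mem hG (I.mul_mem_left (h ^ M₂) ha)
        convert h5 using 1
        rw [← hab]
        ring))
      refine ⟨G₃, ?_⟩
      have h6 := I.add_mem ha (I.mul_mem_left g hG₃)
      convert h6 using 1
      rw [← hab]
      ring
  obtain ⟨G₃, hG₃⟩ := key M₁ G₁ G₂ h1
  refine ⟨G₃, hgn (p * M₁) _ ?_⟩
  have h5 : G₁ ^ p - (g ^ M₁ * G₃) ^ p ∈ I := by
    rw [← sub_pow_expChar]
    exact I.pow_mem_of_mem hG₃ p hp.out.pos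
  have h6 := I.add_mem hG₁ h5
  convert h6 using 1
  rw [mul_pow, ← pow_mul, mul_comm M₁]
  ring

end Jacobian
end Stillman

namespace Stillman
open MvPolynomial

section Specialization

variable {K E F Ω : Type*} [Field K] [Field E] [Field F] [Algebra K E]

open Classical in
/-- Substitute constants for the variables in `V`, and keep the other variables. -/
noncomputable def partialEval (V : Set Ω) (ζ : Ω → E) :
    MvPolynomial Ω K →ₐ[K] MvPolynomial {ω // ω ∉ V} E :=
  aeval fun ω => if h : ω ∈ V then C (ζ ω) else X ⟨ω, h⟩

lemma exists_partialEval_monomial (V : Set Ω) (ζ : Ω → E) (u : Ω →₀ ℕ) (a : K) :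
    ∃ b : E, ((∀ ω ∈ V, u ω = 0) → b = algebraMap K E a) ∧
      partialEval V ζ (monomial u a) = monomial (u.comapDomain Subtype.val Subtype.val_injective.injOn) b := by
  classical
  induction u using Finsupp.induction generalizing a with
  | zero =>
    refine ⟨algebraMap K E a, fun _ => rfl, ?_⟩
    rw [partialEval, aeval_monomial]
    simp [MvPolynomial.algebraMap_apply]
  | single_add ω n u hω hn ih =>
    obtain ⟨b, hb, h⟩ := ih a
    have h1 : monomial (Finsupp.single ω n + u) a = (X ω ^ n : MvPolynomial Ω K) * monomial u a := by
      rw [X_pow_eq_monomial, monomial_mul, one_mul]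
    by_cases hV : ω ∈ V
    · refine ⟨ζ ω ^ n * b, fun h0 => ?_, ?_⟩
      · have := h0 ω hV
        simp [hn] at this
      · rw [h1, map_mul, h, map_pow, partialEval, aeval_X, dif_pos hV, ← C_pow, C_mul_monomial]
        congr 2
        ext t
        have : ω ≠ t.1 := fun h => t.2 (h ▸ hV)
        simp [Finsupp.comapDomain_apply, this]
    · refine ⟨b, fun h0 => hb fun v hv => ?_, ?_⟩
      · have := h0 v hv
        rw [Finsupp.add_apply] at this
        omega
      · rw [h1, map_mul, h, map_pow, partialEval, aeval_X, dif_neg hV, X_pow_eq_monomial, monomial_mul, one_mul]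
        congr 2
        ext t
        simp [Finsupp.single_apply, Subtype.ext_iff]

lemma coeff_partialEval {V : Set Ω} {δ : Ω → ℕ} (hδ : ∀ ω, 0 < δ ω) (ζ : Ω → E)
    {p : MvPolynomial Ω K} {n : ℕ} (hp : p.IsWeightedHomogeneous δ n) (u : Ω →₀ ℕ)
    (hu : ∀ ω ∈ V, u ω = 0) (hn : n ≤ Finsupp.weight δ u) :
    coeff (u.comapDomain Subtype.val Subtype.val_injective.injOn) (partialEval V ζ p) =
      algebraMap K E (coeff u p) := by
  classical
  have hw : ∀ u' : Ω →₀ ℕ, Finsupp.weight δ u' ≤ Finsupp.weight δ u →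
      u'.comapDomain (Subtype.val : {ω // ω ∉ V} → Ω) Subtype.val_injective.injOn =
        u.comapDomain Subtype.val Subtype.val_injective.injOn → u' = u := by
    intro u' hle heq
    have h1 : u ≤ u' := by
      intro ω
      by_cases hω : ω ∈ V
      · rw [hu ω hω]; exact Nat.zero_le _
      · have := DFunLike.congr_fun heq ⟨ω, hω⟩
        simp only [Finsupp.comapDomain_apply] at this
        exact this.ge
    obtain ⟨d, rfl⟩ := exists_add_of_le h1
    rw [map_add] at hle
    have h2 : Finsupp.weight δ d = 0 := by omega
    have h3 : d = 0 := by
      ext ω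
      by_contra h
      have h4 := Finsupp.le_weight δ (hδ ω).ne' d
      have h5 : d ω = 0 := by omega
      exact h h5
    rw [h3, add_zero]
  conv_lhs => rw [p.as_sum, map_sum, coeff_sum]
  have h1 : ∀ u' ∈ p.support, coeff (u.comapDomain Subtype.val Subtype.val_injective.injOn)
      (partialEval V ζ (monomial u' (coeff u' p))) = if u' = u then algebraMap K E (coeff u p) else 0 := by
    intro u' hu'
    obtain ⟨b, hb, h⟩ := exists_partialEval_monomial V ζ u' (coeff u' p)
    rw [h, coeff_monomial]
    by_cases he : u' = u
    · subst he
      rw [if_pos rfl, if_pos rfl, hb hu]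
    · rw [if_neg he, if_neg]
      intro h2
      refine he (hw u' ?_ h2)
      rw [hp (mem_support_iff.1 hu')]
      exact hn
  rw [Finset.sum_congr rfl h1]
  simp only [Finset.sum_ite_eq', mem_support_iff]
  split_ifs with h
  · rfl
  · rw [not_not.1 h, map_zero]

variable [Algebra E F] [Algebra K F] [IsScalarTower K E F]

lemma exists_linear_relation {β J : Type*} [Fintype β] {δ : Ω → ℕ} (hδ : ∀ ω, 0 < δ ω) (z : Ω → F)
    (V : Set Ω) (hV : ∀ ω ∈ V, z ω ∈ Set.range (algebraMap E F))
    (hz : AlgebraicIndependent E fun t : {ω // ω ∉ V} => z t)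
    (n : β → ℕ) (p : J → β → MvPolynomial Ω K) (hp : ∀ j b, (p j b).IsWeightedHomogeneous δ (n b))
    (c : β → E) (hc : c ≠ 0) (h : ∀ j, ∑ b, algebraMap E F (c b) * aeval z (p j b) = 0) :
    ∃ (k : ℕ) (l : β → K), l ≠ 0 ∧ (∀ b, l b ≠ 0 → n b = k) ∧
      ∀ j, ∑ b, l b • p j b ∈ Ideal.span (X '' V) := by
  classical
  choose! ζ hζ using hV
  have hcomp : ∀ q : MvPolynomial Ω K, aeval (fun t : {ω // ω ∉ V} => z t) (partialEval V ζ q) = aeval z q := by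
    intro q
    have : ((aeval fun t : {ω // ω ∉ V} => z t : MvPolynomial _ E →ₐ[E] F).restrictScalars K).comp
        (partialEval V ζ) = (aeval z : MvPolynomial Ω K →ₐ[K] F) := by
      ext ω
      simp only [partialEval, AlgHom.comp_apply, aeval_X, AlgHom.restrictScalars_apply]
      split_ifs with hω
      · rw [aeval_C, hζ _ hω]
      · rw [aeval_X]
    exact DFunLike.congr_fun this q
  have hrel : ∀ j, ∑ b, C (c b) * partialEval V ζ (p j b) = 0 := by
    intro j
    refine hz ?_
    rw [map_zero, ← h j, map_sum]
    refine Finset.sum_congr rfl fun b _ => ?_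
    rw [map_mul, hcomp, aeval_C]
  obtain ⟨b₁, hb₁⟩ := Function.ne_iff.1 hc
  obtain ⟨b₀, hb₀, hmax⟩ := Finset.exists_max_image (Finset.univ.filter fun b => c b ≠ 0) n
    ⟨b₁, by simpa using hb₁⟩
  simp only [Finset.mem_filter, Finset.mem_univ, true_and] at hb₀ hmax
  obtain ⟨φ, hφ⟩ : ∃ φ : Module.Dual K E, φ (c b₀) ≠ 0 := by
    by_contra! h
    exact hb₀ ((Module.forall_dual_apply_eq_zero_iff K _).1 h)
  refine ⟨n b₀, fun b => if n b = n b₀ then φ (c b) else 0, fun h0 => ?_, fun b hb => ?_, fun j => ?_⟩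
  · have := congrFun h0 b₀
    simp only [if_true, Pi.zero_apply] at this
    exact hφ this
  · by_contra h
    exact hb (if_neg h)
  · rw [mem_ideal_span_X_image]
    intro u hu
    by_contra! hcon
    rw [mem_support_iff, coeff_sum] at hu
    apply hu
    simp only [coeff_smul, smul_eq_mul, ite_mul, zero_mul]
    by_cases hw : Finsupp.weight δ u = n b₀
    · have h1 := congrArg (coeff (u.comapDomain Subtype.val Subtype.val_injective.injOn)) (hrel j)
      rw [coeff_sum, coeff_zero] at h1
      have h2 : ∀ b, coeff (u.comapDomain Subtype.val Subtype.val_injective.injOn)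
          (C (c b) * partialEval V ζ (p j b)) = if n b = n b₀ then coeff u (p j b) • c b else 0 := by
        intro b
        rw [coeff_C_mul]
        by_cases hcb : c b = 0
        · simp [hcb]
        rw [coeff_partialEval hδ ζ (hp j b) u hcon (hw ▸ hmax b hcb), mul_comm, ← Algebra.smul_def]
        split_ifs with hb
        · rfl
        · have h3 : coeff u (p j b) = 0 := (hp j b).coeff_eq_zero u (by rw [hw]; exact fun h => hb h.symm)
          rw [h3, zero_smul]
      simp only [h2] at h1
      have h3 := congrArg φ h1
      rw [map_sum, map_zero] at h3
      refine (Finset.sum_congr rfl fun b _ => ?_).trans h3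
      split_ifs
      · rw [map_smul, smul_eq_mul, mul_comm]
      · exact (map_zero φ).symm
    · refine Finset.sum_eq_zero fun b _ => ?_
      split_ifs with hb
      · rw [(hp j b).coeff_eq_zero u (by rw [hb]; exact hw), mul_zero]
      · rfl

lemma exists_linear_relation_of_isAlgebraic {Ω K F : Type*} [Field K] [Field F] [Algebra K F]
    {β J : Type*} [Fintype β] {δ : Ω → ℕ} (hδ : ∀ ω, 0 < δ ω) (z : Ω → F)
    (B V₀ : Set Ω) (hB : AlgebraicIndependent K fun b : B => z b) (hV₀ : V₀.Finite) (hBV : Bᶜ ⊆ V₀)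
    (halg : ∀ v ∈ V₀, IsAlgebraic (Algebra.adjoin K (z '' (V₀ ∩ B))) (z v))
    (n : β → ℕ) (p : J → β → MvPolynomial Ω K) (hp : ∀ j b, (p j b).IsWeightedHomogeneous δ (n b))
    (c : β → F) (hc : c ≠ 0) (h : ∀ j, ∑ b, c b * aeval z (p j b) = 0) :
    ∃ V : Set Ω, V.Finite ∧ ∃ (k : ℕ) (l : β → K), l ≠ 0 ∧ (∀ b, l b ≠ 0 → n b = k) ∧
      ∀ j, ∑ b, l b • p j b ∈ Ideal.span (X '' V) := by
  classical
  set L := IntermediateField.adjoin K (Set.range z) with hL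
  obtain ⟨b₀, hb₀⟩ := Function.ne_iff.1 hc
  obtain ⟨μ, hμ⟩ : ∃ μ : Module.Dual L F, μ (c b₀) ≠ 0 := by
    by_contra! h
    exact hb₀ ((Module.forall_dual_apply_eq_zero_iff L _).1 h)
  have hzL : ∀ q : MvPolynomial Ω K, aeval z q ∈ L := by
    intro q
    induction q using MvPolynomial.induction_on with
    | C a => rw [aeval_C]; exact L.algebraMap_mem a
    | add p q hp hq => rw [map_add]; exact L.add_mem (hp) (hq)
    | mul_X p ω hp => rw [map_mul, aeval_X]; exact L.mul_mem (hp) (IntermediateField.subset_adjoin _ _ ⟨ω, rfl⟩)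
  have hrel : ∀ j, ∑ b, (μ (c b) : F) * aeval z (p j b) = 0 := by
    intro j
    have h1 := congrArg μ (h j)
    rw [map_sum, map_zero] at h1
    have h2 : ∀ b, μ (c b * aeval z (p j b)) = (⟨aeval z (p j b), hzL _⟩ : L) * μ (c b) := by
      intro b
      rw [← smul_eq_mul (a := (⟨aeval z (p j b), hzL _⟩ : L)), ← map_smul]
      congr 1
      rw [mul_comm]
      rfl
    simp only [h2] at h1
    have h3 := congrArg (Subtype.val : L → F) h1
    rw [AddSubmonoidClass.coe_finsetSum] at h3
    rw [← ZeroMemClass.coe_zero L, ← h3]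
    refine Finset.sum_congr rfl fun b _ => ?_
    rw [mul_comm]
    rfl
  have hfin : ∀ b, ∃ S : Set Ω, S.Finite ∧ (μ (c b) : F) ∈ IntermediateField.adjoin K (z '' S) := by
    intro b
    obtain ⟨T, hT, hmem⟩ := IntermediateField.exists_finset_of_mem_adjoin (μ (c b)).2
    choose g hg using fun x : (T : Set F) => hT x.2
    refine ⟨Set.range g, Set.finite_range g, ?_⟩
    rw [← Set.range_comp]
    convert! hmem
    ext x
    exact ⟨fun ⟨y, hy⟩ => (hy.symm.trans (hg y)).symm ▸ y.2, fun hx => ⟨⟨x, hx⟩, hg ⟨x, hx⟩⟩⟩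
  choose S hS hSc using hfin
  set V := V₀ ∪ ⋃ b, S b with hV
  have hVfin : V.Finite := hV₀.union (Set.finite_iUnion hS)
  set s : Set Ω := V ∩ B with hs
  set E₀ := IntermediateField.adjoin K (z '' s) with hE₀
  set E := (algebraicClosure E₀ F).restrictScalars K with hE
  have hE₀E : ∀ x ∈ E₀, x ∈ E := fun x hx => (algebraicClosure E₀ F).algebraMap_mem ⟨x, hx⟩
  have hVE : ∀ v ∈ V, z v ∈ E := by
    intro v hv
    by_cases hvB : v ∈ B
    · exact hE₀E _ (IntermediateField.subset_adjoin _ _ ⟨v, ⟨hv, hvB⟩, rfl⟩)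
    · have h1 := halg v (hBV hvB)
      have h2 : IsAlgebraic (Algebra.adjoin K (z '' s)) (z v) :=
        h1.tower_top_of_subalgebra_le (Algebra.adjoin_mono (Set.image_mono
          (Set.inter_subset_inter_left _ Set.subset_union_left)))
      rw [hE, IntermediateField.mem_restrictScalars, mem_algebraicClosure_iff]
      exact IntermediateField.isAlgebraic_adjoin_iff.2 h2
  have hcE : ∀ b, (μ (c b) : F) ∈ E := by
    intro b
    have h1 : IntermediateField.adjoin K (z '' S b) ≤ E := by
      rw [IntermediateField.adjoin_le_iff]
      rintro _ ⟨ω, hω, rfl⟩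
      exact hVE ω (Or.inr (Set.mem_iUnion_of_mem b hω))
    exact h1 (hSc b)
  have hind : AlgebraicIndependent E fun t : {ω // ω ∉ V} => z t := by
    have h1 := hB.adjoin_of_disjoint (s := Subtype.val ⁻¹' V) (t := Subtype.val ⁻¹' Vᶜ)
      (Set.disjoint_left.2 fun x hx hx' => hx' hx)
    have h2 : (fun b : B => z b) '' (Subtype.val ⁻¹' V) = z '' s := by
      rw [hs, Set.inter_comm, ← Subtype.image_preimage_coe, Set.image_image]
    rw [h2, ← IntermediateField.algebraicIndependent_adjoin_iff] at h1
    have h4 : ∀ t : {ω // ω ∉ V}, t.1 ∈ B := by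
      intro t
      by_contra h
      exact t.2 (Or.inl (hBV h))
    let f : {ω // ω ∉ V} → (Subtype.val ⁻¹' Vᶜ : Set B) := fun t => ⟨⟨t.1, h4 t⟩, t.2⟩
    have hf : Function.Injective f := fun t t' h =>
      Subtype.ext (congrArg (fun x : (Subtype.val ⁻¹' Vᶜ : Set B) => x.1.1) h)
    exact (h1.comp f hf).algebraicClosure
  obtain ⟨k, l, hl⟩ := exists_linear_relation hδ z V (fun ω hω => ⟨⟨z ω, hVE ω hω⟩, rfl⟩) hind n p hp
    (fun b => ⟨μ (c b), hcE b⟩ : β → E) (fun h0 => hμ (by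
      have := congrArg (Subtype.val : E → F) (congrFun h0 b₀)
      exact Subtype.val_injective this)) hrel
  exact ⟨V, hVfin, k, l, hl⟩

end Specialization
end Stillman

namespace Stillman
open MvPolynomial

section Regular

variable {K Ω : Type*} [Field K]

lemma isWeightedHomogeneous_of_mul {δ : Ω → ℕ} {q r : MvPolynomial Ω K} {n : ℕ}
    (h : (q * r).IsWeightedHomogeneous δ n) (h0 : q * r ≠ 0) : ∃ a, q.IsWeightedHomogeneous δ a := by
  classical
  let Φ : MvPolynomial Ω K →ₐ[K] Polynomial (MvPolynomial Ω K) :=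
    aeval fun ω => Polynomial.monomial (δ ω) (X ω)
  have hmon : ∀ u a, Φ (monomial u a) = Polynomial.monomial (Finsupp.weight δ u) (monomial u a) := by
    intro u a
    induction u using Finsupp.induction generalizing a with
    | zero => simp [Φ, Polynomial.algebraMap_apply]
    | single_add ω n u hω hn ih =>
      have h1 : monomial (Finsupp.single ω n + u) a = (X ω ^ n : MvPolynomial Ω K) * monomial u a := by
        rw [X_pow_eq_monomial, monomial_mul, one_mul]
      rw [h1, map_mul, ih, map_pow]
      simp only [Φ, aeval_X]
      rw [Polynomial.monomial_pow, Polynomial.monomial_mul_monomial, map_add, Finsupp.weight_single,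
        smul_eq_mul, mul_comm (δ ω) n]
  have hcoeff : ∀ p u k, coeff u ((Φ p).coeff k) = if Finsupp.weight δ u = k then coeff u p else 0 := by
    intro p u k
    induction p using MvPolynomial.induction_on' with
    | monomial v a =>
      rw [hmon, Polynomial.coeff_monomial]
      by_cases hv : v = u
      · subst hv
        split_ifs <;> simp
      · split_ifs <;> simp [coeff_monomial, hv]
    | add p q hp hq =>
      rw [map_add, Polynomial.coeff_add, coeff_add, hp, hq, coeff_add]
      split_ifs <;> simp
  have hinj : ∀ p, p ≠ 0 → Φ p ≠ 0 := by
    intro p hp hΦ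
    refine hp ?_
    ext u
    have := hcoeff p u (Finsupp.weight δ u)
    rw [hΦ, if_pos rfl] at this
    simpa using this.symm
  have hq : q ≠ 0 := left_ne_zero_of_mul h0
  have hr : r ≠ 0 := right_ne_zero_of_mul h0
  have hqr : Φ (q * r) = Polynomial.monomial n (q * r) := by
    ext k u
    rw [hcoeff, Polynomial.coeff_monomial]
    by_cases hc : coeff u (q * r) = 0
    · split_ifs <;> simp [hc]
    · rw [h hc]
      split_ifs <;> simp
  have h1 := Polynomial.natDegree_mul (hinj q hq) (hinj r hr)
  have h2 := Polynomial.natTrailingDegree_mul (hinj q hq) (hinj r hr)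
  rw [← map_mul, hqr] at h1 h2
  rw [Polynomial.natDegree_monomial_eq _ h0] at h1
  rw [Polynomial.natTrailingDegree_monomial h0] at h2
  have h3 := Polynomial.natTrailingDegree_le_natDegree (Φ q)
  have h4 := Polynomial.natTrailingDegree_le_natDegree (Φ r)
  refine ⟨(Φ q).natDegree, fun u hu => ?_⟩
  have h5 : (Φ q).coeff (Finsupp.weight δ u) ≠ 0 := by
    intro h
    have := hcoeff q u (Finsupp.weight δ u)
    rw [h, if_pos rfl] at this
    exact hu (by simpa using this.symm)
  have h6 := Polynomial.le_natDegree_of_ne_zero h5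
  have h7 := Polynomial.natTrailingDegree_le_of_ne_zero h5
  omega

open Classical in
/-- Set the variables in `S` to zero. -/
noncomputable def kill (S : Set Ω) : MvPolynomial Ω K →ₐ[K] MvPolynomial Ω K :=
  aeval fun ω => if ω ∈ S then 0 else X ω

lemma sub_kill_mem (S : Set Ω) (f : MvPolynomial Ω K) : f - kill S f ∈ Ideal.span (X '' S) := by
  classical
  induction f using MvPolynomial.induction_on with
  | C a => simp [kill, algebraMap_eq]
  | add p q hp hq => rw [map_add, add_sub_add_comm]; exact Ideal.add_mem _ hp hq
  | mul_X p ω hp =>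
    rw [map_mul]
    have h : p * X ω - kill S p * kill S (X ω) = (p - kill S p) * X ω + kill S p * (X ω - kill S (X ω)) := by ring
    rw [h]
    refine Ideal.add_mem _ (Ideal.mul_mem_right _ _ hp) (Ideal.mul_mem_left _ _ ?_)
    rw [kill, aeval_X]
    split_ifs with hω
    · rw [sub_zero]; exact Ideal.subset_span ⟨ω, hω, rfl⟩
    · rw [sub_self]; exact Ideal.zero_mem _

lemma kill_eq_zero_iff (S : Set Ω) (f : MvPolynomial Ω K) : kill S f = 0 ↔ f ∈ Ideal.span (X '' S) := by
  classical
  constructor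
  · intro h
    have := sub_kill_mem S f
    rwa [h, sub_zero] at this
  · intro h
    have h1 : Ideal.span (X '' S) ≤ RingHom.ker (kill S : MvPolynomial Ω K →ₐ[K] _) := by
      rw [Ideal.span_le]
      rintro _ ⟨ω, hω, rfl⟩
      change kill S (X ω) = 0
      rw [kill, aeval_X, if_pos hω]
    exact h1 h

lemma mem_span_X_of_mul_mem {S : Set Ω} {G f : MvPolynomial Ω K} (hG : G ∉ Ideal.span (X '' S))
    (h : G * f ∈ Ideal.span (X '' S)) : f ∈ Ideal.span (X '' S) := by
  rw [← kill_eq_zero_iff] at *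
  rw [map_mul] at h
  exact (mul_eq_zero.1 h).resolve_left hG

lemma kill_monomial (S : Set Ω) (u : Ω →₀ ℕ) (a : K) :
    kill S (monomial u a) = monomial u a ∨ kill S (monomial u a) = 0 := by
  classical
  by_cases h : ∀ ω ∈ S, u ω = 0
  · left
    rw [kill, aeval_monomial, monomial_eq, algebraMap_eq]
    congr 1
    refine Finsupp.prod_congr fun ω hω => ?_
    rw [if_neg fun hS => Finsupp.mem_support_iff.1 hω (h ω hS)]
  · right
    push Not at h
    rw [kill_eq_zero_iff, mem_ideal_span_X_image]
    intro v hv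
    have := support_monomial_subset hv
    rw [Finset.mem_singleton] at this
    exact this ▸ h

lemma support_kill_subset (S : Set Ω) (f : MvPolynomial Ω K) : (kill S f).support ⊆ f.support := by
  classical
  conv_lhs => rw [f.as_sum, map_sum]
  refine support_sum.trans (Finset.biUnion_subset.2 fun u hu => ?_)
  rcases kill_monomial S u (coeff u f) with h | h <;> rw [h]
  · exact support_monomial_subset.trans (Finset.singleton_subset_iff.2 hu)
  · simp

lemma vars_kill_subset (S : Set Ω) (f : MvPolynomial Ω K) : (kill S f).vars ⊆ f.vars := by
  intro ω hω
  obtain ⟨u, hu, h⟩ := (mem_vars_iff_mem_support _).1 hω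
  exact (mem_vars_iff_mem_support _).2 ⟨u, support_kill_subset S f hu, h⟩

lemma kill_isWeightedHomogeneous {δ : Ω → ℕ} {H : MvPolynomial Ω K} {n : ℕ} (S : Set Ω)
    (hH : H.IsWeightedHomogeneous δ n) : (kill S H).IsWeightedHomogeneous δ n := fun _ hu =>
  hH (mem_support_iff.1 (support_kill_subset S H (mem_support_iff.2 hu)))

lemma vars_subset_of_dvd {q f : MvPolynomial Ω K} (hf : f ≠ 0) (h : q ∣ f) : q.vars ⊆ f.vars := by
  classical
  obtain ⟨r, rfl⟩ := h
  intro ω hω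
  have h1 := degreeOf_mul_eq (n := ω) (left_ne_zero_of_mul hf) (right_ne_zero_of_mul hf)
  rw [vars_def, Multiset.mem_toFinset, ← Multiset.count_pos, ← degreeOf_def] at hω ⊢
  omega

lemma isUnit_of_dvd {δ : Ω → ℕ} (hδ : ∀ ω, 0 < δ ω) {S : Set Ω} {q H : MvPolynomial Ω K} {n : ℕ}
    (hq : (q.vars : Set Ω) ⊆ S) (hH : H ∉ Ideal.span (X '' S)) (hHn : H.IsWeightedHomogeneous δ n)
    (h : q ∣ H) : IsUnit q := by
  classical
  have hH0 : H ≠ 0 := fun h0 => hH (h0 ▸ Ideal.zero_mem _)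
  obtain ⟨r, rfl⟩ := h
  obtain ⟨a, ha⟩ := isWeightedHomogeneous_of_mul hHn hH0
  by_contra hunit
  refine hH (Ideal.mul_mem_right _ _ (mem_ideal_span_X_image.2 fun u hu => ?_))
  by_contra! hcon
  have hu0 : u = 0 := by
    ext ω
    by_contra hω
    exact hω (hcon ω (hq ((mem_vars_iff_mem_support _).2 ⟨u, hu, Finsupp.mem_support_iff.2 hω⟩)))
  have ha0 : a = 0 := by
    rw [← ha (mem_support_iff.1 hu), hu0, map_zero]
  refine hunit ?_
  have hqC : q = C (coeff 0 q) := by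
    ext v
    rw [coeff_C]
    split_ifs with hv
    · rw [← hv]
    · by_contra hc
      have h1 := ha hc
      rw [ha0] at h1
      refine hv (Finsupp.ext fun ω => ?_)
      have h2 := Finsupp.le_weight δ (hδ ω).ne' v
      rw [Finsupp.coe_zero, Pi.zero_apply]
      omega
  rw [hqC]
  exact (hu0 ▸ mem_support_iff.1 hu : coeff 0 q ≠ 0).isUnit.map C

lemma mem_span_X_sup_of_mul_mem {δ : Ω → ℕ} (hδ : ∀ ω, 0 < δ ω) {S T : Set Ω} (hST : S ⊆ T)
    {G H f : MvPolynomial Ω K} {n : ℕ} (hG : (G.vars : Set Ω) ⊆ T)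
    (hH : H ∉ Ideal.span (X '' T)) (hHn : H.IsWeightedHomogeneous δ n)
    (h : H * f ∈ Ideal.span (X '' S) ⊔ Ideal.span {G}) : f ∈ Ideal.span (X '' S) ⊔ Ideal.span {G} := by
  have hle : Ideal.span (X '' S) ≤ Ideal.span (X '' T : Set (MvPolynomial Ω K)) :=
    Ideal.span_mono (Set.image_mono hST)
  by_cases hG0 : kill S G = 0
  · rw [kill_eq_zero_iff] at hG0
    rw [sup_of_le_left ((Ideal.span_singleton_le_iff_mem _).2 hG0)] at h ⊢
    exact mem_span_X_of_mul_mem (fun h => hH (hle h)) h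
  obtain ⟨a, ha, b, hb, hab⟩ := Submodule.mem_sup.1 h
  obtain ⟨c, rfl⟩ := Ideal.mem_span_singleton'.1 hb
  have h1 : kill S G ∣ kill S H * kill S f := by
    refine ⟨kill S c, ?_⟩
    rw [← map_mul, ← hab, map_add, (kill_eq_zero_iff S a).2 ha, zero_add, map_mul, mul_comm]
  have hH' : kill S H ∉ Ideal.span (X '' T) := by
    intro h2
    have := Ideal.add_mem _ (hle (sub_kill_mem S H)) h2
    rw [sub_add_cancel] at this
    exact hH this
  have h2 : IsRelPrime (kill S G) (kill S H) := by
    intro q hq1 hq2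
    refine isUnit_of_dvd hδ (S := T) ?_ hH' (kill_isWeightedHomogeneous S hHn) hq2
    exact (Finset.coe_subset.2 (vars_subset_of_dvd hG0 hq1)).trans ((Finset.coe_subset.2 (vars_kill_subset S G)).trans hG)
  obtain ⟨r, hr⟩ := h2.dvd_of_dvd_mul_left h1
  have h3 : f = (f - kill S f) + r * (-(G - kill S G)) + r * G := by
    rw [hr]; ring
  rw [h3]
  exact Submodule.add_mem_sup (Ideal.add_mem _ (sub_kill_mem S f) (Ideal.mul_mem_left _ _ (neg_mem (sub_kill_mem S G))))
    (Ideal.mul_mem_left _ _ (Ideal.mem_span_singleton_self G))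

end Regular
end Stillman

namespace Stillman
open MvPolynomial Filter

/-- The ideal of families that vanish almost everywhere. -/
def ultIdeal (𝓤 : Ultrafilter ℕ) (A : ℕ → Type*) [∀ i, CommRing (A i)] : Ideal (Π i, A i) where
  carrier := {f | ∀ᶠ i in 𝓤, f i = 0}
  add_mem' {f g} hf hg := by
    filter_upwards [hf, hg] with i h1 h2
    rw [Pi.add_apply, h1, h2, add_zero]
  zero_mem' := Eventually.of_forall fun _ => rfl
  smul_mem' c f hf := by
    filter_upwards [hf] with i h
    change c i * f i = 0
    rw [h, mul_zero]

/-- The ultraproduct of a sequence of commutative rings. -/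
def Ult (𝓤 : Ultrafilter ℕ) (A : ℕ → Type*) [∀ i, CommRing (A i)] : Type _ :=
  (Π i, A i) ⧸ ultIdeal 𝓤 A

noncomputable instance ultCommRing (𝓤 : Ultrafilter ℕ) (A : ℕ → Type*) [∀ i, CommRing (A i)] :
    CommRing (Ult 𝓤 A) :=
  inferInstanceAs (CommRing ((Π i, A i) ⧸ ultIdeal 𝓤 A))

section Ult

variable {𝓤 : Ultrafilter ℕ} {A B : ℕ → Type*} [∀ i, CommRing (A i)] [∀ i, CommRing (B i)]
  [∀ i, Algebra (A i) (B i)]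

/-- The class of a family in the ultraproduct. -/
noncomputable def Ult.mk (𝓤 : Ultrafilter ℕ) {A : ℕ → Type*} [∀ i, CommRing (A i)] :
    (Π i, A i) →+* Ult 𝓤 A :=
  Ideal.Quotient.mk (ultIdeal 𝓤 A)

lemma Ult.mk_surjective : Function.Surjective (Ult.mk 𝓤 (A := A)) := Ideal.Quotient.mk_surjective

lemma Ult.mk_eq_zero {f : Π i, A i} : Ult.mk 𝓤 f = 0 ↔ ∀ᶠ i in 𝓤, f i = 0 :=
  Ideal.Quotient.eq_zero_iff_mem

lemma Ult.mk_eq_mk {f g : Π i, A i} : Ult.mk 𝓤 f = Ult.mk 𝓤 g ↔ ∀ᶠ i in 𝓤, f i = g i := by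
  rw [← sub_eq_zero, ← map_sub, Ult.mk_eq_zero]
  simp only [Pi.sub_apply, sub_eq_zero]

/-- A representative of an element of the ultraproduct. -/
noncomputable def Ult.rep (x : Ult 𝓤 A) : Π i, A i := Function.surjInv Ult.mk_surjective x

@[simp] lemma Ult.mk_rep (x : Ult 𝓤 A) : Ult.mk 𝓤 x.rep = x := Function.surjInv_eq _ x

lemma Ult.isField {k : ℕ → Type*} [∀ i, Field (k i)] : IsField (Ult 𝓤 k) where
  exists_pair_ne := ⟨0, 1, fun h => by
    have h1 : Ult.mk 𝓤 (1 : Π i, k i) = 0 := by rw [map_one, h]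
    obtain ⟨i, hi⟩ := (Ult.mk_eq_zero.1 h1).exists
    exact one_ne_zero hi⟩
  mul_comm := mul_comm
  mul_inv_cancel {x} hx := by
    obtain ⟨f, rfl⟩ := Ult.mk_surjective x
    refine ⟨Ult.mk 𝓤 fun i => (f i)⁻¹, ?_⟩
    rw [← map_mul, ← map_one (Ult.mk 𝓤), Ult.mk_eq_mk]
    have : ∀ᶠ i in 𝓤, f i ≠ 0 := Ultrafilter.eventually_not.2 fun h => hx (Ult.mk_eq_zero.2 h)
    filter_upwards [this] with i hi
    exact mul_inv_cancel₀ hi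

noncomputable instance {k : ℕ → Type*} [∀ i, Field (k i)] : Field (Ult 𝓤 k) := Ult.isField.toField

noncomputable instance ultAlgebra : Algebra (Ult 𝓤 A) (Ult 𝓤 B) :=
  RingHom.toAlgebra (Ideal.quotientMap (ultIdeal 𝓤 B)
    (RingHom.pi fun i => (algebraMap (A i) (B i)).comp (Pi.evalRingHom A i)) (fun f hf => by
      change ∀ᶠ i in 𝓤, algebraMap (A i) (B i) (f i) = 0
      filter_upwards [show ∀ᶠ i in 𝓤, f i = 0 from hf] with i hi
      rw [hi, map_zero]))

lemma Ult.algebraMap_mk (f : Π i, A i) :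
    algebraMap (Ult 𝓤 A) (Ult 𝓤 B) (Ult.mk 𝓤 f) = Ult.mk 𝓤 fun i => algebraMap (A i) (B i) (f i) :=
  rfl

lemma Ult.smul_mk (a : Π i, A i) (f : Π i, B i) :
    Ult.mk 𝓤 a • Ult.mk 𝓤 f = Ult.mk 𝓤 fun i => a i • f i := by
  rw [Algebra.smul_def, Ult.algebraMap_mk, ← map_mul]
  congr 1
  ext i
  exact (Algebra.smul_def _ _).symm

lemma Ult.sum_apply {ι : Type*} (s : Finset ι) (f : ι → Π i, A i) (i : ℕ) :
    (∑ j ∈ s, f j) i = ∑ j ∈ s, f j i := Finset.sum_apply _ _ _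

lemma Ult.exists_of_mem_adjoin {Ω : Type*} {S : Set Ω} {f : Ω → Π i, B i} {x : Ult 𝓤 B}
    (hx : x ∈ Algebra.adjoin (Ult 𝓤 A) ((fun ω => Ult.mk 𝓤 (f ω)) '' S)) :
    ∃ g : Π i, B i, Ult.mk 𝓤 g = x ∧ ∀ i, g i ∈ Algebra.adjoin (A i) ((fun ω => f ω i) '' S) := by
  induction hx using Algebra.adjoin_induction with
  | mem x hx =>
    obtain ⟨ω, hω, rfl⟩ := hx
    exact ⟨f ω, rfl, fun i => Algebra.subset_adjoin ⟨ω, hω, rfl⟩⟩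
  | algebraMap r =>
    obtain ⟨r, rfl⟩ := Ult.mk_surjective r
    exact ⟨_, rfl, fun i => Subalgebra.algebraMap_mem _ _⟩
  | add x y _ _ h1 h2 =>
    obtain ⟨g, rfl, hg⟩ := h1
    obtain ⟨g', rfl, hg'⟩ := h2
    exact ⟨g + g', map_add _ _ _, fun i => add_mem (hg i) (hg' i)⟩
  | mul x y _ _ h1 h2 =>
    obtain ⟨g, rfl, hg⟩ := h1
    obtain ⟨g', rfl, hg'⟩ := h2
    exact ⟨g * g', map_mul _ _ _, fun i => mul_mem (hg i) (hg' i)⟩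

lemma Ult.mk_mem_span {Ω : Type*} {V : Set Ω} (hV : V.Finite) {w : Ω → Π i, A i} {f : Π i, A i} :
    Ult.mk 𝓤 f ∈ Ideal.span ((fun ω => Ult.mk 𝓤 (w ω)) '' V) ↔
      ∀ᶠ i in 𝓤, f i ∈ Ideal.span ((fun ω => w ω i) '' V) := by
  classical
  lift V to Finset Ω using hV
  constructor
  · intro h
    obtain ⟨c, hc⟩ := (Submodule.mem_span_image_finset_iff_exists_fun' _).1 h
    have h1 : Ult.mk 𝓤 (∑ ω ∈ V, (c ω).rep * w ω) = Ult.mk 𝓤 f := by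
      simp only [map_sum, map_mul, Ult.mk_rep]
      exact hc
    filter_upwards [Ult.mk_eq_mk.1 h1] with i hi
    rw [← hi, Ult.sum_apply]
    exact Ideal.sum_mem _ fun ω hω => Ideal.mul_mem_left _ _ (Ideal.subset_span ⟨ω, hω, rfl⟩)
  · intro h
    have h1 : ∀ i, ∃ c : Ω → A i, f i ∈ Ideal.span ((fun ω => w ω i) '' (V : Set Ω)) →
        ∑ ω ∈ V, c ω • w ω i = f i := by
      intro i
      by_cases hi : f i ∈ Ideal.span ((fun ω => w ω i) '' (V : Set Ω))
      · obtain ⟨c, hc⟩ := (Submodule.mem_span_image_finset_iff_exists_fun' _).1 hi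
        exact ⟨c, fun _ => hc⟩
      · exact ⟨0, fun h => absurd h hi⟩
    choose c hc using h1
    have h2 : Ult.mk 𝓤 f = ∑ ω ∈ V, Ult.mk 𝓤 (fun i => c i ω) * Ult.mk 𝓤 (w ω) := by
      simp only [← map_mul, ← map_sum]
      rw [Ult.mk_eq_mk]
      filter_upwards [h] with i hi
      rw [Ult.sum_apply, ← hc i hi]
      rfl
    rw [h2]
    exact Ideal.sum_mem _ fun ω hω => Ideal.mul_mem_left _ _ (Ideal.subset_span ⟨ω, hω, rfl⟩)

/-- A sequence of polynomials representing a polynomial over the ultraproduct. -/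
noncomputable def liftPoly {Ω : Type*} (p : MvPolynomial Ω (Ult 𝓤 A)) (i : ℕ) :
    MvPolynomial Ω (A i) :=
  ∑ m ∈ p.support, monomial m ((coeff m p).rep i)

lemma coeff_liftPoly {Ω : Type*} (p : MvPolynomial Ω (Ult 𝓤 A)) (i : ℕ) (m : Ω →₀ ℕ)
    [Decidable (m ∈ p.support)] :
    coeff m (liftPoly p i) = if m ∈ p.support then (coeff m p).rep i else 0 := by
  classical
  rw [liftPoly, coeff_sum]
  simp only [coeff_monomial]
  rw [Finset.sum_ite_eq']
  congr

lemma support_liftPoly_subset {Ω : Type*} (p : MvPolynomial Ω (Ult 𝓤 A)) (i : ℕ) :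
    (liftPoly p i).support ⊆ p.support := by
  classical
  intro m hm
  rw [mem_support_iff, coeff_liftPoly] at hm
  by_contra h
  exact hm (if_neg h)

lemma vars_liftPoly_subset {Ω : Type*} (p : MvPolynomial Ω (Ult 𝓤 A)) (i : ℕ) :
    (liftPoly p i).vars ⊆ p.vars := by
  intro ω hω
  obtain ⟨u, hu, h⟩ := (mem_vars_iff_mem_support _).1 hω
  exact (mem_vars_iff_mem_support _).2 ⟨u, support_liftPoly_subset p i hu, h⟩

lemma liftPoly_isWeightedHomogeneous {Ω : Type*} {p : MvPolynomial Ω (Ult 𝓤 A)} {δ : Ω → ℕ} {n : ℕ}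
    (hp : p.IsWeightedHomogeneous δ n) (i : ℕ) : (liftPoly p i).IsWeightedHomogeneous δ n :=
  fun _ hu => hp (mem_support_iff.1 (support_liftPoly_subset p i (mem_support_iff.2 hu)))

lemma eventually_coeff_liftPoly_ne_zero {Ω : Type*} {p : MvPolynomial Ω (Ult 𝓤 A)} {m : Ω →₀ ℕ}
    (hm : coeff m p ≠ 0) : ∀ᶠ i in 𝓤, coeff m (liftPoly p i) ≠ 0 := by
  classical
  refine Ultrafilter.eventually_not.2 fun h => hm ?_
  rw [← Ult.mk_rep (coeff m p), Ult.mk_eq_zero]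
  filter_upwards [h] with i hi
  rwa [coeff_liftPoly, if_pos (mem_support_iff.2 hm)] at hi

lemma eventually_liftPoly_notMem_span_X {Ω : Type*} {k : ℕ → Type*} [∀ i, Field (k i)]
    {p : MvPolynomial Ω (Ult 𝓤 k)} {S : Set Ω}
    (hp : p ∉ Ideal.span (X '' S)) : ∀ᶠ i in 𝓤, liftPoly p i ∉ Ideal.span (X '' S) := by
  rw [mem_ideal_span_X_image] at hp
  push Not at hp
  obtain ⟨m, hm, h⟩ := hp
  filter_upwards [eventually_coeff_liftPoly_ne_zero (mem_support_iff.1 hm)] with i hi hcon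
  obtain ⟨ω, hω, h1⟩ := mem_ideal_span_X_image.1 hcon m (mem_support_iff.2 hi)
  exact h1 (h ω hω)

lemma aeval_mk {Ω : Type*} (w : Ω → Π i, B i) (p : MvPolynomial Ω (Ult 𝓤 A)) :
    aeval (fun ω => Ult.mk 𝓤 (w ω)) p =
      Ult.mk 𝓤 fun i => aeval (fun ω => w ω i) (liftPoly p i) := by
  have h : (fun i => aeval (fun ω => w ω i) (liftPoly p i)) =
      ∑ m ∈ p.support, (fun i => algebraMap (A i) (B i) ((coeff m p).rep i)) *
        m.prod fun ω n => w ω ^ n := by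
    ext i
    rw [Ult.sum_apply, liftPoly, map_sum]
    refine Finset.sum_congr rfl fun m _ => ?_
    rw [aeval_monomial, Pi.mul_apply, Finsupp.prod, Finsupp.prod, Finset.prod_apply]
    rfl
  rw [h, map_sum, aeval_def, eval₂_eq]
  refine Finset.sum_congr rfl fun m _ => ?_
  rw [map_mul, ← Ult.algebraMap_mk, Ult.mk_rep, Finsupp.prod, map_prod]
  simp only [map_pow]

end Ult

end Stillman

namespace Stillman
open MvPolynomial Filter

/-- The sequence of polynomial rings `K i [x_1, …, x_{N i}]`. -/
abbrev PolyFam (N : ℕ → ℕ) (K : ℕ → Type u) [∀ i, Field (K i)] (i : ℕ) : Type u :=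
  MvPolynomial (Fin (N i)) (K i)

section Generators

variable {𝓤 : Ultrafilter ℕ} {N : ℕ → ℕ} {K : ℕ → Type u} [∀ i, Field (K i)]

variable (𝓤 N K) in
/-- The classes of degree `e` spanned by products of homogeneous classes of smaller positive
degree. -/
noncomputable def Dec (e : ℕ) : Submodule (Ult 𝓤 K) (Ult 𝓤 (PolyFam N K)) :=
  Submodule.span _ {x | ∃ (a b : ℕ) (f g : Π i, PolyFam N K i), 0 < a ∧ 0 < b ∧ a + b = e ∧
    (∀ i, (f i).IsHomogeneous a) ∧ (∀ i, (g i).IsHomogeneous b) ∧ Ult.mk 𝓤 (f * g) = x}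

/-- A family of homogeneous sequences which, degree by degree, is a basis of the homogeneous
classes modulo the decomposable ones. -/
structure IsGen (𝓤 : Ultrafilter ℕ) {N : ℕ → ℕ} {K : ℕ → Type u} [∀ i, Field (K i)] {Ω : Type v}
    (w : Ω → Π i, PolyFam N K i) (δ : Ω → ℕ) : Prop where
  pos : ∀ ω, 0 < δ ω
  hom : ∀ ω i, (w ω i).IsHomogeneous (δ ω)
  span : ∀ e, 0 < e → ∀ f : Π i, PolyFam N K i, (∀ i, (f i).IsHomogeneous e) →
    Ult.mk 𝓤 f ∈ Dec 𝓤 N K e ⊔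
      Submodule.span (Ult 𝓤 K) ((fun ω => Ult.mk 𝓤 (w ω)) '' {ω | δ ω = e})
  indep : ∀ (e : ℕ) (s : Finset Ω) (c : Ω → Ult 𝓤 K), (∀ ω ∈ s, c ω ≠ 0 → δ ω = e) →
    ∑ ω ∈ s, c ω • Ult.mk 𝓤 (w ω) ∈ Dec 𝓤 N K e → ∀ ω ∈ s, c ω = 0

variable (𝓤 N K) in
/-- The classes of sequences of homogeneous polynomials of degree `e`. -/
def homClasses (e : ℕ) : Submodule (Ult 𝓤 K) (Ult 𝓤 (PolyFam N K)) where
  carrier := {x | ∃ f : Π i, PolyFam N K i, (∀ i, (f i).IsHomogeneous e) ∧ Ult.mk 𝓤 f = x}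
  add_mem' := by
    rintro _ _ ⟨f, hf, rfl⟩ ⟨g, hg, rfl⟩
    exact ⟨f + g, fun i => (hf i).add (hg i), map_add _ _ _⟩
  zero_mem' := ⟨0, fun i => isHomogeneous_zero _ _ _, map_zero _⟩
  smul_mem' := by
    rintro c _ ⟨f, hf, rfl⟩
    obtain ⟨c, rfl⟩ := Ult.mk_surjective c
    exact ⟨fun i => c i • f i, fun i => (homogeneousSubmodule _ _ _).smul_mem _ (hf i),
      (Ult.smul_mk _ _).symm⟩

variable (𝓤 N K) in
lemma exists_isGen : ∃ (Ω : Type u) (w : Ω → Π i, PolyFam N K i) (δ : Ω → ℕ), IsGen 𝓤 w δ := by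
  classical
  let M := fun e : ℕ => (homClasses 𝓤 N K (e + 1)).map (Dec 𝓤 N K (e + 1)).mkQ
  let b := fun e => Module.Basis.ofVectorSpace (Ult 𝓤 K) (M e)
  have hb : ∀ e x, ∃ f : Π i, PolyFam N K i, (∀ i, (f i).IsHomogeneous (e + 1)) ∧
      (Dec 𝓤 N K (e + 1)).mkQ (Ult.mk 𝓤 f) = b e x := by
    intro e x
    obtain ⟨_, ⟨f, hf, rfl⟩, h⟩ := (b e x).2
    exact ⟨f, hf, h⟩
  choose f hf hfb using hb
  refine ⟨Σ e, Module.Basis.ofVectorSpaceIndex (Ult 𝓤 K) (M e), fun ω => f ω.1 ω.2,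
    fun ω => ω.1 + 1, fun ω => Nat.succ_pos _, fun ω i => hf _ _ i, ?_, ?_⟩
  · intro e he g hg
    obtain ⟨e, rfl⟩ : ∃ e', e = e' + 1 := ⟨e - 1, by omega⟩
    have h1 : (Dec 𝓤 N K (e + 1)).mkQ (Ult.mk 𝓤 g) ∈ M e := ⟨_, ⟨g, hg, rfl⟩, rfl⟩
    have h2 : (M e).subtype ⟨_, h1⟩ ∈ (⊤ : Submodule (Ult 𝓤 K) (M e)).map (M e).subtype :=
      ⟨_, trivial, rfl⟩
    rw [← (b e).span_eq, Submodule.map_span, ← Set.range_comp] at h2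
    have h3 : Set.range ((M e).subtype ∘ b e) = (Dec 𝓤 N K (e + 1)).mkQ '' ((fun ω :
        Σ e, Module.Basis.ofVectorSpaceIndex (Ult 𝓤 K) (M e) =>
        Ult.mk 𝓤 (f ω.1 ω.2)) '' {ω | ω.1 + 1 = e + 1}) := by
      ext y
      constructor
      · rintro ⟨x, rfl⟩
        exact ⟨_, ⟨⟨e, x⟩, rfl, rfl⟩, hfb e x⟩
      · rintro ⟨_, ⟨⟨e', x⟩, h, rfl⟩, rfl⟩
        obtain rfl : e' = e := Nat.succ_injective h
        exact ⟨x, (hfb e' x).symm⟩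
    rw [h3, ← Submodule.map_span] at h2
    obtain ⟨y, hy, h4⟩ := h2
    have h5 : Ult.mk 𝓤 g - y ∈ Dec 𝓤 N K (e + 1) := by
      rw [← Submodule.Quotient.mk_eq_zero, Submodule.Quotient.mk_sub, sub_eq_zero]
      exact h4.symm
    rw [← sub_add_cancel (Ult.mk 𝓤 g) y]
    exact add_mem (Submodule.mem_sup_left h5) (Submodule.mem_sup_right hy)
  · intro e s c hc h ω hω
    by_contra hne
    have he := hc ω hω hne
    obtain ⟨e', x⟩ := ω
    change e' + 1 = e at he
    subst he
    have h1 : ∑ y ∈ s.preimage (Sigma.mk e') (sigma_mk_injective.injOn),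
        c ⟨e', y⟩ • b e' y = 0 := by
      apply Subtype.val_injective
      rw [Submodule.coe_sum, Submodule.coe_zero]
      rw [← Submodule.Quotient.mk_eq_zero, ← Submodule.mkQ_apply, map_sum] at h
      rw [← h]
      rw [← Finset.sum_preimage (Sigma.mk e') s (sigma_mk_injective.injOn)]
      · refine Finset.sum_congr rfl fun y _ => ?_
        rw [Submodule.coe_smul, map_smul, ← hfb]
      · rintro ⟨e'', y⟩ hy hr
        by_cases h0 : c ⟨e'', y⟩ = 0
        · rw [h0, zero_smul, map_zero]
        · obtain rfl : e'' = e' := Nat.succ_injective (hc _ hy h0)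
          exact absurd ⟨y, rfl⟩ hr
    exact hne (linearIndependent_iff'.1 (b e').linearIndependent _ _ h1 x
      (Finset.mem_preimage.2 hω))

variable {Ω : Type v} {w : Ω → Π i, PolyFam N K i} {δ : Ω → ℕ}

lemma IsGen.exists_aeval (h : IsGen 𝓤 w δ) {d e : ℕ} (he : e < d) {f : Π i, PolyFam N K i}
    (hf : ∀ i, (f i).IsHomogeneous e) : ∃ p : MvPolynomial {ω // δ ω < d} (Ult 𝓤 K),
      p.IsWeightedHomogeneous (fun ω : {ω // δ ω < d} => δ ω) e ∧
        aeval (fun ω : {ω // δ ω < d} => Ult.mk 𝓤 (w ω)) p = Ult.mk 𝓤 f := by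
  induction e using Nat.strong_induction_on generalizing f with
  | _ e ih =>
    rcases Nat.eq_zero_or_pos e with rfl | hpos
    · refine ⟨C (Ult.mk 𝓤 fun i => coeff 0 (f i)), isWeightedHomogeneous_C _ _, ?_⟩
      rw [aeval_C, Ult.algebraMap_mk]
      congr 1
      ext1 i
      have h0 : f i ∈ homogeneousSubmodule (Fin (N i)) (K i) 0 := hf i
      have h1 := homogeneousComponent_of_mem (m := 0) h0
      rw [if_pos rfl, homogeneousComponent_zero] at h1
      exact h1
    · let T : Submodule (Ult 𝓤 K) (Ult 𝓤 (PolyFam N K)) :=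
        (weightedHomogeneousSubmodule (Ult 𝓤 K) (fun ω : {ω // δ ω < d} => δ ω) e).map
          (aeval (fun ω : {ω // δ ω < d} => Ult.mk 𝓤 (w ω))).toLinearMap
      have hT : Dec 𝓤 N K e ⊔
          Submodule.span (Ult 𝓤 K) ((fun ω => Ult.mk 𝓤 (w ω)) '' {ω | δ ω = e}) ≤ T := by
        refine sup_le (Submodule.span_le.2 ?_) (Submodule.span_le.2 ?_)
        · rintro _ ⟨a, b, f, g, ha, hb, rfl, hf, hg, rfl⟩
          obtain ⟨p, hp, hpf⟩ := ih a (by omega) (by omega) hf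
          obtain ⟨q, hq, hqg⟩ := ih b (by omega) (by omega) hg
          refine ⟨p * q, hp.mul hq, ?_⟩
          rw [AlgHom.toLinearMap_apply, map_mul, hpf, hqg, map_mul]
        · rintro _ ⟨ω, hω, rfl⟩
          obtain rfl : δ ω = e := hω
          have := isWeightedHomogeneous_X (Ult 𝓤 K) (fun ω : {ω // δ ω < d} => δ ω) ⟨ω, by omega⟩
          exact ⟨X ⟨ω, by omega⟩, this, aeval_X _ _⟩
      exact hT (h.span e hpos f hf)

lemma IsGen.exists_aeval_pderiv (h : IsGen 𝓤 w δ) {d : ℕ} {ω : Ω} (hω : δ ω ≤ d)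
    (j : Π i, Fin (N i)) : ∃ p : MvPolynomial {ω // δ ω < d} (Ult 𝓤 K),
      p.IsWeightedHomogeneous (fun ω : {ω // δ ω < d} => δ ω) (δ ω - 1) ∧
        aeval (fun ω : {ω // δ ω < d} => Ult.mk 𝓤 (w ω)) p =
          Ult.mk 𝓤 fun i => pderiv (j i) (w ω i) :=
  h.exists_aeval (by have := h.pos ω; omega) fun i => (h.hom ω i).pderiv

variable (𝓤) in
/-- Homogeneous classes of degree `e` whose partial derivatives lie in an ideal generated by
finitely many generators of smaller degree are decomposable. -/
def DerivDec (w : Ω → Π i, PolyFam N K i) (δ : Ω → ℕ) (e : ℕ) : Prop :=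
  ∀ x : Π i, PolyFam N K i, (∀ i, (x i).IsHomogeneous e) → ∀ V : Set Ω, V.Finite →
    (∀ v ∈ V, δ v < e) → (∀ j : Π i, Fin (N i), Ult.mk 𝓤 (fun i => pderiv (j i) (x i)) ∈
      Ideal.span ((fun ω => Ult.mk 𝓤 (w ω)) '' V)) → Ult.mk 𝓤 x ∈ Dec 𝓤 N K e

variable (𝓤) in
/-- Finite sets of generators of degree less than `d` are almost everywhere good. -/
def GoodBelow (w : Ω → Π i, PolyFam N K i) (δ : Ω → ℕ) (d : ℕ) : Prop :=
  ∀ V : Set Ω, V.Finite → (∀ v ∈ V, δ v < d) → ∀ᶠ i in 𝓤, Good fun v : V => w v i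

lemma IsGen.false_of_relation (h : IsGen 𝓤 w δ) {d : ℕ} {β : Type*} [Fintype β] (ι : β → Ω)
    (hι : Function.Injective ι) (hβ : ∀ b, DerivDec 𝓤 w δ (δ (ι b)))
    {F : Type*} [Field F] [Algebra (Ult 𝓤 K) F] (z : {ω // δ ω < d} → F) (B V₀ : Set {ω // δ ω < d})
    (hB : AlgebraicIndependent (Ult 𝓤 K) fun b : B => z b) (hV₀ : V₀.Finite) (hBV : Bᶜ ⊆ V₀)
    (halg : ∀ v ∈ V₀, IsAlgebraic (Algebra.adjoin (Ult 𝓤 K) (z '' (V₀ ∩ B))) (z v))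
    (p : (Π i, Fin (N i)) → β → MvPolynomial {ω // δ ω < d} (Ult 𝓤 K))
    (hp : ∀ j b, (p j b).IsWeightedHomogeneous (fun ω : {ω // δ ω < d} => δ ω) (δ (ι b) - 1))
    (hpw : ∀ j b, aeval (fun ω : {ω // δ ω < d} => Ult.mk 𝓤 (w ω)) (p j b) =
      Ult.mk 𝓤 fun i => pderiv (j i) (w (ι b) i))
    (c : β → F) (hc : c ≠ 0) (hrel : ∀ j, ∑ b, c b * aeval z (p j b) = 0) : False := by
  classical
  obtain ⟨V, hV, k, l, hl, hk, hmem⟩ := exists_linear_relation_of_isAlgebraic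
    (δ := fun ω : {ω // δ ω < d} => δ ω) (fun ω => h.pos ω) z B V₀ hB hV₀ hBV halg
    (fun b => δ (ι b) - 1) p hp c hc hrel
  have hk' : ∀ b, l b ≠ 0 → δ (ι b) = k + 1 := fun b hb => by
    have := hk b hb
    have := h.pos (ι b)
    omega
  obtain ⟨b₀, hb₀⟩ := Function.ne_iff.1 hl
  let V' : Set {ω // δ ω < d} := V ∩ {ω | δ ω < k + 1}
  have hmem' : ∀ j, ∑ b, l b • p j b ∈ Ideal.span (X '' V') := by
    intro j
    have hhom : (∑ b, l b • p j b).IsWeightedHomogeneous (fun ω : {ω // δ ω < d} => δ ω) k := by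
      refine IsWeightedHomogeneous.sum _ _ _ fun b _ => ?_
      by_cases hb : l b = 0
      · rw [hb, zero_smul]
        exact isWeightedHomogeneous_zero _ _ _
      · rw [← hk b hb]
        exact (weightedHomogeneousSubmodule _ _ _).smul_mem _ (hp j b)
    rw [mem_ideal_span_X_image]
    intro u hu
    obtain ⟨ω, hω, hne⟩ := mem_ideal_span_X_image.1 (hmem j) u hu
    refine ⟨ω, ⟨hω, ?_⟩, hne⟩
    have h1 := Finsupp.le_weight_of_ne_zero' (fun ω : {ω // δ ω < d} => δ ω) hne
    rw [hhom (mem_support_iff.1 hu)] at h1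
    exact Nat.lt_succ_of_le h1
  let x : Π i, PolyFam N K i := ∑ b, fun i => (l b).rep i • if l b = 0 then 0 else w (ι b) i
  have hxi : ∀ i, x i = ∑ b, (l b).rep i • if l b = 0 then 0 else w (ι b) i := fun i =>
    Ult.sum_apply _ _ _
  have hx : Ult.mk 𝓤 x = ∑ b, l b • Ult.mk 𝓤 (w (ι b)) := by
    rw [map_sum]
    refine Finset.sum_congr rfl fun b _ => ?_
    rw [← Ult.smul_mk, Ult.mk_rep]
    split_ifs with hb
    · rw [hb, zero_smul, zero_smul]
    · rfl
  have hdec := hβ b₀ x (fun i => ?_) (Subtype.val '' V') ((hV.inter_of_left _).image _) ?_ ?_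
  · have key := h.indep (k + 1) (Finset.univ.image ι) (fun ω => if hω : ∃ b, ι b = ω then l hω.choose else 0)
    have hch : ∀ b, (if hω : ∃ b', ι b' = ι b then l hω.choose else 0) = l b := by
      intro b
      have hex : ∃ b', ι b' = ι b := ⟨b, rfl⟩
      rw [dif_pos hex, hι hex.choose_spec]
    rw [Finset.sum_image hι.injOn, Finset.forall_mem_image, Finset.forall_mem_image] at key
    simp only [hch] at key
    rw [← hx, ← hk' b₀ hb₀] at key
    exact hb₀ (key (fun b _ hb => (hk' b hb).trans (hk' b₀ hb₀).symm) hdec (Finset.mem_univ b₀))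
  · rw [hxi]
    refine IsHomogeneous.sum _ _ _ fun b _ => (homogeneousSubmodule _ _ _).smul_mem _ ?_
    split_ifs with hb
    · exact zero_mem _
    · rw [hk' b₀ hb₀, ← hk' b hb]
      exact h.hom _ _
  · rintro _ ⟨ω, hω, rfl⟩
    rw [hk' b₀ hb₀]
    exact hω.2
  · intro j
    have h1 : Ult.mk 𝓤 (fun i => pderiv (j i) (x i)) =
        aeval (fun ω : {ω // δ ω < d} => Ult.mk 𝓤 (w ω)) (∑ b, l b • p j b) := by
      have h2 : (fun i => pderiv (j i) (x i)) = ∑ b, fun i => (l b).rep i • pderiv (j i)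
          (if l b = 0 then 0 else w (ι b) i) := by
        ext1 i
        rw [Ult.sum_apply, hxi, map_sum]
        exact Finset.sum_congr rfl fun b _ => (pderiv (j i)).map_smul _ _
      rw [h2, map_sum, map_sum]
      refine Finset.sum_congr rfl fun b _ => ?_
      rw [← Ult.smul_mk, Ult.mk_rep, map_smul, hpw]
      split_ifs with hb
      · rw [hb, zero_smul, zero_smul]
      · rfl
    rw [h1]
    have h3 := Ideal.mem_map_of_mem (aeval (fun ω : {ω // δ ω < d} => Ult.mk 𝓤 (w ω))) (hmem' j)
    rw [Ideal.map_span, ← Set.image_comp] at h3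
    rw [← Set.image_comp]
    convert h3 using 2
    refine Set.image_congr fun ω _ => ?_
    simp

end Generators

end Stillman

namespace Stillman
open MvPolynomial Filter

section Regular

variable {N : ℕ} {K : Type*} [Field K] {Ω : Type*}

lemma rename_val_mem_span_X {T : Set Ω} {S : Set Ω} {q : MvPolynomial T K}
    (h : q ∈ Ideal.span (X '' (Subtype.val ⁻¹' S))) :
    rename Subtype.val q ∈ Ideal.span (X '' S : Set (MvPolynomial Ω K)) := by
  have h1 := Ideal.mem_map_of_mem (rename Subtype.val : MvPolynomial T K →ₐ[K] MvPolynomial Ω K) h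
  rw [Ideal.map_span, ← Set.image_comp] at h1
  refine Ideal.span_mono ?_ h1
  rintro _ ⟨t, ht, rfl⟩
  exact ⟨t, ht, (rename_X _ _).symm⟩

lemma isWeightedHomogeneous_of_rename {T : Set Ω} {δ : Ω → ℕ} {n : ℕ} {q : MvPolynomial T K}
    (h : (rename Subtype.val q).IsWeightedHomogeneous δ n) :
    q.IsWeightedHomogeneous (fun t : T => δ t) n := by
  intro u hu
  rw [← coeff_rename_mapDomain Subtype.val Subtype.val_injective] at hu
  rw [← h hu, Finsupp.weight_apply, Finsupp.weight_apply,
    Finsupp.sum_mapDomain_index (by simp) (by intros; rw [add_smul])]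

lemma Good.mem_span_of_mul_mem {w : Ω → MvPolynomial (Fin N) K} {δ : Ω → ℕ} (hδ : ∀ ω, 0 < δ ω)
    (hw : ∀ ω, (w ω).IsHomogeneous (δ ω)) {T : Set Ω} (hT : T.Finite)
    (hgood : Good fun t : T => w t) {V V' : Set Ω} (hV : V ⊆ V') (hV' : V' ⊆ T)
    {G H : MvPolynomial Ω K} (hGT : (G.vars : Set Ω) ⊆ V') (hHT : (H.vars : Set Ω) ⊆ T)
    (hG : G ∉ Ideal.span (X '' V)) (hH : H ∉ Ideal.span (X '' V')) {n : ℕ}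
    (hHn : H.IsWeightedHomogeneous δ n) :
    (∀ f, aeval w G * f ∈ Ideal.span (w '' V) → f ∈ Ideal.span (w '' V)) ∧
    ∀ f, aeval w H * f ∈ Ideal.span (w '' V) ⊔ Ideal.span {aeval w G} →
      f ∈ Ideal.span (w '' V) ⊔ Ideal.span {aeval w G} := by
  have := hT.to_subtype
  have hflat := hgood.flat (fun t => δ t) (fun t => hδ t) fun t => hw t
  obtain ⟨G', rfl⟩ := exists_rename_eq_of_vars_subset_range G (Subtype.val : T → Ω)
    Subtype.val_injective (by rw [Subtype.range_val]; exact hGT.trans hV')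
  obtain ⟨H', rfl⟩ := exists_rename_eq_of_vars_subset_range H (Subtype.val : T → Ω)
    Subtype.val_injective (by rw [Subtype.range_val]; exact hHT)
  have hX : ∀ t : T, (aeval fun t : T => w t : MvPolynomial T K →ₐ[K] _).toRingHom (X t) = w t :=
    fun t => aeval_X (fun t : T => w t) t
  have hev : ∀ q : MvPolynomial T K,
      aeval w (rename Subtype.val q) = (aeval fun t : T => w t : MvPolynomial T K →ₐ[K] _).toRingHom q := fun q => by
    rw [aeval_rename]
    rfl
  generalize (aeval fun t : T => w t : MvPolynomial T K →ₐ[K] _).toRingHom = φ at *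
  have hmap : (Ideal.span (X '' (Subtype.val ⁻¹' V : Set T)) : Ideal (MvPolynomial T K)).map φ =
      Ideal.span (w '' V) := by
    rw [Ideal.map_span, ← Set.image_comp]
    congr 1
    ext y
    constructor
    · rintro ⟨t, ht, rfl⟩
      exact ⟨t, ht, (hX t).symm⟩
    · rintro ⟨ω, hω, rfl⟩
      exact ⟨⟨ω, hV' (hV hω)⟩, hω, hX _⟩
  have hmap' : (Ideal.span (X '' (Subtype.val ⁻¹' V : Set T)) ⊔ Ideal.span {G'} :
      Ideal (MvPolynomial T K)).map φ =
      Ideal.span (w '' V) ⊔ Ideal.span {aeval w (rename Subtype.val G')} := by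
    rw [Ideal.map_sup, hmap, Ideal.map_span, Set.image_singleton, hev]
  rw [hmap'.symm, hmap.symm, hev, hev]
  refine ⟨fun f hf => mem_map_of_mul_mem_of_flat hflat (fun a ha => ?_) hf,
    fun f hf => mem_map_of_mul_mem_of_flat hflat (fun a ha => ?_) hf⟩
  · exact mem_span_X_of_mul_mem (fun h => hG (rename_val_mem_span_X h)) ha
  · refine mem_span_X_sup_of_mul_mem (fun t : T => hδ t) (T := Subtype.val ⁻¹' V')
      (Set.preimage_mono hV) ?_ (fun h => hH (rename_val_mem_span_X h))
      (isWeightedHomogeneous_of_rename hHn) ha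
    classical
    intro t ht
    refine hGT ?_
    have ht' : t ∈ G'.vars := ht
    rw [vars_def, Multiset.mem_toFinset] at ht'
    rw [Finset.mem_coe, vars_def, Multiset.mem_toFinset,
      degrees_rename_of_injective Subtype.val_injective]
    exact Multiset.mem_map_of_mem _ ht'

lemma homogeneousComponent_pow_char {p : ℕ} [Fact p.Prime] [CharP K p]
    (G : MvPolynomial (Fin N) K) (a : ℕ) :
    homogeneousComponent (a * p) (G ^ p) = homogeneousComponent a G ^ p := by
  have : ExpChar K p := .prime Fact.out
  have hp : 0 < p := (Fact.out : p.Prime).pos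
  conv_lhs => rw [← sum_homogeneousComponent G, sum_pow_char, map_sum]
  have h : ∀ k, homogeneousComponent (a * p) (homogeneousComponent k G ^ p) =
      if k = a then homogeneousComponent a G ^ p else 0 := by
    intro k
    have hk : homogeneousComponent k G ^ p ∈ homogeneousSubmodule (Fin N) K (k * p) :=
      (homogeneousComponent_isHomogeneous k G).pow p
    rw [homogeneousComponent_of_mem hk]
    by_cases hka : k = a
    · rw [hka, if_pos rfl, if_pos rfl]
    · rw [if_neg hka, if_neg fun h => hka (Nat.eq_of_mul_eq_mul_right hp h).symm]
  simp only [h]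
  rw [Finset.sum_ite_eq']
  split_ifs with ha
  · rfl
  · rw [homogeneousComponent_eq_zero _ _ (by rw [Finset.mem_range] at ha; omega), zero_pow hp.ne']

end Regular

section Decomposable

variable {𝓤 : Ultrafilter ℕ} {N : ℕ → ℕ} {K : ℕ → Type u} [∀ i, Field (K i)]
  {Ω : Type v} {w : Ω → Π i, PolyFam N K i} {δ : Ω → ℕ}

lemma mk_mem_dec_of_mem_span (hδ : ∀ ω, 0 < δ ω) (hw : ∀ ω i, (w ω i).IsHomogeneous (δ ω)) {e : ℕ}
    {x : Π i, PolyFam N K i} (hx : ∀ i, (x i).IsHomogeneous e) {V : Set Ω} (hV : V.Finite)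
    (hVe : ∀ v ∈ V, δ v < e)
    (h : ∀ᶠ i in 𝓤, x i ∈ Ideal.span ((fun ω => w ω i) '' V)) : Ult.mk 𝓤 x ∈ Dec 𝓤 N K e := by
  classical
  lift V to Finset Ω using hV
  have h1 : ∀ i, ∃ a : Ω → PolyFam N K i, (∀ v, (a v).IsHomogeneous (e - δ v)) ∧
      (x i ∈ Ideal.span ((fun ω => w ω i) '' (V : Set Ω)) → x i = ∑ v ∈ V, w v i * a v) := by
    intro i
    by_cases hi : x i ∈ Ideal.span ((fun ω => w ω i) '' (V : Set Ω))
    · obtain ⟨c, hc⟩ := (Submodule.mem_span_image_finset_iff_exists_fun' _).1 hi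
      refine ⟨fun v => homogeneousComponent (e - δ v) (c v),
        fun v => homogeneousComponent_isHomogeneous _ _, fun _ => ?_⟩
      have hxe : x i ∈ homogeneousSubmodule (Fin (N i)) (K i) e := hx i
      have h2 := homogeneousComponent_of_mem (m := e) hxe
      rw [if_pos rfl, ← hc, map_sum] at h2
      rw [← hc, ← h2]
      refine Finset.sum_congr rfl fun v hv => ?_
      rw [smul_eq_mul, mul_comm, homogeneousComponent_mul_of_le (hw v i) (hVe v hv).le]
    · exact ⟨0, fun v => isHomogeneous_zero _ _ _, fun h => absurd h hi⟩
  choose a ha hxa using h1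
  have h2 : Ult.mk 𝓤 x = ∑ v ∈ V, Ult.mk 𝓤 (w v * fun i => a i v) := by
    rw [← map_sum, Ult.mk_eq_mk]
    filter_upwards [h] with i hi
    rw [Ult.sum_apply, hxa i hi]
    rfl
  rw [h2]
  refine Submodule.sum_mem _ fun v hv => Submodule.subset_span ?_
  have := hVe v hv
  exact ⟨δ v, e - δ v, _, _, hδ v, by omega, by omega, hw v, fun i => ha i v, rfl⟩

lemma mk_mem_dec_of_sub_pow_mem_span (hδ : ∀ ω, 0 < δ ω)
    (hw : ∀ ω i, (w ω i).IsHomogeneous (δ ω)) {e : ℕ} (he : 0 < e)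
    {x : Π i, PolyFam N K i} (hx : ∀ i, (x i).IsHomogeneous e) {V : Set Ω} (hV : V.Finite)
    (hVe : ∀ v ∈ V, δ v < e) {p : ℕ} [hp : Fact p.Prime] (hpe : p ∣ e) (hc : ∀ᶠ i in 𝓤, CharP (K i) p)
    (h : ∀ᶠ i in 𝓤, ∃ G, x i - G ^ p ∈ Ideal.span ((fun ω => w ω i) '' V)) :
    Ult.mk 𝓤 x ∈ Dec 𝓤 N K e := by
  obtain ⟨a, rfl⟩ := hpe
  have ha : 0 < a := Nat.pos_of_mul_pos_left he
  have h1 : ∀ i, ∃ g : PolyFam N K i, g.IsHomogeneous a ∧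
      ((CharP (K i) p ∧ ∃ G, x i - G ^ p ∈ Ideal.span ((fun ω => w ω i) '' V)) →
        x i - g ^ p ∈ Ideal.span ((fun ω => w ω i) '' V)) := by
    intro i
    by_cases hi : CharP (K i) p ∧ ∃ G, x i - G ^ p ∈ Ideal.span ((fun ω => w ω i) '' V)
    · obtain ⟨hcp, G, hG⟩ := hi
      refine ⟨homogeneousComponent a G, homogeneousComponent_isHomogeneous _ _, fun _ => ?_⟩
      have h2 := homogeneousComponent_mem_span (s := (fun ω => w ω i) '' V)
        (by rintro _ ⟨ω, _, rfl⟩; exact ⟨_, hw ω i⟩) rfl hG (p * a)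
      have hxe : x i ∈ homogeneousSubmodule (Fin (N i)) (K i) (p * a) := hx i
      rwa [map_sub, homogeneousComponent_of_mem hxe, if_pos rfl, mul_comm p a,
        homogeneousComponent_pow_char] at h2
    · exact ⟨0, isHomogeneous_zero _ _ _, fun h => absurd h hi⟩
  choose g hg hgx using h1
  have hp2 := hp.out.two_le
  have hgp : ∀ i, (g i ^ p).IsHomogeneous (p * a) := fun i => by
    rw [mul_comm]
    exact (hg i).pow p
  rw [← sub_add_cancel x (fun i => g i ^ p), map_add]
  refine add_mem (mk_mem_dec_of_mem_span hδ hw (fun i => (hx i).sub (hgp i)) hV hVe ?_) ?_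
  · filter_upwards [hc, h] with i h1 h2
    exact hgx i ⟨h1, h2⟩
  · refine Submodule.subset_span ⟨a, a * (p - 1), g, fun i => g i ^ (p - 1), ha,
      Nat.mul_pos ha (by omega), ?_, hg, fun i => (hg i).pow _, ?_⟩
    · obtain ⟨q, rfl⟩ : ∃ q, p = q + 1 := ⟨p - 1, by omega⟩
      rw [Nat.add_sub_cancel]
      ring
    · congr 1
      ext1 i
      exact mul_pow_sub_one (by omega) (g i)

end Decomposable

end Stillman

namespace Stillman
open MvPolynomial Filter

lemma exists_vec_of_det_eq_zero {F V J : Type*} [Field F] [Fintype V] [DecidableEq V]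
    (r : J → V → F) (h : ∀ j : V → J, (Matrix.of fun a v => r (j a) v).det = 0) :
    ∃ c : V → F, c ≠ 0 ∧ ∀ j, ∑ v, c v * r j v = 0 := by
  by_cases htop : Submodule.span F (Set.range r) = ⊤
  · exfalso
    obtain ⟨f, hf, -, hli⟩ := Submodule.exists_fun_fin_finrank_span_eq F (Set.range r)
    have hcard : Module.finrank F (Submodule.span F (Set.range r)) = Fintype.card V := by
      rw [htop, finrank_top, Module.finrank_fintype_fun_eq_card]
    let ε : V ≃ Fin (Module.finrank F (Submodule.span F (Set.range r))) :=
      (Fintype.equivFin V).trans (finCongr hcard.symm)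
    choose j hj using hf
    have h1 := hli.comp ε ε.injective
    have h2 : (Matrix.of fun a v => r (j (ε a)) v).row = f ∘ ε := by
      ext1 a
      exact hj (ε a)
    have h3 := (Matrix.linearIndependent_rows_iff_isUnit
      (A := Matrix.of fun a v => r (j (ε a)) v)).1 (h2 ▸ h1)
    rw [Matrix.isUnit_iff_isUnit_det, h fun a => j (ε a)] at h3
    exact not_isUnit_zero h3
  · obtain ⟨f, hf, hle⟩ := Submodule.exists_le_ker_of_lt_top _ (lt_top_iff_ne_top.2 htop)
    refine ⟨fun v => f (Pi.single v 1), fun h0 => hf ?_, fun j => ?_⟩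
    · ext v
      exact congrFun h0 v
    · have h1 : f (r j) = 0 := hle (Submodule.subset_span ⟨j, rfl⟩)
      rw [LinearMap.pi_apply_eq_sum_univ] at h1
      rw [← h1]
      refine Finset.sum_congr rfl fun v _ => ?_
      rw [mul_comm, smul_eq_mul]
      congr 1
      refine congrArg f (funext fun v' => ?_)
      simp [Pi.single_apply, eq_comm]

lemma Good.comp_equiv {N : ℕ} {K β γ : Type*} [Field K] {w : β → MvPolynomial (Fin N) K}
    (h : Good w) (e : γ ≃ β) : Good (w ∘ e) := by
  obtain ⟨s, u, hs, hu, hfin⟩ := h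
  refine ⟨s, u, by rw [Nat.card_congr e, hs], hu, ?_⟩
  rwa [EquivLike.range_comp w e]

section Jacobian

variable {𝓤 : Ultrafilter ℕ} {N : ℕ → ℕ} {K : ℕ → Type u} [∀ i, Field (K i)]
  {Ω : Type v} {w : Ω → Π i, PolyFam N K i} {δ : Ω → ℕ}

lemma IsGen.exists_jacMinor [DecidableEq Ω] (h : IsGen 𝓤 w δ) {e : ℕ} {V : Finset Ω}
    (hV : ∀ v ∈ V, δ v < e) (hB : ∀ v ∈ V, DerivDec 𝓤 w δ (δ v))
    {V' : Set {ω // δ ω < e}} (hV' : V'.Finite) :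
    ∃ (j : V → Π i, Fin (N i)) (P : MvPolynomial {ω // δ ω < e} (Ult 𝓤 K)) (n : ℕ),
      P.IsWeightedHomogeneous (fun ω : {ω // δ ω < e} => δ ω) n ∧ P ∉ Ideal.span (X '' V') ∧
      ∀ᶠ i in 𝓤, jacMinor (fun v : V => w v i) (fun a => j a i) =
        aeval (fun ω : {ω // δ ω < e} => w ω i) (liftPoly P i) := by
  classical
  choose p hp hpw using fun (j : Π i, Fin (N i)) (v : V) => h.exists_aeval_pderiv (hV v v.2).le j
  have key : ∃ j : V → Π i, Fin (N i),
      (Matrix.of fun a v => p (j a) v).det ∉ Ideal.span (X '' V') := by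
    by_contra! hcon
    let A := MvPolynomial {ω // δ ω < e} (Ult 𝓤 K)
    let F := FractionRing A
    let z : {ω // δ ω < e} → F := fun ω => if ω ∈ V' then 0 else algebraMap A F (X ω)
    have hz0 : ∀ q ∈ Ideal.span (X '' V' : Set A), aeval z q = 0 := by
      intro q hq
      have hle : Ideal.span (X '' V' : Set A) ≤ RingHom.ker (aeval z : A →ₐ[Ult 𝓤 K] F) := by
        rw [Ideal.span_le]
        rintro _ ⟨ω, hω, rfl⟩
        change aeval z (X ω) = 0
        rw [aeval_X]
        exact if_pos hω
      exact hle hq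
    obtain ⟨c, hc, hrel⟩ := exists_vec_of_det_eq_zero (fun j v => aeval z (p j v)) (fun j => by
      have h1 := hz0 _ (hcon j)
      rw [AlgHom.map_det] at h1
      exact h1)
    refine h.false_of_relation (Subtype.val : V → Ω) Subtype.val_injective
      (fun v => hB v v.2) z V'ᶜ V' ?_ hV' (by rw [compl_compl]) ?_ p hp hpw c hc hrel
    · have h1 := ((MvPolynomial.algebraicIndependent_X {ω // δ ω < e} (Ult 𝓤 K)).map'
        (f := IsScalarTower.toAlgHom (Ult 𝓤 K) A F) (IsFractionRing.injective A F)).comp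
        (Subtype.val : (V'ᶜ : Set _) → _) Subtype.val_injective
      have h2 : (fun b : (V'ᶜ : Set _) => z b) =
          (IsScalarTower.toAlgHom (Ult 𝓤 K) A F ∘ X) ∘ Subtype.val := funext fun b => if_neg b.2
      rw [h2]
      exact h1
    · intro v hv
      have : z v = 0 := if_pos hv
      rw [this]
      exact isAlgebraic_zero
  obtain ⟨j, hj⟩ := key
  refine ⟨j, _, ∑ v : V, (δ v - 1), ?_, hj, ?_⟩
  · rw [Matrix.det_apply]
    refine IsWeightedHomogeneous.sum _ _ _ fun σ _ => ?_
    rw [Units.smul_def]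
    refine (weightedHomogeneousSubmodule (Ult 𝓤 K)
      (fun ω : {ω // δ ω < e} => δ ω) _).toAddSubgroup.zsmul_mem ?_ _
    exact IsWeightedHomogeneous.prod _ _ _ fun v _ => hp _ _
  · rw [← Ult.mk_eq_mk, ← aeval_mk, AlgHom.map_det]
    have h1 : (fun i => jacMinor (fun v : V => w v i) (fun a => j a i)) =
        (Matrix.of fun (a v : V) => fun i => pderiv (j a i) (w v i)).det := by
      ext1 i
      exact ((Pi.evalRingHom (PolyFam N K) i).map_det
        (Matrix.of fun (a v : V) => fun i => pderiv (j a i) (w v i))).symm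
    rw [h1, RingHom.map_det]
    congr 1
    ext a v
    exact (hpw _ _).symm

/-- The implication from goodness of generators of degree less than `e` to the decomposability of
forms of degree `e` all of whose derivatives lie in an ideal of generators of smaller degree. -/
theorem IsGen.derivDec [∀ i, PerfectField (K i)] (h : IsGen 𝓤 w δ) (hN : ∀ i, 0 < N i) {e : ℕ}
    (he : 0 < e) (hG : GoodBelow 𝓤 w δ e) (hB : ∀ e', 0 < e' → e' < e → DerivDec 𝓤 w δ e') :
    DerivDec 𝓤 w δ e := by
  classical
  intro x hx V hV hVe hder
  have hsat : ∀ᶠ i in 𝓤, ∀ k, pderiv k (x i) ∈ Ideal.span ((fun ω => w ω i) '' V) := by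
    have h1 : ∀ i, ∃ j : Fin (N i), pderiv j (x i) ∈ Ideal.span ((fun ω => w ω i) '' V) →
        ∀ k, pderiv k (x i) ∈ Ideal.span ((fun ω => w ω i) '' V) := by
      intro i
      by_cases hi : ∀ k, pderiv k (x i) ∈ Ideal.span ((fun ω => w ω i) '' V)
      · exact ⟨⟨0, hN i⟩, fun _ => hi⟩
      · obtain ⟨j, hj⟩ := not_forall.1 hi
        exact ⟨j, fun h => absurd h hj⟩
    choose j hj using h1
    filter_upwards [(Ult.mk_mem_span hV).1 (hder j)] with i hi
    exact hj i hi
  by_cases he0 : ((e : ℕ) : Ult 𝓤 K) = 0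
  swap
  · refine mk_mem_dec_of_mem_span h.pos h.hom hx hV hVe ?_
    have h2 : ∀ᶠ i in 𝓤, (e : K i) ≠ 0 := by
      refine Ultrafilter.eventually_not.2 fun h0 => he0 ?_
      rw [← map_natCast (Ult.mk 𝓤) e, Ult.mk_eq_zero]
      exact h0
    filter_upwards [hsat, h2] with i hi hei
    have h3 := (hx i).sum_X_mul_pderiv
    have h4 : x i = C ((e : K i)⁻¹) * ∑ k, X k * pderiv k (x i) := by
      rw [h3, nsmul_eq_mul, ← mul_assoc, ← map_natCast (C : K i →+* PolyFam N K i), ← C_mul,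
        inv_mul_cancel₀ hei, C_1, one_mul]
    rw [h4]
    exact Ideal.mul_mem_left _ _ (Ideal.sum_mem _ fun k _ => Ideal.mul_mem_left _ _ (hi k))
  obtain ⟨p, hp, hpe, hp0⟩ : ∃ p, p.Prime ∧ p ∣ e ∧ ((p : ℕ) : Ult 𝓤 K) = 0 := by
    obtain ⟨p, hchar⟩ := CharP.exists (Ult 𝓤 K)
    have hpe : p ∣ e := (CharP.cast_eq_zero_iff _ p e).1 he0
    have hp0 : p ≠ 0 := fun h0 => he.ne' (zero_dvd_iff.1 (h0 ▸ hpe))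
    exact ⟨p, (CharP.char_is_prime_or_zero (Ult 𝓤 K) p).resolve_right hp0, hpe, CharP.cast_eq_zero _ _⟩
  have : Fact p.Prime := ⟨hp⟩
  have hchar : ∀ᶠ i in 𝓤, CharP (K i) p := by
    rw [← map_natCast (Ult.mk 𝓤) p, Ult.mk_eq_zero] at hp0
    filter_upwards [hp0] with i hi
    exact (CharP.charP_iff_prime_eq_zero hp).2 hi
  lift V to Finset Ω using hV
  let V₁ : Set {ω // δ ω < e} := Subtype.val ⁻¹' (V : Set Ω)
  have hV₁ : V₁.Finite := V.finite_toSet.preimage Subtype.val_injective.injOn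
  have hBV : ∀ v ∈ V, DerivDec 𝓤 w δ (δ v) := fun v hv => hB _ (h.pos v) (hVe v hv)
  obtain ⟨j, P, m, hP, hPV, hPj⟩ := h.exists_jacMinor hVe hBV hV₁
  let V₂ : Set {ω // δ ω < e} := V₁ ∪ P.vars
  have hV₂ : V₂.Finite := hV₁.union P.vars.finite_toSet
  obtain ⟨j', P', m', hP', hPV', hPj'⟩ := h.exists_jacMinor hVe hBV hV₂
  let T : Set {ω // δ ω < e} := V₂ ∪ P'.vars
  have hT : T.Finite := hV₂.union P'.vars.finite_toSet
  refine mk_mem_dec_of_sub_pow_mem_span h.pos h.hom he hx V.finite_toSet hVe hpe hchar ?_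
  have hgood := hG (Subtype.val '' T) (hT.image _) (by rintro _ ⟨ω, -, rfl⟩; exact ω.2)
  filter_upwards [hsat, hchar, hPj, hPj', hgood, eventually_liftPoly_notMem_span_X hPV,
    eventually_liftPoly_notMem_span_X hPV'] with i hi hci hji hji' hgi hni hni'
  have hgi' : Good fun t : T => w t i :=
    hgi.comp_equiv (Equiv.Set.image Subtype.val T Subtype.val_injective)
  have hspan : Ideal.span ((fun ω : {ω // δ ω < e} => w ω i) '' V₁) =
      Ideal.span (Set.range fun v : V => w v i) := by
    congr 1
    ext y
    constructor
    · rintro ⟨ω, hω, rfl⟩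
      exact ⟨⟨ω, hω⟩, rfl⟩
    · rintro ⟨v, rfl⟩
      exact ⟨⟨v, hVe v v.2⟩, v.2, rfl⟩
  have hspan' : Ideal.span ((fun ω => w ω i) '' (V : Set Ω)) =
      Ideal.span (Set.range fun v : V => w v i) := by
    rw [Set.image_eq_range]
    rfl
  obtain ⟨hnz, hnz'⟩ := Good.mem_span_of_mul_mem (w := fun ω : {ω // δ ω < e} => w ω i)
    (δ := fun ω : {ω // δ ω < e} => δ ω) (fun ω => h.pos ω) (fun ω => h.hom ω i) hT hgi'
    (V := V₁) (V' := V₂) Set.subset_union_left Set.subset_union_left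
    (G := liftPoly P i) (H := liftPoly P' i)
    ((Finset.coe_subset.2 (vars_liftPoly_subset P i)).trans Set.subset_union_right)
    ((Finset.coe_subset.2 (vars_liftPoly_subset P' i)).trans Set.subset_union_right)
    hni hni' (liftPoly_isWeightedHomogeneous hP' i)
  rw [← hji, hspan] at hnz
  rw [← hji, ← hji', hspan] at hnz'
  rw [hspan'] at hi ⊢
  exact exists_sub_pow_mem _ _ _ hnz hnz' hi

end Jacobian

end Stillman

namespace Stillman
open MvPolynomial Filter

lemma isAlgebraic_subalgebra_iff {K F : Type*} [CommRing K] [Field F] [Algebra K F]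
    {A : Subalgebra K F} {x : F} :
    IsAlgebraic A x ↔ ∃ f : Polynomial F, f ≠ 0 ∧ (∀ n, f.coeff n ∈ A) ∧ f.eval x = 0 := by
  have hinj : Function.Injective (algebraMap A F) := Subtype.val_injective
  constructor
  · rintro ⟨p, hp, hpx⟩
    refine ⟨p.map (algebraMap A F), ?_, fun n => ?_, ?_⟩
    · rwa [Ne, Polynomial.map_eq_zero_iff hinj]
    · rw [Polynomial.coeff_map]
      exact (p.coeff n).2
    · rw [Polynomial.eval_map_algebraMap, hpx]
  · rintro ⟨f, hf, hfA, hfx⟩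
    have h1 : f ∈ Polynomial.lifts (algebraMap A F) :=
      (Polynomial.lifts_iff_coeff_lifts f).2 fun n => ⟨⟨_, hfA n⟩, rfl⟩
    obtain ⟨p, hp⟩ := (Polynomial.mem_lifts f).1 h1
    refine ⟨p, ?_, ?_⟩
    · rintro rfl
      exact hf (by rw [← hp, Polynomial.map_zero])
    · rw [← Polynomial.eval_map_algebraMap, hp, hfx]

lemma exists_finite_of_mem_adjoin {K F Ω : Type*} [CommRing K] [CommRing F] [Algebra K F]
    {z : Ω → F} {S : Set Ω} {x : F} (hx : x ∈ Algebra.adjoin K (z '' S)) :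
    ∃ T ⊆ S, T.Finite ∧ x ∈ Algebra.adjoin K (z '' T) := by
  have mono {T T' : Set Ω} (h : T ⊆ T') : Algebra.adjoin K (z '' T) ≤ Algebra.adjoin K (z '' T') :=
    Algebra.adjoin_mono (Set.image_mono h)
  induction hx using Algebra.adjoin_induction with
  | mem x hx =>
    obtain ⟨ω, hω, rfl⟩ := hx
    exact ⟨{ω}, Set.singleton_subset_iff.2 hω, Set.finite_singleton _,
      Algebra.subset_adjoin ⟨ω, rfl, rfl⟩⟩
  | algebraMap r => exact ⟨∅, Set.empty_subset _, Set.finite_empty, Subalgebra.algebraMap_mem _ _⟩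
  | add x y _ _ h1 h2 =>
    obtain ⟨T, hT, hTf, hx⟩ := h1
    obtain ⟨T', hT', hTf', hy⟩ := h2
    exact ⟨T ∪ T', Set.union_subset hT hT', hTf.union hTf',
      add_mem (mono Set.subset_union_left hx) (mono Set.subset_union_right hy)⟩
  | mul x y _ _ h1 h2 =>
    obtain ⟨T, hT, hTf, hx⟩ := h1
    obtain ⟨T', hT', hTf', hy⟩ := h2
    exact ⟨T ∪ T', Set.union_subset hT hT', hTf.union hTf',
      mul_mem (mono Set.subset_union_left hx) (mono Set.subset_union_right hy)⟩

lemma exists_finite_of_isAlgebraic_adjoin {K F Ω : Type*} [CommRing K] [Field F] [Algebra K F]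
    {z : Ω → F} {S : Set Ω} {x : F} (hx : IsAlgebraic (Algebra.adjoin K (z '' S)) x) :
    ∃ T ⊆ S, T.Finite ∧ IsAlgebraic (Algebra.adjoin K (z '' T)) x := by
  obtain ⟨f, hf, hfA, hfx⟩ := isAlgebraic_subalgebra_iff.1 hx
  choose T hTS hTf hT using fun n => exists_finite_of_mem_adjoin (hfA n)
  refine ⟨⋃ n ∈ f.support, T n, Set.iUnion₂_subset fun n _ => hTS n,
    f.support.finite_toSet.biUnion fun n _ => hTf n, isAlgebraic_subalgebra_iff.2
      ⟨f, hf, fun n => ?_, hfx⟩⟩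
  by_cases hn : n ∈ f.support
  · exact Algebra.adjoin_mono (Set.image_mono (Set.subset_biUnion_of_mem
      (u := fun n => T n) hn)) (hT n)
  · rw [Polynomial.notMem_support_iff.1 hn]
    exact zero_mem _

lemma isAlgebraic_adjoin_mono {K F : Type*} [CommRing K] [Field F] [Algebra K F]
    {S T : Set F} (h : S ⊆ T) {x : F} (hx : IsAlgebraic (Algebra.adjoin K S) x) :
    IsAlgebraic (Algebra.adjoin K T) x := by
  obtain ⟨f, hf, hfA, hfx⟩ := isAlgebraic_subalgebra_iff.1 hx
  exact isAlgebraic_subalgebra_iff.2 ⟨f, hf, fun n => Algebra.adjoin_mono h (hfA n), hfx⟩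

lemma exists_finite_of_forall_isAlgebraic_adjoin {K F Ω : Type*} [CommRing K] [Field F]
    [Algebra K F] {z : Ω → F} {S E : Set Ω} (hE : E.Finite)
    (h : ∀ e ∈ E, IsAlgebraic (Algebra.adjoin K (z '' S)) (z e)) :
    ∃ T ⊆ S, T.Finite ∧ ∀ e ∈ E, IsAlgebraic (Algebra.adjoin K (z '' T)) (z e) := by
  have h1 : ∀ e, ∃ T ⊆ S, T.Finite ∧ (e ∈ E → IsAlgebraic (Algebra.adjoin K (z '' T)) (z e)) := by
    intro e
    by_cases he : e ∈ E
    · obtain ⟨T, hT, hTf, hTe⟩ := exists_finite_of_isAlgebraic_adjoin (h e he)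
      exact ⟨T, hT, hTf, fun _ => hTe⟩
    · exact ⟨∅, Set.empty_subset _, Set.finite_empty, fun h => absurd h he⟩
  choose T hTS hTf hT using h1
  exact ⟨⋃ e ∈ E, T e, Set.iUnion₂_subset fun e _ => hTS e, hE.biUnion fun e _ => hTf e,
    fun e he => isAlgebraic_adjoin_mono (Set.image_mono (Set.subset_biUnion_of_mem
      (u := fun e => T e) he)) (hT e he)⟩

lemma Ult.eventually_isAlgebraic_adjoin {𝓤 : Ultrafilter ℕ} {A L : ℕ → Type*}
    [∀ i, CommRing (A i)] [∀ i, Field (L i)] [∀ i, Algebra (A i) (L i)] {Ω : Type*}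
    {f : Ω → Π i, L i} {S : Set Ω} {x : Π i, L i}
    (hx : IsAlgebraic (Algebra.adjoin (Ult 𝓤 A) ((fun ω => Ult.mk 𝓤 (f ω)) '' S)) (Ult.mk 𝓤 x)) :
    ∀ᶠ i in 𝓤, IsAlgebraic (Algebra.adjoin (A i) ((fun ω => f ω i) '' S)) (x i) := by
  obtain ⟨p, hp, hpA, hpx⟩ := isAlgebraic_subalgebra_iff.1 hx
  choose g hg hgA using fun n => Ult.exists_of_mem_adjoin (hpA n)
  have hlc : ∀ᶠ i in 𝓤, g p.natDegree i ≠ 0 := by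
    rw [Ultrafilter.eventually_not, ← Ult.mk_eq_zero, hg]
    exact Polynomial.leadingCoeff_ne_zero.2 hp
  have hev : ∀ᶠ i in 𝓤, ∑ n ∈ Finset.range (p.natDegree + 1), g n i * x i ^ n = 0 := by
    have : Ult.mk 𝓤 (∑ n ∈ Finset.range (p.natDegree + 1), g n * x ^ n) = 0 := by
      rw [← hpx, Polynomial.eval_eq_sum_range]
      simp only [map_sum, map_mul, map_pow, hg]
    filter_upwards [Ult.mk_eq_zero.1 this] with i hi
    rw [Ult.sum_apply] at hi
    exact hi
  filter_upwards [hlc, hev] with i h1 h2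
  refine isAlgebraic_subalgebra_iff.2 ⟨∑ n ∈ Finset.range (p.natDegree + 1),
    Polynomial.C (g n i) * Polynomial.X ^ n, fun h => h1 ?_, fun n => ?_, ?_⟩
  · have := congrArg (Polynomial.coeff · p.natDegree) h
    simpa [Polynomial.finsetSum_coeff, Polynomial.coeff_C_mul, Polynomial.coeff_X_pow] using this
  · simp only [Polynomial.finsetSum_coeff, Polynomial.coeff_C_mul, Polynomial.coeff_X_pow]
    refine sum_mem fun m _ => ?_
    split_ifs
    · rw [mul_one]
      exact hgA m i
    · rw [mul_zero]
      exact zero_mem _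
  · simpa [Polynomial.eval_finsetSum] using h2

/-- A good family cannot become algebraically too dependent on the points of a subvariety of
large dimension. -/
theorem Good.card_add_le_of_algHom {N : ℕ} {K L β : Type*} [Field K] [Field L] [Algebra K L]
    [Finite β] {w : β → MvPolynomial (Fin N) K} (h : Good w)
    (δ : β → ℕ) (hδ : ∀ b, 0 < δ b) (hw : ∀ b, (w b).IsHomogeneous (δ b))
    (φ : MvPolynomial (Fin N) K →ₐ[K] L) (E : Set β)
    (hE : ∀ b ∈ E, IsAlgebraic (Algebra.adjoin K ((fun b => φ (w b)) '' Eᶜ)) (φ (w b)))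
    {s : ℕ} (y : Fin s → MvPolynomial (Fin N) K)
    (hy : AlgebraicIndependent K fun j => φ (y j)) : s + Nat.card E ≤ N := by
  have : (RingHom.ker φ).IsPrime := RingHom.ker_isPrime _
  set Q := RingHom.ker φ with hQ
  let ψ : (MvPolynomial (Fin N) K ⧸ Q) →ₐ[K] L := Ideal.kerLiftAlg φ
  have hψ : Function.Injective ψ := Ideal.kerLiftAlg_injective φ
  have hψm : ∀ r, ψ (Ideal.Quotient.mk Q r) = φ r := fun r => rfl
  refine h.card_add_le δ hδ hw Q E (fun b hb => ?_) y ?_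
  · have himg : (Algebra.adjoin K ((fun b => Ideal.Quotient.mk Q (w b)) '' Eᶜ)).map ψ =
        Algebra.adjoin K ((fun b => φ (w b)) '' Eᶜ) := by
      rw [AlgHom.map_adjoin, ← Set.image_comp]
      rfl
    have hb' := hE b hb
    rw [← himg] at hb'
    let e := Subalgebra.equivMapOfInjective
      (Algebra.adjoin K ((fun b => Ideal.Quotient.mk Q (w b)) '' Eᶜ)) ψ hψ
    refine IsAlgebraic.of_ringHom_of_comp_eq (e : _ →+* _) (ψ : _ →+* L) (a := _) hb' ?_ ?_ ?_
    · exact e.surjective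
    · exact hψ
    · rfl
  · exact (ψ.algebraicIndependent_iff hψ).1 hy

end Stillman

namespace Stillman
open MvPolynomial Filter

lemma exists_algebraicIndepOn_forall_isAlgebraic {K F Ω : Type*} [Field K] [Field F] [Algebra K F]
    (z : Ω → F) : ∃ B : Set Ω, AlgebraicIndepOn K z B ∧
      ∀ ω, IsAlgebraic (Algebra.adjoin K (z '' B)) (z ω) := by
  obtain ⟨u, -, ⟨hu, huz⟩, hmax⟩ := exists_maximal_algebraicIndependent (R := K) ∅ (Set.range z)
    (Set.empty_subset _) (algebraicIndependent_empty (K := K) (A := F))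
  choose g hg using fun x : u => huz x.2
  have himg : z '' Set.range g = u := by
    rw [← Set.range_comp]
    have : z ∘ g = Subtype.val := funext hg
    rw [this, Subtype.range_coe]
  refine ⟨Set.range g, ?_, fun ω => ?_⟩
  · have h1 : ∀ b : Set.range g, z b ∈ u := fun b => himg.subset ⟨b, b.2, rfl⟩
    refine hu.comp (fun b : Set.range g => (⟨z b, h1 b⟩ : u)) ?_
    rintro ⟨_, x, rfl⟩ ⟨_, y, rfl⟩ hxy
    have hxy' : z (g x) = z (g y) := congrArg Subtype.val hxy
    rw [hg, hg] at hxy'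
    rw [Subtype.ext hxy']
  · rw [himg]
    by_contra hω
    have hins : AlgebraicIndepOn K id (insert (z ω) u) := hu.insert (by
      rw [Set.image_id]
      exact hω)
    have hmem : z ω ∈ u := hmax ⟨hins, Set.insert_subset ⟨ω, rfl⟩ huz⟩ (Set.subset_insert _ _)
      (Set.mem_insert _ _)
    exact hω (isAlgebraic_algebraMap
      (⟨z ω, Algebra.subset_adjoin hmem⟩ : Algebra.adjoin K u))

variable {𝓤 : Ultrafilter ℕ} {N : ℕ → ℕ} {K : ℕ → Type u} [∀ i, Field (K i)]
  {Ω : Type v} {w : Ω → Π i, PolyFam N K i} {δ : Ω → ℕ}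

lemma aeval_mk_algHom {L : ℕ → Type u} [∀ i, Field (L i)] [∀ i, Algebra (K i) (L i)]
    (φ : ∀ i, PolyFam N K i →ₐ[K i] L i) {p : MvPolynomial Ω (Ult 𝓤 K)} {f : Π i, PolyFam N K i}
    (h : aeval (fun ω => Ult.mk 𝓤 (w ω)) p = Ult.mk 𝓤 f) :
    aeval (fun ω => Ult.mk 𝓤 fun i => φ i (w ω i)) p = Ult.mk 𝓤 fun i => φ i (f i) := by
  rw [aeval_mk, Ult.mk_eq_mk] at h
  rw [aeval_mk, Ult.mk_eq_mk]
  filter_upwards [h] with i hi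
  rw [← hi, comp_aeval_apply]

/-- Points of subvarieties of too large dimension at which the Jacobian of a family of generators
degenerates cannot exist almost everywhere. -/
theorem IsGen.false_of_algHom (h : IsGen 𝓤 w δ) {d : ℕ} (hG : GoodBelow 𝓤 w δ d)
    (hB : ∀ e, 0 < e → e ≤ d → DerivDec 𝓤 w δ e) (V : Finset Ω) (hV : ∀ v ∈ V, δ v ≤ d)
    (L : ℕ → Type u) [∀ i, Field (L i)] [∀ i, Algebra (K i) (L i)]
    (φ : ∀ i, PolyFam N K i →ₐ[K i] L i)
    (hdim : ∀ᶠ i in 𝓤, ∃ (s : ℕ) (y : Fin s → PolyFam N K i), N i < s + V.card ∧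
      AlgebraicIndependent (K i) fun j => φ i (y j))
    (c : V → Π i, L i) (hc : ∀ᶠ i in 𝓤, ∃ v, c v i ≠ 0)
    (hrel : ∀ᶠ i in 𝓤, ∀ j, ∑ v, c v i * φ i (pderiv j (w v i)) = 0) : False := by
  classical
  let z : {ω // δ ω < d} → Ult 𝓤 L := fun ω => Ult.mk 𝓤 fun i => φ i (w ω i)
  obtain ⟨B, hBi, hBa⟩ := exists_algebraicIndepOn_forall_isAlgebraic (K := Ult 𝓤 K) z
  rcases Set.finite_or_infinite Bᶜ with hfin | hinf
  · obtain ⟨B₀, hB₀, hB₀f, hB₀a⟩ := exists_finite_of_forall_isAlgebraic_adjoin hfin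
      fun e _ => hBa e
    have hinter : (Bᶜ ∪ B₀) ∩ B = B₀ := by
      rw [Set.union_inter_distrib_right, Set.compl_inter_self, Set.empty_union,
        Set.inter_eq_left.2 hB₀]
    choose p hp hpw using fun (j : Π i, Fin (N i)) (v : V) =>
      h.exists_aeval_pderiv (hV v v.2) j
    refine h.false_of_relation (Subtype.val : V → Ω) Subtype.val_injective
      (fun v => hB _ (h.pos v) (hV v v.2)) z B (Bᶜ ∪ B₀) hBi (hfin.union hB₀f)
      Set.subset_union_left ?_ p hp hpw (fun v => Ult.mk 𝓤 (c v)) ?_ ?_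
    · rw [hinter]
      rintro v (hv | hv)
      · exact hB₀a v hv
      · exact isAlgebraic_algebraMap
          (⟨z v, Algebra.subset_adjoin ⟨v, hv, rfl⟩⟩ : Algebra.adjoin (Ult 𝓤 K) (z '' B₀))
    · intro h0
      have h1 : ∀ᶠ i in 𝓤, ∀ v, c v i = 0 :=
        eventually_all.2 fun v => Ult.mk_eq_zero.1 (congrFun h0 v)
      obtain ⟨i, ⟨v, hv⟩, hi⟩ := (hc.and h1).exists
      exact hv (hi v)
    · intro j
      have h1 : ∀ v : V, aeval z (p j v) = Ult.mk 𝓤 fun i => φ i (pderiv (j i) (w v i)) :=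
        fun v => aeval_mk_algHom φ (hpw j v)
      simp only [h1, ← map_mul, ← map_sum]
      rw [Ult.mk_eq_zero]
      filter_upwards [hrel] with i hi
      rw [Ult.sum_apply]
      exact hi (j i)
  · obtain ⟨E, hE, hEc⟩ := hinf.exists_subset_card_eq V.card
    obtain ⟨B₀, hB₀, hB₀f, hB₀a⟩ := exists_finite_of_forall_isAlgebraic_adjoin E.finite_toSet
      fun e _ => hBa e
    have hWf : (B₀ ∪ E : Set {ω // δ ω < d}).Finite := hB₀f.union E.finite_toSet
    have : Finite (B₀ ∪ E : Set {ω // δ ω < d}) := hWf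
    have hgood := hG (Subtype.val '' (B₀ ∪ E : Set {ω // δ ω < d})) (hWf.image _) (by
      rintro _ ⟨v, -, rfl⟩
      exact v.2)
    have halg : ∀ᶠ i in 𝓤, ∀ e ∈ E, IsAlgebraic (Algebra.adjoin (K i)
        ((fun ω : {ω // δ ω < d} => φ i (w ω i)) '' B₀)) (φ i (w e i)) :=
      (eventually_all_finset E).2 fun e he => Ult.eventually_isAlgebraic_adjoin
        (f := fun (ω : {ω // δ ω < d}) i => φ i (w ω i)) (hB₀a e he)
    obtain ⟨i, ⟨s, y, hs, hy⟩, hg, ha⟩ := (hdim.and (hgood.and halg)).exists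
    have hg' : Good fun v : (B₀ ∪ E : Set {ω // δ ω < d}) => w v i :=
      hg.comp_equiv (Equiv.Set.image Subtype.val _ Subtype.val_injective)
    have hle := hg'.card_add_le_of_algHom (fun v => δ v) (fun v => h.pos v) (fun v => h.hom v i)
      (φ i) (Subtype.val ⁻¹' (E : Set {ω // δ ω < d})) (fun v hv => ?_) y hy
    · have hcard : Nat.card (Subtype.val ⁻¹' (E : Set {ω // δ ω < d}) :
          Set (B₀ ∪ E : Set {ω // δ ω < d})) = V.card := by
        rw [← hEc, Nat.card_coe_set_eq, Set.ncard_preimage_of_injective_subset_range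
          Subtype.val_injective, Set.ncard_coe_finset]
        rw [Subtype.range_coe]
        exact Set.subset_union_right
      omega
    · refine isAlgebraic_adjoin_mono ?_ (ha v hv)
      rintro _ ⟨b, hb, rfl⟩
      exact ⟨⟨b, Or.inl hb⟩, fun hbE => hE hbE (hB₀ hb), rfl⟩

end Stillman

namespace Stillman
open MvPolynomial Filter

/-- A family of forms that is not good degenerates, together with its Jacobian, at the generic
point of a subvariety of large dimension. -/
lemma exists_algHom_of_not_good {n : ℕ} {k : Type u} {β : Type*} [Field k] [IsAlgClosed k]
    [Fintype β] {y : β → MvPolynomial (Fin n) k} (δ : β → ℕ) (hδ : ∀ b, 0 < δ b)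
    (hy : ∀ b, (y b).IsHomogeneous (δ b)) (h : ¬ Good y) :
    ∃ (L : Type u) (_ : Field L) (_ : Algebra k L) (φ : MvPolynomial (Fin n) k →ₐ[k] L),
      (∃ (s : ℕ) (t : Fin s → MvPolynomial (Fin n) k), n < s + Nat.card β ∧
        AlgebraicIndependent k fun j => φ (t j)) ∧
      ∃ c : β → L, (∃ b, c b ≠ 0) ∧ ∀ j, ∑ b, c b * φ (pderiv j (y b)) = 0 := by
  have : Infinite k := IsAlgClosed.instInfinite
  obtain ⟨Q, hQ, hyQ, s, t, hs, ht⟩ := exists_prime_of_not_good δ hδ hy h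
  obtain ⟨c, ⟨b, hb⟩, hc⟩ := exists_relation_pderiv Q y hyQ t ht hs
  let φ : MvPolynomial (Fin n) k →ₐ[k] FractionRing (MvPolynomial (Fin n) k ⧸ Q) :=
    (IsScalarTower.toAlgHom k (MvPolynomial (Fin n) k ⧸ Q)
      (FractionRing (MvPolynomial (Fin n) k ⧸ Q))).comp (Ideal.Quotient.mkₐ k Q)
  have hinj : Function.Injective (IsScalarTower.toAlgHom k (MvPolynomial (Fin n) k ⧸ Q)
      (FractionRing (MvPolynomial (Fin n) k ⧸ Q))) :=
    IsFractionRing.injective (MvPolynomial (Fin n) k ⧸ Q) _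
  have hφ : ∀ r, φ r = 0 ↔ r ∈ Q := fun r => by
    rw [← Ideal.Quotient.eq_zero_iff_mem, ← map_eq_zero_iff _ hinj]
    rfl
  refine ⟨FractionRing (MvPolynomial (Fin n) k ⧸ Q), inferInstance, inferInstance, φ,
    ⟨s, t, hs, (AlgHom.algebraicIndependent_iff _ hinj).2 ht⟩, fun b => φ (c b),
    ⟨b, fun h => hb ((hφ _).1 h)⟩, fun j => ?_⟩
  have h1 := (hφ _).2 (hc j)
  rw [finsum_eq_sum_of_fintype, map_sum] at h1
  simpa only [map_mul] using h1

variable {𝓤 : Ultrafilter ℕ} {N : ℕ → ℕ} {K : ℕ → Type u} [∀ i, Field (K i)]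
  {Ω : Type v} {w : Ω → Π i, PolyFam N K i} {δ : Ω → ℕ}

theorem IsGen.goodBelow_succ [∀ i, IsAlgClosed (K i)] (h : IsGen 𝓤 w δ) {d : ℕ}
    (hG : GoodBelow 𝓤 w δ d) (hB : ∀ e, 0 < e → e ≤ d → DerivDec 𝓤 w δ e) :
    GoodBelow 𝓤 w δ (d + 1) := by
  classical
  intro V hV hVd
  lift V to Finset Ω using hV
  by_contra hbad
  rw [← Ultrafilter.eventually_not] at hbad
  have hex : ∀ i, ∃ (L : Type u) (_ : Field L) (_ : Algebra (K i) L) (φ : PolyFam N K i →ₐ[K i] L)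
      (c : V → L), (¬ Good fun v : V => w v i) →
      (∃ (s : ℕ) (t : Fin s → PolyFam N K i), N i < s + V.card ∧
        AlgebraicIndependent (K i) fun j => φ (t j)) ∧
      (∃ b, c b ≠ 0) ∧ ∀ j, ∑ b, c b * φ (pderiv j (w b i)) = 0 := by
    intro i
    by_cases hi : Good fun v : V => w v i
    · exact ⟨K i, inferInstance, inferInstance, aeval 0, 0, fun h => absurd hi h⟩
    · obtain ⟨L, hL, hA, φ, ⟨s, t, hs, ht⟩, c, hc, hrel⟩ := exists_algHom_of_not_good
        (fun v : V => δ v) (fun v => h.pos v) (fun v => h.hom v i) hi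
      rw [Nat.card_eq_fintype_card, Fintype.card_coe] at hs
      exact ⟨L, hL, hA, φ, c, fun _ => ⟨⟨s, t, hs, ht⟩, hc, hrel⟩⟩
  choose L _ _ φ c hc using hex
  refine h.false_of_algHom hG hB V (fun v hv => Nat.lt_succ_iff.1 (hVd v hv)) L φ ?_
    (fun v i => c i v) ?_ ?_
  · filter_upwards [hbad] with i hi using (hc i hi).1
  · filter_upwards [hbad] with i hi using (hc i hi).2.1
  · filter_upwards [hbad] with i hi using (hc i hi).2.2

/-- Over algebraically closed fields, the generators are eventually as independent as possible. -/
theorem IsGen.goodBelow [∀ i, IsAlgClosed (K i)] (h : IsGen 𝓤 w δ) (hN : ∀ i, 0 < N i) (d : ℕ) :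
    GoodBelow 𝓤 w δ d := by
  have : ∀ i, PerfectField (K i) := fun i => inferInstance
  suffices H : ∀ d, GoodBelow 𝓤 w δ d ∧ ∀ e, 0 < e → e < d → DerivDec 𝓤 w δ e from (H d).1
  intro d
  induction d with
  | zero =>
    refine ⟨fun V _ hV => Eventually.of_forall fun i => ?_, fun e _ he => absurd he (by omega)⟩
    have hV0 : IsEmpty V := ⟨fun v => absurd (hV v v.2) (by omega)⟩
    by_contra hbad
    have : Fintype V := Fintype.ofIsEmpty
    obtain ⟨-, -, -, -, -, c, ⟨b, -⟩, -⟩ := exists_algHom_of_not_good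
      (fun v : V => δ v) (fun v => h.pos v) (fun v => h.hom v i) hbad
    exact hV0.false b
  | succ d ih =>
    have hB : ∀ e, 0 < e → e ≤ d → DerivDec 𝓤 w δ e := by
      intro e he hed
      rcases hed.lt_or_eq with hlt | rfl
      · exact ih.2 e he hlt
      · exact h.derivDec hN he ih.1 ih.2
    exact ⟨h.goodBelow_succ ih.1 hB, fun e he hed => hB e he (Nat.lt_succ_iff.1 hed)⟩

end Stillman

namespace Stillman
open MvPolynomial Filter

/-- The cokernel of a matrix defined over a subring generated by `r` forms that are part of a
system of parameters has projective dimension at most `r`. -/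
lemma Good.pd_coker {N r m n : ℕ} {K : Type u} [Field K] {w : Fin r → MvPolynomial (Fin N) K}
    (h : Good w) (δ : Fin r → ℕ) (hδ : ∀ b, 0 < δ b) (hw : ∀ b, (w b).IsHomogeneous (δ b))
    (Q : Matrix (Fin m) (Fin n) (MvPolynomial (Fin N) K))
    (hQ : ∀ a b, Q a b ∈ (aeval w : MvPolynomial (Fin r) K →ₐ[K] _).range) :
    PD (MvPolynomial (Fin N) K) (Coker Q) r := by
  choose P hP using hQ
  let _ : Algebra (MvPolynomial (Fin r) K) (MvPolynomial (Fin N) K) :=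
    (aeval w : MvPolynomial (Fin r) K →ₐ[K] MvPolynomial (Fin N) K).toRingHom.toAlgebra
  have : Module.Flat (MvPolynomial (Fin r) K) (MvPolynomial (Fin N) K) := h.flat δ hδ hw
  have h1 : (Matrix.of P).map (algebraMap (MvPolynomial (Fin r) K) (MvPolynomial (Fin N) K)) = Q :=
    Matrix.ext hP
  rw [← h1]
  exact pd_coker_map (R := MvPolynomial (Fin N) K) (Matrix.of P) (pd_mvPolynomial K r _)

lemma aeval_mem_adjoin_of_vars_subset {K R Ω : Type*} [CommRing K] [CommRing R] [Algebra K R]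
    (w : Ω → R) {q : MvPolynomial Ω K} {S : Set Ω} (h : (q.vars : Set Ω) ⊆ S) :
    aeval w q ∈ Algebra.adjoin K (w '' S) := by
  classical
  rw [aeval_def, eval₂_eq]
  refine sum_mem fun u hu => mul_mem (Subalgebra.algebraMap_mem _ _)
    (prod_mem fun ω hω => ?_)
  refine pow_mem (Algebra.subset_adjoin (Set.mem_image_of_mem w (h ?_))) _
  exact (mem_vars_iff_mem_support _).2 ⟨u, hu, hω⟩

section Ultraproduct

variable {𝓤 : Ultrafilter ℕ} {N : ℕ → ℕ} {K : ℕ → Type u} [∀ i, Field (K i)]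
  {Ω : Type v} {w : Ω → Π i, PolyFam N K i} {δ : Ω → ℕ}

lemma IsGen.exists_finset_of_isHomogeneous (h : IsGen 𝓤 w δ) {e : ℕ} {f : Π i, PolyFam N K i}
    (hf : ∀ i, (f i).IsHomogeneous e) : ∃ V : Finset Ω,
      ∀ᶠ i in 𝓤, f i ∈ Algebra.adjoin (K i) ((fun ω => w ω i) '' V) := by
  classical
  obtain ⟨p, -, hp⟩ := h.exists_aeval (Nat.lt_succ_self e) hf
  refine ⟨p.vars.image Subtype.val, ?_⟩
  rw [aeval_mk, Ult.mk_eq_mk] at hp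
  filter_upwards [hp] with i hi
  rw [← hi, Finset.coe_image, ← Set.image_comp]
  exact aeval_mem_adjoin_of_vars_subset _ (Finset.coe_subset.2 (vars_liftPoly_subset p i))

lemma IsGen.exists_finset_of_totalDegree_le (h : IsGen 𝓤 w δ) {d : ℕ} {f : Π i, PolyFam N K i}
    (hf : ∀ i, (f i).totalDegree ≤ d) : ∃ V : Finset Ω,
      ∀ᶠ i in 𝓤, f i ∈ Algebra.adjoin (K i) ((fun ω => w ω i) '' V) := by
  classical
  choose V hV using fun e => h.exists_finset_of_isHomogeneous
    (fun i => homogeneousComponent_isHomogeneous e (f i))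
  refine ⟨(Finset.range (d + 1)).biUnion V, ?_⟩
  filter_upwards [(eventually_all_finset (Finset.range (d + 1))).2 fun e _ => hV e] with i hi
  rw [← sum_homogeneousComponent (f i), Finset.sum_subset (Finset.range_mono
    (Nat.succ_le_succ (hf i))) fun e _ he => homogeneousComponent_eq_zero _ _ (by
      simpa using he)]
  refine sum_mem fun e he => Algebra.adjoin_mono (Set.image_mono ?_) (hi e he)
  exact Finset.coe_subset.2 (Finset.subset_biUnion_of_mem V he)

/-- In a sequence of matrices of fixed size and degree over polynomial rings over algebraically
closed fields, the projective dimensions of the cokernels are bounded almost everywhere. -/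
theorem exists_eventually_pd_coker (𝓤 : Ultrafilter ℕ) [∀ i, IsAlgClosed (K i)]
    (hN : ∀ i, 0 < N i) {m n d : ℕ} (𝓜 : ∀ i, Matrix (Fin m) (Fin n) (PolyFam N K i))
    (h𝓜 : ∀ i a b, (𝓜 i a b).totalDegree ≤ d) :
    ∃ r, ∀ᶠ i in 𝓤, PD (PolyFam N K i) (Coker (𝓜 i)) r := by
  classical
  obtain ⟨Ω, w, δ, h⟩ := exists_isGen 𝓤 N K
  choose V hV using fun (a : Fin m) (b : Fin n) =>
    h.exists_finset_of_totalDegree_le fun i => h𝓜 i a b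
  let W : Finset Ω := Finset.univ.biUnion fun a => Finset.univ.biUnion fun b => V a b
  have hVW : ∀ a b, V a b ⊆ W := fun a b =>
    (Finset.subset_biUnion_of_mem (V a) (Finset.mem_univ b)).trans
      (Finset.subset_biUnion_of_mem (fun a => Finset.univ.biUnion fun b => V a b)
        (Finset.mem_univ a))
  refine ⟨W.card, ?_⟩
  have hgood := h.goodBelow hN (W.sup δ + 1) W W.finite_toSet
    fun v hv => Nat.lt_succ_of_le (Finset.le_sup hv)
  filter_upwards [hgood, eventually_all.2 fun a => eventually_all.2 (hV a)] with i hg hi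
  let e : Fin W.card ≃ (W : Set Ω) := W.equivFin.symm
  refine (hg.comp_equiv e).pd_coker (fun k => δ (e k)) (fun k => h.pos _) (fun k => h.hom _ i) _
    fun a b => ?_
  rw [← Algebra.adjoin_range_eq_range_aeval]
  refine Algebra.adjoin_mono ?_ (hi a b)
  rintro _ ⟨ω, hω, rfl⟩
  exact ⟨e.symm ⟨ω, hVW a b hω⟩, by simp⟩

end Ultraproduct

/-- The bound on projective dimensions over algebraically closed fields. -/
theorem exists_pd_coker_of_isAlgClosed (m n d : ℕ) : ∃ C : ℕ, ∀ (K : Type u) [Field K]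
    [IsAlgClosed K] (N : ℕ) (𝓜 : Matrix (Fin m) (Fin n) (MvPolynomial (Fin N) K)),
      (∀ a b, (𝓜 a b).totalDegree ≤ d) → PD (MvPolynomial (Fin N) K) (Coker 𝓜) C := by
  by_contra! H
  choose K _ _ N 𝓜 h𝓜 hpd using H
  have hN : ∀ i, 0 < N i := fun i => Nat.pos_of_ne_zero fun h0 =>
    hpd i (pd_mono (by omega) (pd_mvPolynomial (K i) (N i) _))
  obtain ⟨r, hr⟩ := exists_eventually_pd_coker (hyperfilter ℕ) hN 𝓜 h𝓜
  have hlarge : ∀ᶠ i in (hyperfilter ℕ : Filter ℕ), r ≤ i :=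
    (Nat.hyperfilter_le_atTop (eventually_ge_atTop r))
  obtain ⟨i, h1, h2⟩ := (hr.and hlarge).exists
  exact hpd i (pd_mono h2 h1)

lemma totalDegree_map_le {K L σ : Type*} [CommRing K] [CommRing L] (f : K →+* L)
    (p : MvPolynomial σ K) : (MvPolynomial.map f p).totalDegree ≤ p.totalDegree :=
  Finset.sup_mono (support_map_subset f p)

theorem exists_projDimLE_coker (m n d : ℕ) : ∃ C : ℕ, ∀ (K : Type u) [Field K] (N : ℕ)
    (𝓜 : Matrix (Fin m) (Fin n) (MvPolynomial (Fin N) K)), (∀ a b, (𝓜 a b).totalDegree ≤ d) →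
      ProjDimLE (MvPolynomial (Fin N) K) (C + 1) (Coker 𝓜) := by
  obtain ⟨C, hC⟩ := exists_pd_coker_of_isAlgClosed m n d
  refine ⟨C, fun K _ N 𝓜 h𝓜 => projDimLE_of_pd (pd_mono (Nat.le_succ C)
    (pd_coker_of_field_extension (L := AlgebraicClosure K) 𝓜 (hC _ N _ fun a b => ?_)))⟩
  exact (totalDegree_map_le _ _).trans (h𝓜 a b)

end Stillman

/-- **Stillman's conjecture.** There is a function `C`, independent of `N` and of
the field `K`, such that for every field `K`, every `N`, and every `m × n` matrix over
`K[x_1, …, x_N]` with entries of degree at most `d`, the cokernel of the induced map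
`R^n → R^m` has projective dimension at most `C m n d`. -/
theorem statement7 :
    ∃ C : ℕ → ℕ → ℕ → ℕ, (∀ m n d, 0 < C m n d) ∧
      ∀ (K : Type u) [Field K] (N m n d : ℕ), 0 < m → 0 < n →
        ∀ 𝓜 : Matrix (Fin m) (Fin n) (MvPolynomial (Fin N) K),
          (∀ i j, (𝓜 i j).totalDegree ≤ d) →
          ProjDimLE (MvPolynomial (Fin N) K) (C m n d)
            ((Fin m → MvPolynomial (Fin N) K) ⧸ LinearMap.range 𝓜.mulVecLin) := by
  choose C hC using Stillman.exists_projDimLE_coker.{u}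
  exact ⟨fun m n d => C m n d + 1, fun _ _ _ => Nat.succ_pos _,
    fun K _ N m n d _ _ 𝓜 h𝓜 => hC m n d K N 𝓜 h𝓜⟩
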